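/- (Sufficiency of the integral test for the lower class at 0.) Let ξ : (0, e^e] → (0, ∞) be a nondecreasing continuous function. If the function t ↦ ξ(t)/t^{H+θ} is bounded on (0, e^e] and the integral I₀(ξ) := ∫₀^{e^e} (ξ(t)/t^{H+θ})^{−1/β} · φ(ξ(t)/t^{H+θ}) · dt/t is finite, then ξ belongs to the lower-lower class of M at 0, i.e. almost surely there exists t₀ > 0 such that M(t) ≥ ξ(t) for every t ∈ (0, t₀). -/

import Mathlib

open MeasureTheory ProbabilityTheory Real Set Filter

/-- A process is a centered Gaussian process if every finite linear combination of its
values has a centered Gaussian distribution. -/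
def IsCenteredGaussianProcess {Ω : Type*} [MeasurableSpace Ω] (P : Measure Ω)
    (X : ℝ → Ω → ℝ) : Prop :=
  ∀ (n : ℕ) (t : Fin n → ℝ) (c : Fin n → ℝ), ∃ v : NNReal,
    P.map (fun ω => ∑ i, c i * X (t i) ω) = ProbabilityTheory.gaussianReal 0 v

/-- The covariance function of the generalized fractional Brownian motion:
`E[X s X t] = ∫_ℝ ((s−u)₊^α − (−u)₊^α)((t−u)₊^α − (−u)₊^α)|u|^{−γ} du`. -/
noncomputable def gfbmCov (α γ s t : ℝ) : ℝ :=
  ∫ u : ℝ, ((max (s - u) 0) ^ α - (max (-u) 0) ^ α) *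
    ((max (t - u) 0) ^ α - (max (-u) 0) ^ α) * |u| ^ (-γ)

/-- `X` is a generalized fractional Brownian motion with parameters `(α, γ)` under `P`. -/
def IsGFBM {Ω : Type*} [MeasurableSpace Ω] (P : Measure Ω) (α γ : ℝ)
    (X : ℝ → Ω → ℝ) : Prop :=
  IsCenteredGaussianProcess P X ∧
  (∀ ω, ContinuousOn (fun t => X t ω) (Set.Ici 0)) ∧
  (∀ ω, X 0 ω = 0) ∧
  (∀ s t : ℝ, 0 ≤ s → 0 ≤ t → ∫ ω, X s ω * X t ω ∂P = gfbmCov α γ s t)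

/-- The fractional integral `Y(t) = (1/Γ(θ)) ∫₀^t (t−u)^{θ−1} X(u) du` of a process `X`. -/
noncomputable def fracInt {Ω : Type*} (θ : ℝ) (X : ℝ → Ω → ℝ) (t : ℝ) (ω : Ω) : ℝ :=
  (Real.Gamma θ)⁻¹ * ∫ u in (0:ℝ)..t, (t - u) ^ (θ - 1) * X u ω

/-- The running maximum `M(t) = sup_{0 ≤ s ≤ t} |Y(s)|`. -/
noncomputable def runSup {Ω : Type*} (Y : ℝ → Ω → ℝ) (t : ℝ) (ω : Ω) : ℝ :=
  ⨆ s : Set.Icc (0:ℝ) t, |Y s.1 ω|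

/-- The small ball function `φ(ε) = P(M(1) ≤ ε)`. -/
noncomputable def smallBall {Ω : Type*} [MeasurableSpace Ω] (P : Measure Ω)
    (Y : ℝ → Ω → ℝ) (ε : ℝ) : ℝ :=
  (P {ω | runSup Y 1 ω ≤ ε}).toReal

namespace LowerClass
open scoped ENNReal NNReal Topology Pointwise MatrixOrder
set_option linter.unusedSectionVars false

/-- The one-dimensional Brunn–Minkowski inequality for compact sets. -/
lemma brunn_minkowski_compact {K L C : Set ℝ} {l : ℝ} (hl0 : 0 < l) (hl1 : l < 1)
    (hK : IsCompact K) (hL : IsCompact L) (hKn : K.Nonempty) (hLn : L.Nonempty)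
    (hsub : ∀ x ∈ K, ∀ y ∈ L, (1 - l) * x + l * y ∈ C) :
    ENNReal.ofReal (1 - l) * volume K + ENNReal.ofReal l * volume L ≤ volume C := by
  obtain ⟨x0, hx0, hx0m⟩ := hK.exists_isMaxOn hKn continuousOn_id
  obtain ⟨y0, hy0, hy0m⟩ := hL.exists_isMinOn hLn continuousOn_id
  have hK' : IsCompact ((fun x => (1 - l) * x + l * y0) '' K) := hK.image (by fun_prop)
  have hL' : IsCompact ((fun y => (1 - l) * x0 + l * y) '' L) := hL.image (by fun_prop)
  have hv : ∀ (c d : ℝ) (_ : 0 < c) (S : Set ℝ),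
      volume ((fun x => c * x + d) '' S) = ENNReal.ofReal c * volume S := by
    intro c d hc S
    have : (fun x => c * x + d) '' S = (fun x => x + d) '' (c • S) := by
      ext z; simp [Set.mem_smul_set, ← eq_sub_iff_add_eq, sub_eq_add_neg]
    rw [this]
    simp only [Set.image_add_right, measure_preimage_add_right]
    rw [Measure.addHaar_smul]
    simp [abs_of_pos hc]
  have h1 := hv (1 - l) (l * y0) (by linarith) K
  have h2 := hv l ((1 - l) * x0) hl0 L
  have h2' : (fun y => (1 - l) * x0 + l * y) '' L = (fun x => l * x + (1 - l) * x0) '' L := by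
    congr 1; ext y; ring
  rw [← h2'] at h2
  rw [← h1, ← h2, ← measure_union₀ hL'.measurableSet.nullMeasurableSet]
  · apply measure_mono
    rintro z (⟨x, hx, rfl⟩ | ⟨y, hy, rfl⟩)
    · exact hsub x hx y0 hy0
    · exact hsub x0 hx0 y hy
  · refine measure_mono_null (t := {(1 - l) * x0 + l * y0}) ?_ (by simp)
    rintro z ⟨⟨x, hx, rfl⟩, ⟨y, hy, h⟩⟩
    have a1 : x ≤ x0 := hx0m hx
    have a2 : y0 ≤ y := hy0m hy
    simp only [Set.mem_singleton_iff]
    simp only at h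
    nlinarith

/-- The one-dimensional Brunn–Minkowski inequality. -/
lemma brunn_minkowski_real {A B C : Set ℝ} {l : ℝ} (hl0 : 0 < l) (hl1 : l < 1)
    (hA : MeasurableSet A) (hB : MeasurableSet B) (hAn : A.Nonempty) (hBn : B.Nonempty)
    (hsub : ∀ x ∈ A, ∀ y ∈ B, (1 - l) * x + l * y ∈ C) :
    ENNReal.ofReal (1 - l) * volume A + ENNReal.ofReal l * volume B ≤ volume C := by
  obtain ⟨x0, hx0⟩ := hAn
  obtain ⟨y0, hy0⟩ := hBn
  rw [hA.measure_eq_iSup_isCompact volume, hB.measure_eq_iSup_isCompact volume]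
  simp only [ENNReal.mul_iSup]
  have hne : ∀ S : Set ℝ, ∃ K, K ⊆ S ∧ IsCompact K := fun S => ⟨∅, empty_subset _, isCompact_empty⟩
  simp only [iSup_and']
  refine ENNReal.biSup_add_biSup_le' (hne A) (hne B) ?_
  intro K ⟨hKA, hK⟩ L ⟨hLB, hL⟩
  refine le_trans ?_ (brunn_minkowski_compact hl0 hl1 (hK.union (isCompact_singleton (x := x0)))
    (hL.union (isCompact_singleton (x := y0))) ⟨x0, by simp⟩ ⟨y0, by simp⟩ (C := C) ?_)
  · gcongr <;> exact subset_union_left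
  · rintro x hx y hy
    refine hsub x ?_ y ?_
    · rcases hx with h | h
      · exact hKA h
      · rw [h]; exact hx0
    · rcases hy with h | h
      · exact hLB h
      · rw [h]; exact hy0

lemma ennreal_geom_le_arith {l : ℝ} (hl0 : 0 < l) (hl1 : l < 1) (A B : ℝ≥0∞) :
    A ^ (1 - l) * B ^ l ≤ ENNReal.ofReal (1 - l) * A + ENNReal.ofReal l * B := by
  have h1 : 0 < 1 - l := by linarith
  have hpq : (1 - l)⁻¹.HolderConjugate l⁻¹ := by
    rw [Real.holderConjugate_iff]
    refine ⟨by rw [one_lt_inv₀ h1]; linarith, by simp⟩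
  have := ENNReal.young_inequality (A ^ (1 - l)) (B ^ l) hpq
  rw [← ENNReal.rpow_mul, ← ENNReal.rpow_mul, mul_inv_cancel₀ h1.ne', mul_inv_cancel₀ hl0.ne',
    ENNReal.rpow_one, ENNReal.rpow_one, ENNReal.ofReal_inv_of_pos h1,
    ENNReal.ofReal_inv_of_pos hl0, ENNReal.div_eq_inv_mul, ENNReal.div_eq_inv_mul, inv_inv,
    inv_inv] at this
  exact this

/-- Prékopa–Leindler on the line for functions with supremum one. -/
lemma prekopa_leindler_sup_one {f g h : ℝ → ℝ} {l : ℝ} (hl0 : 0 < l) (hl1 : l < 1)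
    (hf : Measurable f) (hg : Measurable g) (hh : Measurable h)
    (hf0 : ∀ x, 0 ≤ f x) (hg0 : ∀ x, 0 ≤ g x) (hh0 : ∀ x, 0 ≤ h x)
    (hf1 : ∀ x, f x ≤ 1) (hg1 : ∀ x, g x ≤ 1)
    (hfs : ∀ t < 1, ∃ x, t < f x) (hgs : ∀ t < 1, ∃ x, t < g x)
    (H : ∀ x y, f x ^ (1 - l) * g y ^ l ≤ h ((1 - l) * x + l * y)) :
    ENNReal.ofReal (1 - l) * (∫⁻ x, ENNReal.ofReal (f x)) +
      ENNReal.ofReal l * (∫⁻ x, ENNReal.ofReal (g x)) ≤ ∫⁻ x, ENNReal.ofReal (h x) := by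
  have key : ∀ f : ℝ → ℝ, Measurable f → (∀ x, 0 ≤ f x) → (∀ x, f x ≤ 1) →
      ∫⁻ x, ENNReal.ofReal (f x) = ∫⁻ t in Ioo (0:ℝ) 1, volume {a | t < f a} := by
    intro f hf hf0 hf1
    rw [lintegral_eq_lintegral_meas_lt _ (ae_of_all _ hf0) hf.aemeasurable]
    rw [← Ioo_union_Ici_eq_Ioi (zero_lt_one' ℝ), lintegral_union measurableSet_Ici
      (by rw [Set.disjoint_left]; intro x hx hx'; exact absurd hx.2 (not_lt.2 hx'))]
    rw [setLIntegral_congr_fun (g := fun _ => 0) measurableSet_Ici]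
    · simp
    · intro t ht
      have : {a | t < f a} = ∅ := by
        ext a; simp only [mem_ofPred_eq, mem_empty_iff_false, iff_false, not_lt]
        exact (hf1 a).trans ht
      simp [this]
  have meas : ∀ f : ℝ → ℝ, Measurable (fun t => volume {a | t < f a}) := by
    intro f
    apply Antitone.measurable
    intro s t hst
    exact measure_mono (fun a ha => lt_of_le_of_lt hst ha)
  rw [key f hf hf0 hf1, key g hg hg0 hg1, lintegral_eq_lintegral_meas_lt _ (ae_of_all _ hh0)
    hh.aemeasurable, ← lintegral_const_mul _ (meas f), ← lintegral_const_mul _ (meas g),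
    ← lintegral_add_left ((meas f).const_mul _)]
  refine le_trans (setLIntegral_mono' measurableSet_Ioo ?_) (lintegral_mono_set Ioo_subset_Ioi_self)
  intro t ht
  refine brunn_minkowski_real hl0 hl1 (measurableSet_lt measurable_const hf)
    (measurableSet_lt measurable_const hg) (hfs t ht.2) (hgs t ht.2) ?_
  intro x hx y hy
  refine lt_of_lt_of_le ?_ (H x y)
  have e : t = t ^ (1 - l) * t ^ l := by
    rw [← Real.rpow_add ht.1]; simp
  rw [e]
  exact mul_lt_mul'' (Real.rpow_lt_rpow ht.1.le hx (by linarith)) (Real.rpow_lt_rpow ht.1.le hy hl0)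
    (Real.rpow_nonneg ht.1.le _) (Real.rpow_nonneg ht.1.le _)

/-- Prékopa–Leindler on the line. -/
lemma prekopa_leindler_real {f g h : ℝ → ℝ} {l : ℝ} (hl0 : 0 < l) (hl1 : l < 1)
    (hf : Measurable f) (hg : Measurable g) (hh : Measurable h)
    (hf0 : ∀ x, 0 ≤ f x) (hg0 : ∀ x, 0 ≤ g x) (hh0 : ∀ x, 0 ≤ h x)
    (hf1 : BddAbove (range f)) (hg1 : BddAbove (range g))
    (H : ∀ x y, f x ^ (1 - l) * g y ^ l ≤ h ((1 - l) * x + l * y)) :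
    (∫⁻ x, ENNReal.ofReal (f x)) ^ (1 - l) * (∫⁻ x, ENNReal.ofReal (g x)) ^ l
      ≤ ∫⁻ x, ENNReal.ofReal (h x) := by
  have h1l : 0 < 1 - l := by linarith
  by_cases hfz : ∀ x, f x = 0
  · simp [hfz, h1l]
  by_cases hgz : ∀ x, g x = 0
  · simp [hgz, hl0]
  push Not at hfz hgz
  set a := ⨆ x, f x with ha
  set b := ⨆ x, g x with hb
  have hfa : ∀ x, f x ≤ a := fun x => le_ciSup hf1 x
  have hgb : ∀ x, g x ≤ b := fun x => le_ciSup hg1 x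
  have ha0 : 0 < a := by
    obtain ⟨x, hx⟩ := hfz
    exact lt_of_lt_of_le (lt_of_le_of_ne (hf0 x) hx.symm) (hfa x)
  have hb0 : 0 < b := by
    obtain ⟨x, hx⟩ := hgz
    exact lt_of_lt_of_le (lt_of_le_of_ne (hg0 x) hx.symm) (hgb x)
  set c := a ^ (1 - l) * b ^ l with hc
  have hc0 : 0 < c := by positivity
  have sc : ∀ (f : ℝ → ℝ) (a : ℝ), 0 < a →
      ∫⁻ x, ENNReal.ofReal (f x) = ENNReal.ofReal a * ∫⁻ x, ENNReal.ofReal (f x / a) := by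
    intro f a ha
    rw [← lintegral_const_mul' _ _ ENNReal.ofReal_ne_top]
    congr 1; ext x
    rw [← ENNReal.ofReal_mul ha.le]
    congr 1; field_simp
  rw [sc f a ha0, sc g b hb0, sc h c hc0]
  have P := prekopa_leindler_sup_one (f := fun x => f x / a) (g := fun x => g x / b)
    (h := fun x => h x / c) hl0 hl1 (hf.div_const _) (hg.div_const _) (hh.div_const _)
    (fun x => div_nonneg (hf0 x) ha0.le) (fun x => div_nonneg (hg0 x) hb0.le)
    (fun x => div_nonneg (hh0 x) hc0.le)
    (fun x => (div_le_one ha0).2 (hfa x)) (fun x => (div_le_one hb0).2 (hgb x))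
    (fun t ht => by
      obtain ⟨x, hx⟩ := exists_lt_of_lt_ciSup (show t * a < ⨆ x, f x by nlinarith)
      exact ⟨x, (lt_div_iff₀ ha0).2 hx⟩)
    (fun t ht => by
      obtain ⟨x, hx⟩ := exists_lt_of_lt_ciSup (show t * b < ⨆ x, g x by nlinarith)
      exact ⟨x, (lt_div_iff₀ hb0).2 hx⟩)
    (fun x y => by
      rw [Real.div_rpow (hf0 x) ha0.le, Real.div_rpow (hg0 y) hb0.le, div_mul_div_comm]
      exact div_le_div_of_nonneg_right (H x y) hc0.le)
  have := (ennreal_geom_le_arith hl0 hl1 _ _).trans P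
  rw [ENNReal.mul_rpow_of_nonneg _ _ h1l.le, ENNReal.mul_rpow_of_nonneg _ _ hl0.le,
    ENNReal.ofReal_rpow_of_pos ha0, ENNReal.ofReal_rpow_of_pos hb0, mul_mul_mul_comm,
    ← ENNReal.ofReal_mul (by positivity)]
  gcongr

/-- The Prékopa–Leindler property of a measure. -/
def PL {E : Type*} [AddCommGroup E] [Module ℝ E] [MeasurableSpace E] (μ : Measure E) : Prop :=
  ∀ l : ℝ, 0 < l → l < 1 → ∀ f g h : E → ℝ≥0∞, Measurable f → Measurable g → Measurable h →
    (∀ x, f x ≤ 1) → (∀ x, g x ≤ 1) → (∀ x, h x ≤ 1) →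
    (∀ x y, f x ^ (1 - l) * g y ^ l ≤ h ((1 - l) • x + l • y)) →
    (∫⁻ x, f x ∂μ) ^ (1 - l) * (∫⁻ x, g x ∂μ) ^ l ≤ ∫⁻ x, h x ∂μ

lemma PL.map {E F : Type*} [AddCommGroup E] [Module ℝ E] [MeasurableSpace E]
    [AddCommGroup F] [Module ℝ F] [MeasurableSpace F] {μ : Measure E} (h : PL μ)
    (T : E →ₗ[ℝ] F) (hT : Measurable T) : PL (μ.map T) := by
  intro l hl0 hl1 f g k hf hg hk hf1 hg1 hk1 H
  rw [lintegral_map hf hT, lintegral_map hg hT, lintegral_map hk hT]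
  refine h l hl0 hl1 _ _ _ (hf.comp hT) (hg.comp hT) (hk.comp hT) (fun _ => hf1 _) (fun _ => hg1 _)
    (fun _ => hk1 _) (fun x y => ?_)
  simpa using H (T x) (T y)

lemma PL.prod {E F : Type*} [AddCommGroup E] [Module ℝ E] [MeasurableSpace E]
    [AddCommGroup F] [Module ℝ F] [MeasurableSpace F] {μ : Measure E} {ν : Measure F}
    [IsProbabilityMeasure μ] [IsProbabilityMeasure ν] (hμ : PL μ) (hν : PL ν) :
    PL (μ.prod ν) := by
  intro l hl0 hl1 f g k hf hg hk hf1 hg1 hk1 H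
  rw [lintegral_prod _ hf.aemeasurable, lintegral_prod _ hg.aemeasurable,
    lintegral_prod _ hk.aemeasurable]
  have one : ∀ u : F → ℝ≥0∞, (∀ y, u y ≤ 1) → ∫⁻ y, u y ∂ν ≤ 1 := by
    intro u hu
    calc ∫⁻ y, u y ∂ν ≤ ∫⁻ _, 1 ∂ν := lintegral_mono hu
      _ = 1 := by simp
  refine hμ l hl0 hl1 _ _ _ hf.lintegral_prod_right' hg.lintegral_prod_right'
    hk.lintegral_prod_right' (fun _ => one _ fun _ => hf1 _) (fun _ => one _ fun _ => hg1 _)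
    (fun _ => one _ fun _ => hk1 _) (fun x y => ?_)
  exact hν l hl0 hl1 (fun z => f (x, z)) (fun z => g (y, z)) (fun z => k ((1 - l) • x + l • y, z))
    (by fun_prop) (by fun_prop) (by fun_prop)
    (fun _ => hf1 _) (fun _ => hg1 _) (fun _ => hk1 _) (fun z w => by simpa using H (x, z) (y, w))

lemma PL.gaussianReal_std : PL (gaussianReal 0 1) := by
  intro l hl0 hl1 f g k hf hg hk hf1 hg1 hk1 H
  have h1l : 0 < 1 - l := by linarith
  have e : ∀ f : ℝ → ℝ≥0∞, Measurable f → (∀ x, f x ≤ 1) → ∫⁻ x, f x ∂(gaussianReal 0 1) =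
      ∫⁻ x, ENNReal.ofReal ((f x).toReal * gaussianPDFReal 0 1 x) := by
    intro f hf hf1
    rw [gaussianReal_of_var_ne_zero _ one_ne_zero,
      lintegral_withDensity_eq_lintegral_mul _ (measurable_gaussianPDF 0 1) hf]
    congr 1; ext x
    rw [ENNReal.ofReal_mul ENNReal.toReal_nonneg, ENNReal.ofReal_toReal
      ((hf1 x).trans_lt ENNReal.one_lt_top).ne, mul_comm]
    rfl
  have pb : ∀ x, gaussianPDFReal 0 1 x ≤ (√(2 * π * (1:NNReal)))⁻¹ := by
    intro x
    rw [gaussianPDFReal]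
    refine mul_le_of_le_one_right (by positivity) (Real.exp_le_one_iff.2 ?_)
    rw [neg_div]; simp; positivity
  have t1 : ∀ f : ℝ → ℝ≥0∞, (∀ x, f x ≤ 1) → ∀ x, (f x).toReal ≤ 1 := by
    intro f hf x
    exact ENNReal.toReal_le_of_le_ofReal zero_le_one (by simpa using hf x)
  have bd : ∀ f : ℝ → ℝ≥0∞, (∀ x, f x ≤ 1) →
      BddAbove (range fun x => (f x).toReal * gaussianPDFReal 0 1 x) := by
    intro f hf
    refine ⟨(√(2 * π * (1:NNReal)))⁻¹, ?_⟩
    rintro _ ⟨x, rfl⟩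
    exact (mul_le_of_le_one_left (gaussianPDFReal_nonneg _ _ _) (t1 f hf x)).trans (pb x)
  rw [e f hf hf1, e g hg hg1, e k hk hk1]
  refine prekopa_leindler_real hl0 hl1 (by fun_prop) (by fun_prop) (by fun_prop)
    (fun x => mul_nonneg ENNReal.toReal_nonneg (gaussianPDFReal_nonneg _ _ _))
    (fun x => mul_nonneg ENNReal.toReal_nonneg (gaussianPDFReal_nonneg _ _ _))
    (fun x => mul_nonneg ENNReal.toReal_nonneg (gaussianPDFReal_nonneg _ _ _))
    (bd f hf1) (bd g hg1) ?_
  intro x y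
  rw [Real.mul_rpow ENNReal.toReal_nonneg (gaussianPDFReal_nonneg _ _ _),
    Real.mul_rpow ENNReal.toReal_nonneg (gaussianPDFReal_nonneg _ _ _), mul_mul_mul_comm]
  refine mul_le_mul ?_ ?_ (by positivity [gaussianPDFReal_nonneg 0 1 x, gaussianPDFReal_nonneg 0 1 y]) ENNReal.toReal_nonneg
  · have := ENNReal.toReal_mono ((hk1 _).trans_lt ENNReal.one_lt_top).ne (H x y)
    rw [ENNReal.toReal_mul, ← ENNReal.toReal_rpow, ← ENNReal.toReal_rpow] at this
    simpa using this
  · simp only [gaussianPDFReal]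
    rw [Real.mul_rpow (by positivity) (by positivity), Real.mul_rpow (by positivity) (by positivity),
      mul_mul_mul_comm, ← Real.rpow_add (by positivity), ← Real.exp_mul, ← Real.exp_mul,
      ← Real.exp_add]
    simp only [sub_add_cancel, Real.rpow_one]
    gcongr
    simp only [sub_zero, NNReal.coe_one, mul_one]
    nlinarith [mul_nonneg (mul_nonneg h1l.le hl0.le) (sq_nonneg (x - y))]

lemma PL.pi_gaussian (n : ℕ) : PL (Measure.pi fun _ : Fin n => gaussianReal 0 1) := by
  induction n with
  | zero =>
    intro l hl0 hl1 f g h hf hg hh hf1 hg1 hh1 H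
    rw [Measure.pi_of_empty]
    simp only [lintegral_dirac]
    convert H _ _ using 2
  | succ n ih =>
    have h := (measurePreserving_piFinSuccAbove (fun _ : Fin (n+1) => gaussianReal 0 1) 0).symm
    let T : (ℝ × (Fin n → ℝ)) →ₗ[ℝ] (Fin (n+1) → ℝ) :=
      { toFun := fun p => Fin.cons p.1 p.2
        map_add' := fun p q => by
          ext i; refine Fin.cases ?_ (fun i => ?_) i <;> simp
        map_smul' := fun c p => by
          ext i; refine Fin.cases ?_ (fun i => ?_) i <;> simp }
    have hT : (T : (ℝ × (Fin n → ℝ)) → (Fin (n+1) → ℝ)) =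
        (MeasurableEquiv.piFinSuccAbove (fun _ : Fin (n+1) => ℝ) 0).symm := by
      ext p i
      refine Fin.cases ?_ (fun i => ?_) i <;> simp [T, MeasurableEquiv.piFinSuccAbove]
    rw [← h.map_eq, ← hT]
    exact (PL.gaussianReal_std.prod ih).map T (by rw [hT]; exact MeasurableEquiv.measurable _)

lemma PL.pi_gaussian' (ι : Type*) [Fintype ι] : PL (Measure.pi fun _ : ι => gaussianReal 0 1) := by
  have e := Fintype.equivFin ι
  have h := measurePreserving_piCongrLeft (fun _ : ι => gaussianReal 0 1) e.symm
  have h2 := (PL.pi_gaussian (Fintype.card ι)).map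
    (LinearEquiv.piCongrLeft ℝ (fun _ : ι => ℝ) e.symm : _ ≃ₗ[ℝ] _).toLinearMap
    (MeasurableEquiv.piCongrLeft (fun _ : ι => ℝ) e.symm).measurable
  rw [← h.map_eq]
  exact h2

lemma PL.multivariateGaussian_zero {ι : Type*} [Fintype ι] [DecidableEq ι] (S : Matrix ι ι ℝ) :
    PL (multivariateGaussian 0 S) := by
  have h1 : PL (stdGaussian (EuclideanSpace ℝ ι)) := by
    rw [← map_pi_eq_stdGaussian]
    exact (PL.pi_gaussian' ι).map (WithLp.linearEquiv 2 ℝ (ι → ℝ)).symm.toLinearMap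
      (by change Measurable (WithLp.toLp 2); fun_prop)
  have h2 := h1.map (Matrix.toEuclideanCLM (𝕜 := ℝ) (CFC.sqrt S)).toLinearMap
    (by change Measurable (Matrix.toEuclideanCLM (𝕜 := ℝ) (CFC.sqrt S)); fun_prop)
  simp only [multivariateGaussian, zero_add]
  exact h2

lemma PL.of_isGaussian {ι : Type*} [Fintype ι] (μ : Measure (EuclideanSpace ℝ ι)) [IsGaussian μ]
    (hm : ∫ x, x ∂μ = 0) : PL μ := by
  classical
  let b := EuclideanSpace.basisFun ι ℝ
  let S : Matrix ι ι ℝ := Matrix.of fun i j => covarianceBilin μ (b i) (b j)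
  have hq : ∀ x y : EuclideanSpace ℝ ι, covarianceBilin μ x y =
      dotProduct (x : ι → ℝ) (Matrix.mulVec S y) := by
    intro x y
    conv_lhs => rw [← b.sum_repr x, ← b.sum_repr y]
    simp only [map_sum, map_smul, sum_apply, smul_apply,
      smul_eq_mul, dotProduct, Matrix.mulVec, S, Matrix.of_apply, Finset.mul_sum]
    rw [Finset.sum_comm]
    refine Finset.sum_congr rfl fun i _ => Finset.sum_congr rfl fun j _ => ?_
    simp [b]; ring
  have hS : S.PosSemidef := by
    refine Matrix.PosSemidef.of_dotProduct_mulVec_nonneg ?_ ?_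
    · ext i j
      simp [S, covarianceBilin_comm]
    · intro x
      have := covarianceBilin_self_nonneg (μ := μ) (WithLp.toLp 2 x)
      rw [hq] at this
      simpa using this
  have : μ = multivariateGaussian 0 S := by
    refine IsGaussian.ext (by simpa using hm) ?_
    ext x y
    rw [hq, covarianceBilin_multivariateGaussian hS]
  rw [this]
  exact PL.multivariateGaussian_zero S

/-- A finite family of random variables is centered jointly Gaussian. -/
def CG {Ω : Type*} [MeasurableSpace Ω] (P : Measure Ω) {ι : Type*} [Fintype ι]
    (Z : ι → Ω → ℝ) : Prop :=
  ∀ c : ι → ℝ, ∃ v : ℝ≥0, P.map (fun ω => ∑ i, c i * Z i ω) = gaussianReal 0 v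

section CG
variable {Ω Ω' : Type*} [MeasurableSpace Ω] [MeasurableSpace Ω'] {P : Measure Ω} {P' : Measure Ω'}
  {ι κ : Type*} [Fintype ι] [Fintype κ] {Z : ι → Ω → ℝ}

lemma CG.aemeasurable_sum (h : CG P Z) (c : ι → ℝ) :
    AEMeasurable (fun ω => ∑ i, c i * Z i ω) P := by
  obtain ⟨v, hv⟩ := h c
  by_contra hc
  rw [Measure.map_of_not_aemeasurable hc] at hv
  exact IsProbabilityMeasure.ne_zero _ hv.symm

lemma CG.linear (h : CG P Z) (A : κ → ι → ℝ) : CG P (fun k ω => ∑ i, A k i * Z i ω) := by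
  intro c
  obtain ⟨v, hv⟩ := h (fun i => ∑ k, c k * A k i)
  refine ⟨v, ?_⟩
  rw [← hv]
  congr 1; ext ω
  simp only [Finset.mul_sum, Finset.sum_mul]
  rw [Finset.sum_comm]
  exact Finset.sum_congr rfl fun i _ => Finset.sum_congr rfl fun j _ => by ring

lemma CG.reindex (h : CG P Z) (f : κ → ι) : CG P (fun k => Z (f k)) := by
  classical
  have := h.linear (fun k i => if i = f k then 1 else 0)
  simpa using this

lemma CG.aemeasurable (h : CG P Z) (i : ι) : AEMeasurable (Z i) P := by
  classical
  have := h.aemeasurable_sum (Pi.single i 1)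
  simpa [Pi.single_apply] using this

lemma CG.aemeasurable_pi (h : CG P Z) : AEMeasurable (fun ω i => Z i ω) P :=
  aemeasurable_pi_lambda _ h.aemeasurable

open Classical in
lemma strongDual_pi_apply (L : StrongDual ℝ (ι → ℝ)) (x : ι → ℝ) :
    L x = ∑ i, L (Pi.single i 1) * x i := by
  conv_lhs => rw [← Finset.univ_sum_single x]
  rw [map_sum]
  refine Finset.sum_congr rfl fun i _ => ?_
  rw [← smul_eq_mul, smul_eq_mul, mul_comm, ← smul_eq_mul, ← map_smul]
  congr 1
  ext j
  by_cases h : j = i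
  · subst h; simp
  · simp [h]

lemma law_ext [IsFiniteMeasure P] [IsFiniteMeasure P'] {Z : ι → Ω → ℝ} {Z' : ι → Ω' → ℝ}
    (hZ : AEMeasurable (fun ω i => Z i ω) P) (hZ' : AEMeasurable (fun ω i => Z' i ω) P')
    (h : ∀ c : ι → ℝ, P.map (fun ω => ∑ i, c i * Z i ω) = P'.map (fun ω => ∑ i, c i * Z' i ω)) :
    P.map (fun ω i => Z i ω) = P'.map (fun ω i => Z' i ω) := by
  classical
  apply Measure.ext_of_charFunDual
  ext L
  rw [charFunDual_eq_charFun_map_one, charFunDual_eq_charFun_map_one,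
    AEMeasurable.map_map_of_aemeasurable (by fun_prop) hZ,
    AEMeasurable.map_map_of_aemeasurable (by fun_prop) hZ']
  have e1 : (L ∘ fun ω i => Z i ω) = fun ω => ∑ i, L (Pi.single i 1) * Z i ω := by
    ext ω; exact strongDual_pi_apply L _
  have e2 : (L ∘ fun ω i => Z' i ω) = fun ω => ∑ i, L (Pi.single i 1) * Z' i ω := by
    ext ω; exact strongDual_pi_apply L _
  rw [e1, e2, h]

variable [IsProbabilityMeasure P]

lemma CG.neg_law (h : CG P Z) : P.map (fun ω i => -Z i ω) = P.map (fun ω i => Z i ω) := by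
  refine law_ext (Z := fun i ω => -Z i ω) h.aemeasurable_pi.neg h.aemeasurable_pi fun c => ?_
  obtain ⟨v, hv⟩ := h c
  have : (fun ω => ∑ i, c i * -Z i ω) = (fun x => -x) ∘ fun ω => ∑ i, c i * Z i ω := by
    ext ω; simp
  rw [this, ← AEMeasurable.map_map_of_aemeasurable (by fun_prop) (h.aemeasurable_sum c), hv,
    gaussianReal_map_neg, neg_zero]

lemma CG.isGaussian (h : CG P Z) : IsGaussian (P.map (fun ω i => Z i ω)) := by
  classical
  refine isGaussian_of_map_eq_gaussianReal fun L => ?_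
  obtain ⟨v, hv⟩ := h (fun i => L (Pi.single i 1))
  refine ⟨0, v, ?_⟩
  rw [AEMeasurable.map_map_of_aemeasurable (by fun_prop) h.aemeasurable_pi, ← hv]
  congr 1; ext ω; exact strongDual_pi_apply L _

lemma CG.hasGaussianLaw (h : CG P Z) : HasGaussianLaw (fun ω i => Z i ω) P := ⟨h.isGaussian⟩

lemma CG.memLp (h : CG P Z) (i : ι) : MemLp (Z i) 2 P := (h.hasGaussianLaw.eval i).memLp_two

lemma CG.integral (h : CG P Z) (i : ι) : ∫ ω, Z i ω ∂P = 0 := by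
  classical
  obtain ⟨v, hv⟩ := h (Pi.single i 1)
  have : (fun ω => ∑ j, (Pi.single i 1 : ι → ℝ) j * Z j ω) = Z i := by
    ext ω; simp [Pi.single_apply]
  rw [this] at hv
  have h2 := integral_map (h.aemeasurable i) (f := fun x : ℝ => x) (by fun_prop)
  rw [← h2, hv, integral_id_gaussianReal]

lemma CG.PL (h : CG P Z) : PL (P.map (fun ω i => Z i ω)) := by
  have hG := h.isGaussian
  have hc : Measurable (WithLp.toLp 2 : (ι → ℝ) → EuclideanSpace ℝ ι) := by fun_prop
  let T : (ι → ℝ) →L[ℝ] EuclideanSpace ℝ ι := (EuclideanSpace.equiv ι ℝ).symm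
  have hg : IsGaussian ((P.map (fun ω i => Z i ω)).map T) := inferInstance
  have hP : LowerClass.PL ((P.map (fun ω i => Z i ω)).map T) := by
    refine PL.of_isGaussian _ ?_
    rw [integral_map (by fun_prop) (by fun_prop), ContinuousLinearMap.integral_comp_comm _
      IsGaussian.integrable_fun_id]
    have : ∫ x, x ∂(P.map (fun ω i => Z i ω)) = 0 := by
      rw [integral_map h.aemeasurable_pi (by fun_prop)]
      ext i
      rw [eval_integral (fun i => (h.memLp i).integrable (by norm_num))]
      simp [h.integral]
    rw [this, map_zero]
  have := hP.map ((EuclideanSpace.equiv ι ℝ) : EuclideanSpace ℝ ι →ₗ[ℝ] (ι → ℝ))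
    (by change Measurable (EuclideanSpace.equiv ι ℝ); fun_prop)
  rw [Measure.map_map (by change Measurable (EuclideanSpace.equiv ι ℝ); fun_prop)
    (by fun_prop)] at this
  convert this
  rw [show ((EuclideanSpace.equiv ι ℝ : EuclideanSpace ℝ ι →ₗ[ℝ] (ι → ℝ)) ∘ T) = id by
    ext x i; simp [T]]
  simp

/-- Log-concavity of box probabilities. -/
lemma CG.box_concave (h : CG P Z) {l : ℝ} (hl0 : 0 < l) (hl1 : l < 1) (a b r s : ι → ℝ) :
    P {ω | ∀ i, |Z i ω - a i| ≤ r i} ^ (1 - l) * P {ω | ∀ i, |Z i ω - b i| ≤ s i} ^ l ≤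
      P {ω | ∀ i, |Z i ω - ((1 - l) * a i + l * b i)| ≤ (1 - l) * r i + l * s i} := by
  have h1l : 0 < 1 - l := by linarith
  let B : (ι → ℝ) → (ι → ℝ) → Set (ι → ℝ) := fun a r => {x | ∀ i, |x i - a i| ≤ r i}
  have hB : ∀ a r, MeasurableSet (B a r) := fun a r => by
    simp only [B, ofPred_forall]
    refine MeasurableSet.iInter fun i => measurableSet_le (by fun_prop) measurable_const
  have e : ∀ a r, P {ω | ∀ i, |Z i ω - a i| ≤ r i} =
      ∫⁻ x, (B a r).indicator 1 x ∂(P.map (fun ω i => Z i ω)) := by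
    intro a r
    rw [lintegral_indicator_one (hB a r), Measure.map_apply_of_aemeasurable h.aemeasurable_pi
      (hB a r)]
    rfl
  have le1 : ∀ a r x, (B a r).indicator (1 : (ι → ℝ) → ℝ≥0∞) x ≤ 1 := fun a r x =>
    indicator_le (fun _ _ => le_rfl) x |>.trans (by simp)
  rw [e, e, e]
  refine h.PL l hl0 hl1 _ _ _ (measurable_one.indicator (hB _ _)) (measurable_one.indicator (hB _ _))
    (measurable_one.indicator (hB _ _)) (le1 _ _) (le1 _ _) (le1 _ _) fun x y => ?_
  by_cases hx : x ∈ B a r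
  swap
  · simp [hx, h1l]
  by_cases hy : y ∈ B b s
  swap
  · simp [hy, hl0]
  have : (1 - l) • x + l • y ∈ B (fun i => (1 - l) * a i + l * b i)
      (fun i => (1 - l) * r i + l * s i) := by
    intro i
    have h1 := abs_le.1 (hx i)
    have h2 := abs_le.1 (hy i)
    simp only [Pi.add_apply, Pi.smul_apply, smul_eq_mul]
    rw [abs_le]
    constructor <;> nlinarith
  rw [indicator_of_mem hx, indicator_of_mem hy, indicator_of_mem this]
  simp

lemma CG.box_symm (h : CG P Z) (a r : ι → ℝ) :
    P {ω | ∀ i, |Z i ω + a i| ≤ r i} = P {ω | ∀ i, |Z i ω - a i| ≤ r i} := by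
  have hB : MeasurableSet {x : ι → ℝ | ∀ i, |x i - a i| ≤ r i} := by
    simp only [ofPred_forall]
    refine MeasurableSet.iInter fun i => measurableSet_le (by fun_prop) measurable_const
  have e1 := Measure.map_apply_of_aemeasurable h.aemeasurable_pi hB
  have e2 := Measure.map_apply_of_aemeasurable h.aemeasurable_pi.neg hB
  have e3 : P.map (-fun ω i => Z i ω) = P.map (fun ω i => -Z i ω) := rfl
  rw [e3, h.neg_law] at e2
  have := e2.symm.trans e1
  rw [show {ω | ∀ i, |Z i ω - a i| ≤ r i} = (fun ω i => Z i ω) ⁻¹' {x | ∀ i, |x i - a i| ≤ r i}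
    from rfl, ← this]
  congr 1
  ext ω
  simp only [mem_preimage, mem_ofPred_eq, Pi.neg_apply]
  refine forall_congr' fun i => ?_
  rw [← abs_neg]; ring_nf

/-- Boxes further out along a line have smaller probability. -/
lemma CG.box_antitone (h : CG P Z) (a r : ι → ℝ) {u v : ℝ} (huv : |u| ≤ |v|) :
    P {ω | ∀ i, |Z i ω - v * a i| ≤ r i} ≤ P {ω | ∀ i, |Z i ω - u * a i| ≤ r i} := by
  have hsym : ∀ w : ℝ, P {ω | ∀ i, |Z i ω - (-w) * a i| ≤ r i} =
      P {ω | ∀ i, |Z i ω - w * a i| ≤ r i} := by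
    intro w
    rw [← h.box_symm (fun i => w * a i)]
    simp
  rcases eq_or_lt_of_le huv with he | hlt
  · rcases abs_eq_abs.1 he with h1 | h1
    · rw [h1]
    · rw [h1, hsym]
  have hv : v ≠ 0 := by
    rintro rfl
    simp at hlt
    exact absurd hlt (not_lt.2 (abs_nonneg _))
  have hq : |u / v| < 1 := by
    rw [abs_div, div_lt_one (abs_pos.2 hv)]; exact hlt
  obtain ⟨q1, q2⟩ := abs_lt.1 hq
  have := h.box_concave (l := (1 - u / v) / 2) (by linarith) (by linarith) (fun i => v * a i)
    (fun i => -v * a i) r r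
  rw [hsym, ← ENNReal.rpow_add_of_nonneg _ _ (by linarith) (by linarith)] at this
  simp only [sub_add_cancel, ENNReal.rpow_one] at this
  refine this.trans (le_of_eq ?_)
  congr 1; ext ω
  simp only [mem_ofPred_eq]
  refine forall_congr' fun i => ?_
  have e : (1 - (1 - u / v) / 2) * (v * a i) + (1 - u / v) / 2 * (-v * a i) = u * a i := by
    field_simp; ring
  rw [e]
  constructor <;> intro h <;> linarith

/-- Anderson's inequality for boxes. -/
lemma CG.anderson (h : CG P Z) (a r : ι → ℝ) :
    P {ω | ∀ i, |Z i ω - a i| ≤ r i} ≤ P {ω | ∀ i, |Z i ω| ≤ r i} := by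
  have := h.box_antitone a r (u := 0) (v := 1) (by simp)
  simpa using this

end CG

section CG
variable {Ω : Type*} [MeasurableSpace Ω] {P : Measure Ω} [IsProbabilityMeasure P]

/-- A Chebyshev-type association inequality for functions decreasing in `|u|`. -/
lemma lintegral_Icc_antitone {μ : Measure ℝ} [IsProbabilityMeasure μ] {F : ℝ → ℝ≥0∞}
    (hF : ∀ u v : ℝ, |u| ≤ |v| → F v ≤ F u) {s : ℝ} (hs : 0 ≤ s) :
    μ (Icc (-s) s) * ∫⁻ u, F u ∂μ ≤ ∫⁻ u in Icc (-s) s, F u ∂μ := by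
  have h1 : F s * μ (Icc (-s) s) ≤ ∫⁻ u in Icc (-s) s, F u ∂μ := by
    rw [← setLIntegral_const]
    refine setLIntegral_mono' measurableSet_Icc fun u hu => hF _ _ ?_
    rw [abs_of_nonneg hs]; exact abs_le.2 hu
  have h2 : ∫⁻ u in (Icc (-s) s)ᶜ, F u ∂μ ≤ F s * μ (Icc (-s) s)ᶜ := by
    rw [← setLIntegral_const]
    refine setLIntegral_mono' measurableSet_Icc.compl fun u hu => hF _ _ ?_
    rw [abs_of_nonneg hs]
    by_contra hc
    exact hu (abs_le.1 (not_le.1 hc).le)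
  rw [← lintegral_add_compl F (measurableSet_Icc (a := -s) (b := s)), mul_add]
  have h3 : μ (Icc (-s) s) + μ (Icc (-s) s)ᶜ = 1 := prob_add_prob_compl measurableSet_Icc
  calc _ ≤ μ (Icc (-s) s) * (∫⁻ u in Icc (-s) s, F u ∂μ) +
        μ (Icc (-s) s) * (F s * μ (Icc (-s) s)ᶜ) := by gcongr
    _ = μ (Icc (-s) s) * (∫⁻ u in Icc (-s) s, F u ∂μ) +
        (F s * μ (Icc (-s) s)) * μ (Icc (-s) s)ᶜ := by ring
    _ ≤ μ (Icc (-s) s) * (∫⁻ u in Icc (-s) s, F u ∂μ) +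
        (∫⁻ u in Icc (-s) s, F u ∂μ) * μ (Icc (-s) s)ᶜ := by gcongr
    _ = (μ (Icc (-s) s) + μ (Icc (-s) s)ᶜ) * (∫⁻ u in Icc (-s) s, F u ∂μ) := by ring
    _ = _ := by rw [h3, one_mul]

lemma CG.sidak_step {n : ℕ} {Z : Fin (n+1) → Ω → ℝ} (h : CG P Z) (s : Fin (n+1) → ℝ)
    (hs : ∀ i, 0 ≤ s i) :
    P {ω | |Z 0 ω| ≤ s 0} * P {ω | ∀ i : Fin n, |Z i.succ ω| ≤ s i.succ} ≤
      P {ω | ∀ i, |Z i ω| ≤ s i} := by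
  by_cases hσ : cov[Z 0, Z 0; P] = 0
  · have h0 : ∀ᵐ ω ∂P, Z 0 ω = 0 := by
      rw [covariance_self (h.aemeasurable 0)] at hσ
      rw [variance_eq_integral (h.aemeasurable 0), h.integral] at hσ
      rw [integral_eq_zero_iff_of_nonneg (fun _ => sq_nonneg _)
        (by simpa using (h.memLp 0).integrable_sq)] at hσ
      filter_upwards [hσ] with ω hω
      simpa using hω
    calc _ ≤ 1 * P {ω | ∀ i : Fin n, |Z i.succ ω| ≤ s i.succ} := by gcongr; exact prob_le_one
      _ = P {ω | ∀ i : Fin n, |Z i.succ ω| ≤ s i.succ} := one_mul _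
      _ ≤ _ := by
        refine measure_mono_ae ?_
        filter_upwards [h0] with ω hω hi
        refine fun i => Fin.cases ?_ (fun i => hi i) i
        rw [hω, abs_zero]; exact hs 0
  set c : Fin n → ℝ := fun i => cov[Z i.succ, Z 0; P] / cov[Z 0, Z 0; P] with hc
  set W : Fin n → Ω → ℝ := fun i ω => Z i.succ ω - c i * Z 0 ω with hW
  have hV : CG P (Fin.cons (Z 0) W : Fin (n+1) → Ω → ℝ) := by
    have := h.linear (κ := Fin (n+1)) (Fin.cons (Pi.single 0 1)
      (fun i => Pi.single i.succ 1 - c i • Pi.single 0 1))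
    convert this using 1
    ext k ω
    refine Fin.cases ?_ (fun i => ?_) k
    · simp [Pi.single_apply]
    · simp [hW, Pi.single_apply, sub_mul, Finset.sum_sub_distrib]
  have hWcg : CG P W := by simpa using hV.reindex Fin.succ
  let T : (Fin (n+1) → ℝ) →L[ℝ] ((Unit → ℝ) × (Fin n → ℝ)) :=
    (ContinuousLinearMap.pi fun _ => ContinuousLinearMap.proj 0).prod
      (ContinuousLinearMap.pi fun i => ContinuousLinearMap.proj i.succ)
  have hT : HasGaussianLaw (fun ω => ((fun _ : Unit => Z 0 ω), fun i => W i ω)) P := by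
    exact hV.hasGaussianLaw.map T
  have hind := hT.indepFun_of_covariance_eval (X := fun _ => Z 0) (fun _ j => by
    have e : W j = Z j.succ - c j • Z 0 := by ext ω; simp [hW]
    rw [e, covariance_sub_right (h.memLp _) (h.memLp _) ((h.memLp _).const_smul _),
      covariance_smul_right, covariance_comm (Z 0) (Z j.succ)]
    simp only [hc]
    field_simp
    simp)
  have hind2 : IndepFun (Z 0) (fun ω i => W i ω) P := by
    have := hind.comp (φ := fun x : Unit → ℝ => x ()) (ψ := id)
      (measurable_pi_apply (X := fun _ : Unit => ℝ) ()) measurable_id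
    exact this
  have hlaw := (indepFun_iff_map_prod_eq_prod_map_map (h.aemeasurable 0)
    hWcg.aemeasurable_pi).1 hind2
  have hB : MeasurableSet {p : ℝ × (Fin n → ℝ) | ∀ i, |p.2 i + c i * p.1| ≤ s i.succ} := by
    simp only [ofPred_forall]
    exact MeasurableSet.iInter fun i => measurableSet_le (by fun_prop) measurable_const
  have hp := AEMeasurable.prodMk (h.aemeasurable 0) hWcg.aemeasurable_pi
  set F : ℝ → ℝ≥0∞ := fun u => P {ω | ∀ i, |W i ω - u * (-c i)| ≤ s i.succ} with hF
  have hF1 : ∀ u v : ℝ, |u| ≤ |v| → F v ≤ F u := fun u v huv => hWcg.box_antitone _ _ huv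
  have hprob : IsProbabilityMeasure (P.map (Z 0)) := Measure.isProbabilityMeasure_map
    (h.aemeasurable 0)
  have hprobW : IsProbabilityMeasure (P.map (fun ω i => W i ω)) := Measure.isProbabilityMeasure_map
    hWcg.aemeasurable_pi
  have hFe : ∀ u, (P.map (fun ω i => W i ω)) (Prod.mk u ⁻¹'
      {p : ℝ × (Fin n → ℝ) | ∀ i, |p.2 i + c i * p.1| ≤ s i.succ}) = F u := by
    intro u
    rw [Measure.map_apply_of_aemeasurable hWcg.aemeasurable_pi (hB.preimage (by fun_prop))]
    simp only [hF]
    congr 1; ext ω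
    simp only [mem_preimage, mem_ofPred_eq]
    refine forall_congr' fun i => ?_
    ring_nf
  have e1 : P {ω | ∀ i : Fin n, |Z i.succ ω| ≤ s i.succ} = ∫⁻ u, F u ∂(P.map (Z 0)) := by
    simp only [← hFe]
    rw [← Measure.prod_apply hB, ← hlaw, Measure.map_apply_of_aemeasurable hp hB]
    congr 1; ext ω; simp [hW]
  have hIm : MeasurableSet {p : ℝ × (Fin n → ℝ) | p.1 ∈ Icc (-s 0) (s 0)} :=
    measurableSet_Icc.preimage measurable_fst
  have e2 : P {ω | ∀ i, |Z i ω| ≤ s i} = ∫⁻ u in Icc (-s 0) (s 0), F u ∂(P.map (Z 0)) := by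
    rw [← lintegral_indicator measurableSet_Icc]
    have : ∀ u, (Icc (-s 0) (s 0)).indicator F u = (P.map (fun ω i => W i ω)) (Prod.mk u ⁻¹'
      ({p : ℝ × (Fin n → ℝ) | p.1 ∈ Icc (-s 0) (s 0)} ∩
        {p : ℝ × (Fin n → ℝ) | ∀ i, |p.2 i + c i * p.1| ≤ s i.succ})) := by
      intro u
      by_cases hu : u ∈ Icc (-s 0) (s 0)
      · rw [indicator_of_mem hu, ← hFe]
        congr 1; ext x
        simp only [mem_preimage, mem_inter_iff, mem_ofPred_eq, hu, true_and]
      · rw [indicator_of_notMem hu, eq_comm]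
        refine Eq.trans (congrArg _ ?_) measure_empty
        ext x
        simp only [mem_preimage, mem_inter_iff, mem_ofPred_eq, hu, false_and, mem_empty_iff_false]
    simp only [this]
    rw [← Measure.prod_apply (hIm.inter hB), ← hlaw, Measure.map_apply_of_aemeasurable hp
      (hIm.inter hB)]
    congr 1; ext ω
    simp [hW, Fin.forall_fin_succ, abs_le]
  have e3 : P {ω | |Z 0 ω| ≤ s 0} = (P.map (Z 0)) (Icc (-s 0) (s 0)) := by
    rw [Measure.map_apply_of_aemeasurable (h.aemeasurable 0) measurableSet_Icc]
    congr 1; ext ω; simp [abs_le]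
  rw [e1, e2, e3]
  exact lintegral_Icc_antitone hF1 (hs 0)

/-- Šidák's inequality. -/
lemma CG.sidak_fin {n : ℕ} {Z : Fin n → Ω → ℝ} (h : CG P Z) (s : Fin n → ℝ)
    (hs : ∀ i, 0 ≤ s i) :
    ∏ i, P {ω | |Z i ω| ≤ s i} ≤ P {ω | ∀ i, |Z i ω| ≤ s i} := by
  induction n with
  | zero => simp
  | succ n ih =>
    rw [Fin.prod_univ_succ]
    refine le_trans ?_ (h.sidak_step s hs)
    gcongr
    exact ih (h.reindex Fin.succ) (fun i => s i.succ) (fun i => hs _)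

lemma CG.sidak {ι : Type*} [Fintype ι] {Z : ι → Ω → ℝ} (h : CG P Z) (s : ι → ℝ)
    (hs : ∀ i, 0 ≤ s i) :
    ∏ i, P {ω | |Z i ω| ≤ s i} ≤ P {ω | ∀ i, |Z i ω| ≤ s i} := by
  let e := (Fintype.equivFin ι).symm
  have := (h.reindex e).sidak_fin (fun i => s (e i)) (fun i => hs _)
  rw [Equiv.prod_comp e (fun i => P {ω | |Z i ω| ≤ s i})] at this
  refine this.trans (le_of_eq ?_)
  congr 1; ext ω
  exact e.forall_congr_right (q := fun i => |Z i ω| ≤ s i)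

end CG

section limits
variable {Ω : Type*} [MeasurableSpace Ω] {P : Measure Ω} [IsProbabilityMeasure P]

lemma aemeasurable_of_map_eq_gaussian {L : Ω → ℝ} {v : ℝ≥0} (h : P.map L = gaussianReal 0 v) :
    AEMeasurable L P := by
  by_contra hc
  rw [Measure.map_of_not_aemeasurable hc] at h
  exact IsProbabilityMeasure.ne_zero _ h.symm

lemma charFun_map_real {L : Ω → ℝ} (hL : AEMeasurable L P) (s : ℝ) :
    charFun (P.map L) s = ∫ ω, Complex.exp (s * L ω * Complex.I) ∂P := by
  rw [charFun_apply_real, integral_map hL (by fun_prop)]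

/-- Pointwise limits of centered Gaussian variables are centered Gaussian. -/
lemma gaussian_limit {L : ℕ → Ω → ℝ} {L' : Ω → ℝ} {v : ℕ → ℝ≥0}
    (hv : ∀ n, P.map (L n) = gaussianReal 0 (v n))
    (hlim : ∀ ω, Tendsto (fun n => L n ω) atTop (𝓝 (L' ω))) :
    ∃ w : ℝ≥0, Tendsto v atTop (𝓝 w) ∧ P.map L' = gaussianReal 0 w := by
  have hm : ∀ n, AEMeasurable (L n) P := fun n => aemeasurable_of_map_eq_gaussian (hv n)
  have hm' : AEMeasurable L' P := aemeasurable_of_tendsto_metrizable_ae atTop hm (ae_of_all _ hlim)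
  have hpm : IsProbabilityMeasure (P.map L') := Measure.isProbabilityMeasure_map hm'
  have hc : ∀ s : ℝ, Tendsto (fun n => Complex.exp (-(v n) * s ^ 2 / 2)) atTop
      (𝓝 (charFun (P.map L') s)) := by
    intro s
    have : ∀ n, Complex.exp (-(v n) * s ^ 2 / 2) = charFun (P.map (L n)) s := by
      intro n; rw [hv n, charFun_gaussianReal]; congr 1; simp; ring
    simp only [this]
    rw [charFun_map_real hm']
    simp only [charFun_map_real (hm _)]
    refine tendsto_integral_of_dominated_convergence (fun _ => 1) (fun n => ?_) (by simp)
      (fun n => ae_of_all _ fun ω => ?_) (ae_of_all _ fun ω => ?_)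
    · have := (hm n).aestronglyMeasurable
      exact (by fun_prop : Continuous fun x : ℝ => Complex.exp (s * x * Complex.I)).comp_aestronglyMeasurable this
    · have : (s * L n ω * Complex.I : ℂ) = ((s * L n ω : ℝ) : ℂ) * Complex.I := by push_cast; ring
      rw [this, Complex.norm_exp_ofReal_mul_I]
    · exact ((by fun_prop : Continuous fun x : ℝ => Complex.exp (s * x * Complex.I)).tendsto _).comp
        (hlim ω)
  have hre : ∀ s : ℝ, Tendsto (fun n => Real.exp (-(v n) * s ^ 2 / 2)) atTop
      (𝓝 (charFun (P.map L') s).re) := by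
    intro s
    refine ((Complex.continuous_re.tendsto _).comp (hc s)).congr fun n => ?_
    have : Complex.exp (-(v n) * s ^ 2 / 2) = ((Real.exp (-(v n) * s ^ 2 / 2) : ℝ) : ℂ) := by
      push_cast; rfl
    simp only [Function.comp, this, Complex.ofReal_re]
  obtain ⟨s, hs0, hs⟩ : ∃ s : ℝ, s ≠ 0 ∧ 0 < (charFun (P.map L') s).re := by
    have hcont : Continuous fun s : ℝ => (charFun (P.map L') s).re :=
      Complex.continuous_re.comp continuous_charFun
    have h0 : (charFun (P.map L') 0).re = 1 := by simp
    have : ∀ᶠ s in 𝓝 (0:ℝ), 0 < (charFun (P.map L') s).re :=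
      hcont.continuousAt.eventually_const_lt (by simp only [h0]; norm_num)
    obtain ⟨s, hs1, hs2⟩ := ((this.filter_mono nhdsWithin_le_nhds).and
      (self_mem_nhdsWithin (s := {0}ᶜ) (a := (0:ℝ)))).exists
    exact ⟨s, hs2, hs1⟩
  have hvl : Tendsto (fun n => ((v n : ℝ≥0) : ℝ)) atTop
      (𝓝 (-(2 / s ^ 2) * Real.log (charFun (P.map L') s).re)) := by
    have := (((Real.continuousAt_log hs.ne').tendsto.comp (hre s)).const_mul (-(2 / s ^ 2)))
    refine this.congr fun n => ?_
    simp only [Function.comp, Real.log_exp]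
    field_simp
  have hw0 : 0 ≤ -(2 / s ^ 2) * Real.log (charFun (P.map L') s).re :=
    ge_of_tendsto' hvl fun n => (v n).2
  obtain ⟨w, hw⟩ : ∃ w : ℝ≥0, (w : ℝ) = -(2 / s ^ 2) * Real.log (charFun (P.map L') s).re :=
    ⟨Real.toNNReal _, Real.coe_toNNReal _ hw0⟩
  rw [← hw] at hvl
  refine ⟨w, NNReal.tendsto_coe.1 hvl, ?_⟩
  refine Measure.ext_of_charFun ?_
  ext u
  refine tendsto_nhds_unique (hc u) ?_
  rw [charFun_gaussianReal]
  have h1 : Tendsto (fun n => ((v n : ℝ) : ℂ)) atTop (𝓝 ((w : ℝ) : ℂ)) :=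
    (Complex.continuous_ofReal.tendsto _).comp hvl
  have h2 := (Complex.continuous_exp.tendsto _).comp ((h1.neg.mul_const ((u:ℂ) ^ 2)).div_const 2)
  convert h2 using 2
  congr 1
  simp; ring_nf

end limits

/-- The (unnormalised) Riemann–Liouville integral, in scaled form. -/
noncomputable def rl (a : ℝ) (x : ℝ → ℝ) (t : ℝ) : ℝ :=
  (max t 0) ^ a * ∫ v in (0:ℝ)..1, (1 - v) ^ (a - 1) * x (max t 0 * v)

section rl
variable {a : ℝ}

lemma intervalIntegrable_one_sub (ha : 0 < a) (b c : ℝ) :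
    IntervalIntegrable (fun v : ℝ => (1 - v) ^ (a - 1)) volume b c :=
  (intervalIntegral.intervalIntegrable_rpow' (r := a - 1) (by linarith) (a := 1 - b)
    (b := 1 - c)).comp_sub_left 1 |> fun h => by simpa using h

lemma integral_one_sub (ha : 0 < a) : ∫ v in (0:ℝ)..1, (1 - v) ^ (a - 1) = a⁻¹ := by
  rw [intervalIntegral.integral_comp_sub_left (fun v => v ^ (a - 1)) 1, integral_rpow (by left; linarith)]
  simp [ha.ne']

lemma rl_eq (ha : 0 < a) (x : ℝ → ℝ) {t : ℝ} (ht : 0 ≤ t) :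
    rl a x t = ∫ u in (0:ℝ)..t, (t - u) ^ (a - 1) * x u := by
  rw [rl, max_eq_left ht]
  rcases ht.eq_or_lt with rfl | ht
  · simp [Real.zero_rpow ha.ne']
  have := intervalIntegral.smul_integral_comp_mul_left (fun u => (t - u) ^ (a - 1) * x u) t
    (a := 0) (b := 1)
  rw [mul_zero, mul_one] at this
  rw [← this, smul_eq_mul]
  have e : ∫ v in (0:ℝ)..1, (t - t * v) ^ (a - 1) * x (t * v) =
      ∫ v in (0:ℝ)..1, t ^ (a - 1) * ((1 - v) ^ (a - 1) * x (t * v)) := by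
    refine intervalIntegral.integral_congr fun v hv => ?_
    rw [uIcc_of_le zero_le_one] at hv
    rw [← mul_assoc, ← Real.mul_rpow ht.le (by linarith [hv.2])]
    congr 2; ring
  rw [e, intervalIntegral.integral_const_mul, ← mul_assoc, Real.rpow_sub_one ht.ne',
    mul_div_cancel₀ _ ht.ne']

lemma rl_integrable (ha : 0 < a) {x : ℝ → ℝ} (hx : Continuous x) (t b c : ℝ) :
    IntervalIntegrable (fun v : ℝ => (1 - v) ^ (a - 1) * x (t * v)) volume b c :=
  (intervalIntegrable_one_sub ha b c).mul_continuousOn (by fun_prop)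

lemma rl_continuous (ha : 0 < a) {x : ℝ → ℝ} (hx : Continuous x) : Continuous (rl a x) := by
  unfold rl
  refine Continuous.mul ((continuous_id.max continuous_const).rpow_const fun _ => Or.inr ha.le) ?_
  have : Continuous fun t : ℝ => ∫ v in (0:ℝ)..1, (1 - v) ^ (a - 1) * x (t * v) := by
    rw [continuous_iff_continuousAt]
    intro t0
    obtain ⟨C, hC⟩ := (isCompact_Icc (a := -(|t0|+1)) (b := |t0|+1)).exists_bound_of_continuousOn
      hx.continuousOn
    refine intervalIntegral.continuousAt_of_dominated_interval
      (bound := fun v => (1 - v) ^ (a - 1) * C) ?_ ?_ ?_ ?_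
    · exact Eventually.of_forall fun t => by
        rw [uIoc_of_le zero_le_one]; exact (rl_integrable ha hx t 0 1).1.aestronglyMeasurable
    · filter_upwards [Metric.ball_mem_nhds t0 one_pos] with t ht
      refine ae_of_all _ fun v hv => ?_
      rw [uIoc_of_le zero_le_one] at hv
      have h1 : 0 ≤ (1 - v) ^ (a - 1) := Real.rpow_nonneg (by linarith [hv.2]) _
      rw [norm_mul, Real.norm_of_nonneg h1]
      refine mul_le_mul_of_nonneg_left (hC _ ?_) h1
      rw [mem_Icc, ← abs_le, abs_mul, abs_of_pos hv.1]
      rw [Metric.mem_ball, Real.dist_eq] at ht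
      have h3 : |t| ≤ |t0| + 1 := by
        have := abs_sub_abs_le_abs_sub t t0
        linarith
      calc |t| * v ≤ |t| * 1 := by gcongr; exact hv.2
        _ ≤ _ := by linarith
    · exact (intervalIntegrable_one_sub ha 0 1).mul_const C
    · refine ae_of_all _ fun v _ => ?_
      fun_prop
  exact this.comp (continuous_id.max continuous_const)

lemma rl_sub (ha : 0 < a) {x y : ℝ → ℝ} (hx : Continuous x) (hy : Continuous y) (t : ℝ) :
    rl a (fun u => x u - y u) t = rl a x t - rl a y t := by
  simp only [rl, mul_sub]
  rw [intervalIntegral.integral_sub (rl_integrable ha hx _ _ _) (rl_integrable ha hy _ _ _)]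
  ring

lemma rl_smul (x : ℝ → ℝ) (c t : ℝ) : rl a (fun u => c * x u) t = c * rl a x t := by
  simp only [rl, mul_left_comm _ c, intervalIntegral.integral_const_mul]

/-- Weights of the Riemann-type sums converging to the Riemann–Liouville integral. -/
noncomputable def rlWeight (a : ℝ) (n : ℕ) (i : ℕ) : ℝ :=
  ∫ v in ((i:ℝ) / n)..((i + 1 : ℕ):ℝ) / n, (1 - v) ^ (a - 1)

lemma rl_sum_tendsto (ha : 0 < a) {x : ℝ → ℝ} (hx : Continuous x) {t : ℝ} (ht : 0 ≤ t) :
    Tendsto (fun n : ℕ => ∑ i : Fin (n+1), (t ^ a * rlWeight a (n+1) i) * x (t * ((i:ℕ) / (n+1 : ℕ))))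
      atTop (𝓝 (rl a x t)) := by
  have hk0 : ∀ v ∈ Icc (0:ℝ) 1, 0 ≤ (1 - v) ^ (a - 1) := fun v hv =>
    Real.rpow_nonneg (by linarith [hv.2]) _
  suffices h : Tendsto (fun n : ℕ => ∑ i : Fin (n+1), rlWeight a (n+1) i * x (t * ((i:ℕ) / (n+1 : ℕ))))
      atTop (𝓝 (∫ v in (0:ℝ)..1, (1 - v) ^ (a - 1) * x (t * v))) by
    rw [rl, max_eq_left ht]
    refine (h.const_mul (t ^ a)).congr fun n => ?_
    simp only [Finset.mul_sum, mul_assoc]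
  have huc : UniformContinuousOn (fun v => x (t * v)) (Icc 0 1) :=
    isCompact_Icc.uniformContinuousOn_of_continuous (by fun_prop)
  rw [Metric.tendsto_atTop]
  intro ε hε
  rw [Metric.uniformContinuousOn_iff] at huc
  obtain ⟨δ, hδ, H⟩ := huc (ε * a / 2) (by positivity)
  obtain ⟨N, hN⟩ := exists_nat_gt (1 / δ)
  refine ⟨N, fun n hn => ?_⟩
  have hn1 : (0:ℝ) < (n+1 : ℕ) := by positivity
  have hnδ : 1 / ((n+1 : ℕ) : ℝ) < δ := by
    rw [div_lt_iff₀ hn1]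
    rw [div_lt_iff₀ hδ] at hN
    have : (N:ℝ) ≤ (n+1 : ℕ) := by exact_mod_cast hn.trans (Nat.le_succ n)
    nlinarith
  have hInt := fun i : ℕ => rl_integrable ha hx t ((i:ℝ) / (n+1 : ℕ)) (((i + 1 : ℕ):ℝ) / (n+1 : ℕ))
  have hinc : ∀ i : ℕ, (i:ℝ) / (n+1 : ℕ) ≤ ((i + 1 : ℕ):ℝ) / (n+1 : ℕ) := fun i => by
    gcongr; simp
  have hkint := fun i : ℕ => intervalIntegrable_one_sub ha ((i:ℝ) / (n+1 : ℕ)) (((i + 1 : ℕ):ℝ) / (n+1 : ℕ))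
  have s1 := intervalIntegral.sum_integral_adjacent_intervals (n := n+1)
    (a := fun i : ℕ => (i:ℝ) / (n+1 : ℕ)) (fun i _ => hInt i)
  have s2 := intervalIntegral.sum_integral_adjacent_intervals (n := n+1)
    (a := fun i : ℕ => (i:ℝ) / (n+1 : ℕ)) (fun i _ => hkint i)
  simp only [Nat.cast_zero, zero_div, div_self hn1.ne'] at s1 s2
  rw [integral_one_sub ha] at s2
  rw [← s1, Fin.sum_univ_eq_sum_range (fun i => rlWeight a (n+1) i * x (t * ((i:ℕ) / (n+1 : ℕ)))),
    Real.dist_eq, ← Finset.sum_sub_distrib]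
  refine lt_of_le_of_lt (Finset.abs_sum_le_sum_abs _ _) ?_
  have hterm : ∀ i ∈ Finset.range (n+1), |rlWeight a (n+1) i * x (t * ((i:ℕ) / (n+1 : ℕ))) -
      ∫ v in ((i:ℝ) / (n+1 : ℕ))..((i + 1 : ℕ):ℝ) / (n+1 : ℕ), (1 - v) ^ (a - 1) * x (t * v)| ≤
      (∫ v in ((i:ℝ) / (n+1 : ℕ))..((i + 1 : ℕ):ℝ) / (n+1 : ℕ), (1 - v) ^ (a - 1)) * (ε * a / 2) := by
    intro i hi
    rw [rlWeight, ← intervalIntegral.integral_mul_const, ← intervalIntegral.integral_mul_const,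
      ← intervalIntegral.integral_sub ((hkint i).mul_const _) (hInt i)]
    rw [← Real.norm_eq_abs]
    refine intervalIntegral.norm_integral_le_of_norm_le (hinc i) (ae_of_all _ fun v hv => ?_)
      ((hkint i).mul_const _)
    have hi' : ((i + 1 : ℕ):ℝ) / (n+1 : ℕ) ≤ 1 := by
      rw [div_le_one hn1]; exact_mod_cast Finset.mem_range.1 hi
    have hi0 : (0:ℝ) ≤ (i:ℝ) / (n+1 : ℕ) := by positivity
    have hv1 : v ∈ Icc (0:ℝ) 1 := ⟨hi0.trans hv.1.le, hv.2.trans hi'⟩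
    rw [← mul_sub, norm_mul, Real.norm_of_nonneg (hk0 v hv1)]
    refine mul_le_mul_of_nonneg_left ?_ (hk0 v hv1)
    refine (H _ ⟨hi0, (hinc i).trans hi'⟩ v hv1 ?_).le
    rw [Real.dist_eq, abs_sub_comm, abs_of_nonneg (by linarith [hv.1])]
    refine lt_of_le_of_lt ?_ hnδ
    have : ((i + 1 : ℕ):ℝ) / (n+1 : ℕ) = (i:ℝ) / (n+1 : ℕ) + 1 / (n+1 : ℕ) := by
      push_cast; ring
    linarith [hv.2]
  refine lt_of_le_of_lt (Finset.sum_le_sum hterm) ?_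
  rw [← Finset.sum_mul, s2]
  field_simp
  linarith

end rl

section entropy
variable {a : ℝ}

lemma intervalIntegrable_sub_rpow (ha : 0 < a) (t b c : ℝ) :
    IntervalIntegrable (fun v : ℝ => (t - v) ^ (a - 1)) volume b c :=
  (intervalIntegral.intervalIntegrable_rpow' (r := a - 1) (by linarith) (a := t - b)
    (b := t - c)).comp_sub_left t |> fun h => by simpa using h

lemma integral_sub_rpow (ha : 0 < a) (t b c : ℝ) :
    ∫ v in b..c, (t - v) ^ (a - 1) = ((t - b) ^ a - (t - c) ^ a) / a := by
  rw [intervalIntegral.integral_comp_sub_left (fun v => v ^ (a - 1)) t,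
    integral_rpow (by left; linarith)]
  simp

lemma rl_holder_aux (ha : 0 < a) (ha1 : a ≤ 1) {x : ℝ → ℝ} (hx : Continuous x)
    (hx1 : ∀ u ∈ Icc (0:ℝ) 1, |x u| ≤ 1) {s t : ℝ} (hs : 0 ≤ s) (hst : s ≤ t) (ht : t ≤ 1) :
    |rl a x t - rl a x s| ≤ 2 / a * (t - s) ^ a := by
  rw [rl_eq ha x (hs.trans hst), rl_eq ha x hs]
  have i1 := fun t b c => (intervalIntegrable_sub_rpow ha t b c).mul_continuousOn hx.continuousOn
  rw [← intervalIntegral.integral_add_adjacent_intervals (i1 t 0 s) (i1 t s t), add_sub_right_comm,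
    ← intervalIntegral.integral_sub (i1 t 0 s) (i1 s 0 s)]
  have b1 : |∫ u in s..t, (t - u) ^ (a - 1) * x u| ≤ ∫ u in s..t, (t - u) ^ (a - 1) := by
    rw [← Real.norm_eq_abs]
    refine intervalIntegral.norm_integral_le_of_norm_le hst (ae_of_all _ fun u hu => ?_)
      (intervalIntegrable_sub_rpow ha _ _ _)
    have h0 : 0 ≤ (t - u) ^ (a - 1) := Real.rpow_nonneg (by linarith [hu.2]) _
    rw [norm_mul, Real.norm_of_nonneg h0]
    exact mul_le_of_le_one_right h0 (hx1 u ⟨by linarith [hu.1], hu.2.trans ht⟩)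
  have b2 : |∫ u in (0:ℝ)..s, ((t - u) ^ (a - 1) * x u - (s - u) ^ (a - 1) * x u)| ≤
      ∫ u in (0:ℝ)..s, ((s - u) ^ (a - 1) - (t - u) ^ (a - 1)) := by
    rw [← Real.norm_eq_abs]
    refine intervalIntegral.norm_integral_le_of_norm_le hs ?_
      ((intervalIntegrable_sub_rpow ha _ _ _).sub (intervalIntegrable_sub_rpow ha _ _ _))
    have hne : ∀ᵐ u : ℝ, u ≠ s := by simp [ae_iff]
    filter_upwards [hne] with u hus hu
    have hus : u < s := lt_of_le_of_ne hu.2 hus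
    have h0 : (t - u) ^ (a - 1) ≤ (s - u) ^ (a - 1) :=
      Real.rpow_le_rpow_of_nonpos (by linarith) (by linarith) (by linarith)
    rw [← sub_mul, norm_mul, Real.norm_eq_abs, abs_sub_comm, abs_of_nonneg (sub_nonneg.2 h0)]
    exact mul_le_of_le_one_right (sub_nonneg.2 h0) (hx1 u ⟨hu.1.le, by linarith⟩)
  rw [intervalIntegral.integral_sub (intervalIntegrable_sub_rpow ha _ _ _)
    (intervalIntegrable_sub_rpow ha _ _ _), integral_sub_rpow ha, integral_sub_rpow ha] at b2
  rw [integral_sub_rpow ha] at b1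
  have h3 : s ^ a ≤ t ^ a := Real.rpow_le_rpow hs hst ha.le
  have h4 : 0 ≤ (t - s) ^ a := Real.rpow_nonneg (by linarith) _
  simp only [sub_self, Real.zero_rpow ha.ne', sub_zero] at b1 b2
  have b3 := (abs_add_le (∫ u in (0:ℝ)..s, ((t - u) ^ (a - 1) * x u - (s - u) ^ (a - 1) * x u))
    (∫ u in s..t, (t - u) ^ (a - 1) * x u)).trans (add_le_add b2 b1)
  refine b3.trans ?_
  rw [div_mul_eq_mul_div, ← sub_div, ← add_div]
  exact div_le_div_of_nonneg_right (by linarith) ha.le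

lemma rl_holder (ha : 0 < a) (ha1 : a ≤ 1) {x : ℝ → ℝ} (hx : Continuous x)
    (hx1 : ∀ u ∈ Icc (0:ℝ) 1, |x u| ≤ 1) {s t : ℝ} (hs : s ∈ Icc (0:ℝ) 1) (ht : t ∈ Icc (0:ℝ) 1) :
    |rl a x t - rl a x s| ≤ 2 / a * |t - s| ^ a := by
  rcases le_total s t with h | h
  · rw [abs_of_nonneg (sub_nonneg.2 h)]; exact rl_holder_aux ha ha1 hx hx1 hs.1 h ht.2
  · rw [abs_sub_comm, abs_sub_comm t s, abs_of_nonneg (sub_nonneg.2 h)]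
    exact rl_holder_aux ha ha1 hx hx1 ht.1 h hs.2

/-- Exponential entropy bound for the image of the unit ball under `rl a`. -/
def Ent (a : ℝ) : Prop :=
  ∃ C : ℝ, 1 ≤ C ∧ ∀ n : ℕ, 1 ≤ n → ∃ (N : ℕ) (code : (ℝ → ℝ) → Fin N), (N : ℝ) ≤ C ^ n ∧
    ∀ x y : ℝ → ℝ, Continuous x → Continuous y → (∀ u ∈ Icc (0:ℝ) 1, |x u| ≤ 1) →
      (∀ u ∈ Icc (0:ℝ) 1, |y u| ≤ 1) → code x = code y →
      ∀ t ∈ Icc (0:ℝ) 1, |rl a x t - rl a y t| ≤ C * (n:ℝ) ^ (-a)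

lemma Ent.base (ha : 0 < a) (ha1 : a ≤ 1) : Ent a := by
  obtain ⟨D, hD⟩ := exists_nat_gt (2 / a + 1)
  have hD0 : (0:ℝ) < 2 / a := by positivity
  refine ⟨max (2 * D + 1) (1 + 4 / a), le_max_of_le_left (by linarith [Nat.cast_nonneg (α := ℝ) D]), ?_⟩
  intro n hn
  have hn0 : (0:ℝ) < n := by exact_mod_cast hn
  have hna : 0 < (n:ℝ) ^ a := by positivity
  let z : (ℝ → ℝ) → ℕ → ℤ := fun x i => ⌊(n:ℝ) ^ a * rl a x (i / n)⌋
  let K := Finset.Icc (-(D:ℤ)) D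
  let cl : ℤ → K := fun d => ⟨max (-(D:ℤ)) (min D d), by
    simp only [K, Finset.mem_Icc]; omega⟩
  let code0 : (ℝ → ℝ) → (Fin n → K) := fun x i => cl (z x (i+1) - z x i)
  let e := Fintype.equivFin (Fin n → K)
  refine ⟨_, fun x => e (code0 x), ?_, ?_⟩
  · rw [Fintype.card_fun, Fintype.card_fin]
    push_cast
    gcongr
    refine le_max_of_le_left ?_
    have : Fintype.card K = 2 * D + 1 := by
      rw [Fintype.card_coe, Int.card_Icc]; omega
    rw [this]; push_cast; exact le_rfl
  · intro x y hx hy hx1 hy1 hxy t ht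
    have hcode : code0 x = code0 y := e.injective hxy
    have hd : ∀ x : ℝ → ℝ, Continuous x → (∀ u ∈ Icc (0:ℝ) 1, |x u| ≤ 1) → ∀ i < n,
        -(D:ℤ) ≤ z x (i+1) - z x i ∧ z x (i+1) - z x i ≤ D := by
      intro x hx hx1 i hi
      have hi1 : (i:ℝ) + 1 ≤ n := by exact_mod_cast hi
      have h := rl_holder ha ha1 hx hx1 (s := i / n) (t := (i+1 : ℕ) / n)
        ⟨by positivity, by rw [div_le_one hn0]; linarith⟩
        ⟨by positivity, by rw [div_le_one hn0]; push_cast; linarith⟩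
      have e1 : ((i+1 : ℕ):ℝ) / n - i / n = 1 / n := by push_cast; ring
      rw [e1, abs_of_pos (show (0:ℝ) < 1 / n by positivity), Real.div_rpow zero_le_one hn0.le, Real.one_rpow] at h
      have h2 : |(n:ℝ) ^ a * rl a x ((i+1 : ℕ) / n) - (n:ℝ) ^ a * rl a x (i / n)| ≤ 2 / a := by
        rw [← mul_sub, abs_mul, abs_of_pos hna]
        calc _ ≤ (n:ℝ) ^ a * (2 / a * (1 / (n:ℝ) ^ a)) := by gcongr
          _ = _ := by field_simp
      have f1 := Int.floor_le ((n:ℝ) ^ a * rl a x ((i+1 : ℕ) / n))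
      have f2 := Int.lt_floor_add_one ((n:ℝ) ^ a * rl a x ((i+1 : ℕ) / n))
      have f3 := Int.floor_le ((n:ℝ) ^ a * rl a x (i / n))
      have f4 := Int.lt_floor_add_one ((n:ℝ) ^ a * rl a x (i / n))
      obtain ⟨g1, g2⟩ := abs_le.1 h2
      constructor
      · have : (-(D:ℝ)) ≤ ((z x (i+1) - z x i : ℤ) : ℝ) := by
          simp only [z]; push_cast at *; linarith
        exact_mod_cast this
      · have : ((z x (i+1) - z x i : ℤ) : ℝ) ≤ D := by
          simp only [z]; push_cast at *; linarith
        exact_mod_cast this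
    have hz : ∀ i ≤ n, z x i = z y i := by
      intro i
      induction i with
      | zero =>
        intro _
        simp [z, rl, Real.zero_rpow ha.ne']
      | succ i ih =>
        intro hi
        have h1 := congrArg Subtype.val (congrFun hcode ⟨i, hi⟩)
        simp only [code0, cl] at h1
        have h2 := hd x hx hx1 i hi
        have h3 := hd y hy hy1 i hi
        have h4 := ih (by omega)
        omega
    set i := ⌊(n:ℝ) * t⌋₊ with hi
    have i1 : (i:ℝ) ≤ n * t := Nat.floor_le (by have := ht.1; positivity)
    have i2 : (n:ℝ) * t < i + 1 := Nat.lt_floor_add_one _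
    have hin : (i:ℝ) ≤ n := i1.trans (by nlinarith [ht.2])
    have hmem : (i:ℝ) / n ∈ Icc (0:ℝ) 1 := ⟨by positivity, by rwa [div_le_one hn0]⟩
    have hdist : |t - i / n| ^ a ≤ (n:ℝ) ^ (-a) := by
      rw [Real.rpow_neg hn0.le, ← Real.inv_rpow hn0.le]
      refine Real.rpow_le_rpow (abs_nonneg _) ?_ ha.le
      rw [abs_le]
      constructor
      · have : (i:ℝ) / n ≤ t := by rw [div_le_iff₀ hn0]; linarith
        have : (0:ℝ) < (n:ℝ)⁻¹ := by positivity
        linarith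
      · rw [sub_le_iff_le_add, ← one_div, ← add_div, le_div_iff₀ hn0]; linarith
    have h1 := (rl_holder ha ha1 hx hx1 hmem ht).trans (mul_le_mul_of_nonneg_left hdist hD0.le)
    have h2 := (rl_holder ha ha1 hy hy1 hmem ht).trans (mul_le_mul_of_nonneg_left hdist hD0.le)
    have h3 : |rl a x (i / n) - rl a y (i / n)| ≤ (n:ℝ) ^ (-a) := by
      have := hz i (by exact_mod_cast hin)
      have := Int.abs_sub_lt_one_of_floor_eq_floor this
      rw [← mul_sub, abs_mul, abs_of_pos hna] at this
      rw [Real.rpow_neg hn0.le, inv_eq_one_div, le_div_iff₀ hna]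
      linarith
    have h4 : |rl a x t - rl a y t| ≤ (1 + 4 / a) * (n:ℝ) ^ (-a) := by
      have e : rl a x t - rl a y t = (rl a x t - rl a x (i / n)) + (rl a x (i/n) - rl a y (i/n)) -
        (rl a y t - rl a y (i / n)) := by ring
      rw [e]
      refine (abs_sub _ _).trans ((add_le_add_left (abs_add_le _ _) _).trans ?_)
      have : (1 + 4 / a) * (n:ℝ) ^ (-a) = 2 / a * (n:ℝ) ^ (-a) + (n:ℝ) ^ (-a) +
        2 / a * (n:ℝ) ^ (-a) := by ring
      rw [this]
      gcongr
    refine h4.trans ?_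
    gcongr
    exact le_max_right _ _

lemma rl_one_rl (ha : 0 < a) {x : ℝ → ℝ} (hx : Continuous x) {t : ℝ} (ht : 0 ≤ t) :
    rl 1 (rl a x) t = a⁻¹ * rl (a + 1) x t := by
  rw [rl_eq one_pos _ ht, rl_eq (by linarith) x ht]
  simp only [sub_self, Real.rpow_zero, one_mul, add_sub_cancel_right]
  set μ := volume.restrict (Ioc 0 t) with hμ
  let G : ℝ → ℝ → ℝ := fun s u => (Iio s).indicator (fun u => (s - u) ^ (a - 1) * x u) u
  have e1 : ∫ s in (0:ℝ)..t, rl a x s = ∫ s, ∫ u, G s u ∂μ ∂μ := by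
    rw [intervalIntegral.integral_of_le ht]
    refine setIntegral_congr_fun measurableSet_Ioc fun s hs => ?_
    simp only [G]
    rw [rl_eq ha x hs.1.le, intervalIntegral.integral_of_le hs.1.le,
      integral_indicator measurableSet_Iio, hμ, Measure.restrict_restrict measurableSet_Iio,
      integral_Ioc_eq_integral_Ioo]
    congr 2
    ext u
    simp only [mem_Ioo, mem_inter_iff, mem_Iio, mem_Ioc]
    constructor
    · rintro ⟨h1, h2⟩; exact ⟨h2, h1, h2.le.trans hs.2⟩
    · rintro ⟨h1, h2, h3⟩; exact ⟨h2, h1⟩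
  have hGu : ∀ u, (fun s => G s u) = (Ioi u).indicator (fun s => (s - u) ^ (a - 1) * x u) := by
    intro u; ext s
    simp only [G, indicator, mem_Iio, mem_Ioi]
  have hrp : ∀ u c d : ℝ, IntervalIntegrable (fun s : ℝ => (s - u) ^ (a - 1)) volume c d := by
    intro u c d
    have := (intervalIntegral.intervalIntegrable_rpow' (r := a - 1) (by linarith) (a := c - u)
      (b := d - u)).comp_sub_right u
    simpa using this
  have hin : ∀ u ∈ Ioc 0 t, ∀ c : ℝ, ∫ s, (Ioi u).indicator (fun s => (s - u) ^ (a - 1) * c) s ∂μ =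
      (t - u) ^ a / a * c := by
    intro u hu c
    rw [integral_indicator measurableSet_Ioi, hμ, Measure.restrict_restrict measurableSet_Ioi]
    have : Ioi u ∩ Ioc 0 t = Ioc u t := by
      ext s; simp only [mem_inter_iff, mem_Ioi, mem_Ioc]
      constructor
      · rintro ⟨h1, h2, h3⟩; exact ⟨h1, h3⟩
      · rintro ⟨h1, h2⟩; exact ⟨h1, hu.1.trans h1, h2⟩
    rw [this, ← intervalIntegral.integral_of_le hu.2, intervalIntegral.integral_mul_const,
      intervalIntegral.integral_comp_sub_right (fun s => s ^ (a - 1)) u,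
      integral_rpow (by left; linarith)]
    simp [Real.zero_rpow ha.ne']
  have hmeas : Measurable (Function.uncurry G) := by
    have : Function.uncurry G = {p : ℝ × ℝ | p.2 < p.1}.indicator
        (fun p => (p.1 - p.2) ^ (a - 1) * x p.2) := by
      ext ⟨s, u⟩; simp [G, indicator, Function.uncurry]
    rw [this]
    refine Measurable.indicator ?_ (measurableSet_lt measurable_snd measurable_fst)
    exact ((measurable_fst.sub measurable_snd).pow_const _).mul (hx.measurable.comp measurable_snd)
  have hInt : Integrable (Function.uncurry G) (μ.prod μ) := by
    rw [integrable_prod_iff' hmeas.aestronglyMeasurable]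
    constructor
    · refine ae_of_all _ fun u => ?_
      simp only [Function.uncurry]
      rw [hGu u]
      refine Integrable.indicator ?_ measurableSet_Ioi
      exact ((hrp u 0 t).mul_const (x u)).1
    · have : ∀ u ∈ Ioc 0 t, ∫ s, ‖Function.uncurry G (s, u)‖ ∂μ = (t - u) ^ a / a * |x u| := by
        intro u hu
        rw [← hin u hu]
        congr 1; ext s
        simp only [Function.uncurry, G, indicator, mem_Iio, mem_Ioi]
        split_ifs with h
        · rw [norm_mul, Real.norm_of_nonneg (Real.rpow_nonneg (by linarith) _), Real.norm_eq_abs]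
        · simp
      have h2 : Integrable (fun u => (t - u) ^ a / a * |x u|) μ := by
        refine (Continuous.integrableOn_Icc ?_).mono_set Ioc_subset_Icc_self
        have : Continuous fun u : ℝ => (t - u) ^ a :=
          (continuous_const.sub continuous_id).rpow_const fun _ => Or.inr ha.le
        fun_prop
      refine h2.congr ?_
      filter_upwards [ae_restrict_mem measurableSet_Ioc] with u hu
      exact (this u hu).symm
  rw [e1, integral_integral_swap hInt, intervalIntegral.integral_of_le ht, ← integral_const_mul]
  refine setIntegral_congr_fun measurableSet_Ioc fun u hu => ?_
  change ∫ s, G s u ∂μ = _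
  rw [hGu u, hin u hu]
  ring

lemma Ent.step (ha : 0 < a) (h : Ent a) : Ent (a + 1) := by
  classical
  obtain ⟨C1, hC1, H1⟩ := h
  obtain ⟨C2, hC2, H2⟩ := Ent.base one_pos le_rfl
  have hC12 : 1 ≤ C1 * C2 := by nlinarith
  refine ⟨max (C1 * C2) (a * (C1 * C2)), le_max_of_le_left hC12, ?_⟩
  intro n hn
  have hn0 : (0:ℝ) < n := by exact_mod_cast hn
  obtain ⟨N1, code1, hN1, P1⟩ := H1 n hn
  obtain ⟨N2, code2, hN2, P2⟩ := H2 n hn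
  let good : (ℝ → ℝ) → Prop := fun x => Continuous x ∧ ∀ u ∈ Icc (0:ℝ) 1, |x u| ≤ 1
  let rep : Fin N1 → (ℝ → ℝ) := fun k =>
    if h : ∃ x, good x ∧ code1 x = k then h.choose else 0
  let q : ℝ := (C1 * (n:ℝ) ^ (-a))⁻¹
  have hq : 0 < q := by positivity
  let res : (ℝ → ℝ) → (ℝ → ℝ) := fun x u => q * (rl a x u - rl a (rep (code1 x)) u)
  let e := Fintype.equivFin (Fin N1 × Fin N2)
  refine ⟨_, fun x => e (code1 x, code2 (res x)), ?_, ?_⟩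
  · rw [Fintype.card_prod, Fintype.card_fin, Fintype.card_fin]
    push_cast
    calc (N1:ℝ) * N2 ≤ C1 ^ n * C2 ^ n := by gcongr
      _ = (C1 * C2) ^ n := by rw [mul_pow]
      _ ≤ _ := by gcongr; exact le_max_left _ _
  · intro x y hx hy hx1 hy1 hxy t ht
    obtain ⟨hc1, hc2⟩ := Prod.mk.inj (e.injective hxy)
    have hrep : ∀ x, good x → good (rep (code1 x)) ∧ code1 (rep (code1 x)) = code1 x := by
      intro x hx
      have hex : ∃ y, good y ∧ code1 y = code1 x := ⟨x, hx, rfl⟩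
      have : rep (code1 x) = hex.choose := dif_pos hex
      rw [this]; exact hex.choose_spec
    have hres : ∀ x, good x → Continuous (res x) ∧ ∀ u ∈ Icc (0:ℝ) 1, |res x u| ≤ 1 := by
      intro x hx
      obtain ⟨hr, hrc⟩ := hrep x hx
      refine ⟨((rl_continuous ha hx.1).sub (rl_continuous ha hr.1)).const_mul q, fun u hu => ?_⟩
      have := P1 x _ hx.1 hr.1 hx.2 hr.2 hrc.symm u hu
      simp only [res]
      rw [abs_mul, abs_of_pos hq]
      calc _ ≤ q * (C1 * (n:ℝ) ^ (-a)) := by gcongr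
        _ = 1 := inv_mul_cancel₀ (by positivity)
    have hX := hres x ⟨hx, hx1⟩
    have hY := hres y ⟨hy, hy1⟩
    have key := P2 _ _ hX.1 hY.1 hX.2 hY.2 hc2 t ht
    have er : ∀ x, good x → rl 1 (res x) t =
        q * (a⁻¹ * rl (a+1) x t - rl 1 (rl a (rep (code1 x))) t) := by
      intro x hx
      have hr := (hrep x hx).1
      simp only [res]
      rw [rl_smul, rl_sub one_pos (rl_continuous ha hx.1) (rl_continuous ha hr.1),
        rl_one_rl ha hx.1 ht.1]
    rw [er x ⟨hx, hx1⟩, er y ⟨hy, hy1⟩, hc1, ← mul_sub, sub_sub_sub_cancel_right, ← mul_sub,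
      abs_mul, abs_mul, abs_of_pos hq, abs_of_pos (inv_pos.2 ha)] at key
    have : |rl (a+1) x t - rl (a+1) y t| ≤ a * (C1 * C2) * (n:ℝ) ^ (-(a+1)) := by
      have e2 : (n:ℝ) ^ (-(a+1)) = (n:ℝ) ^ (-a) * (n:ℝ) ^ (-1:ℝ) := by
        rw [← Real.rpow_add hn0]; ring_nf
      have e3 : |rl (a+1) x t - rl (a+1) y t| = a * (C1 * (n:ℝ) ^ (-a)) *
          (q * (a⁻¹ * |rl (a+1) x t - rl (a+1) y t|)) := by
        simp only [q]
        have : (n:ℝ) ^ (-a) ≠ 0 := by positivity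
        have : C1 ≠ 0 := by positivity
        field_simp
      rw [e3, e2]
      calc _ ≤ a * (C1 * (n:ℝ) ^ (-a)) * (C2 * (n:ℝ) ^ (-1:ℝ)) := by gcongr
        _ = _ := by ring
    refine this.trans ?_
    gcongr
    exact le_max_right _ _

lemma Ent.all {θ : ℝ} (hθ : 0 < θ) : Ent θ := by
  have h : ∀ m : ℕ, ∀ a : ℝ, 0 < a → a ≤ 1 → Ent (a + m) := by
    intro m
    induction m with
    | zero => intro a h1 h2; simpa using Ent.base h1 h2
    | succ m ih =>
      intro a h1 h2
      have := (ih a h1 h2).step (by positivity)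
      push_cast; rwa [← add_assoc]
  have h1 := Nat.ceil_lt_add_one hθ.le
  have h2 := Nat.le_ceil θ
  have h3 : 1 ≤ ⌈θ⌉₊ := Nat.one_le_iff_ne_zero.2 (Nat.ceil_pos.2 hθ).ne'
  have := h (⌈θ⌉₊ - 1) (θ - (⌈θ⌉₊ - 1 : ℕ)) (by push_cast [h3]; linarith) (by push_cast [h3]; linarith)
  simpa using this

end entropy

section process
variable {Ω : Type*} [MeasurableSpace Ω] {P : Measure Ω} [IsProbabilityMeasure P]

/-- A continuous centered Gaussian process indexed by `ℝ`, null at `0` and self-similar. -/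
structure GP (P : Measure Ω) (κ : ℝ) (Z : ℝ → Ω → ℝ) : Prop where
  cg : ∀ (n : ℕ) (t : Fin n → ℝ), CG P (fun i => Z (t i))
  cont : ∀ ω, Continuous fun t => Z t ω
  zero : ∀ ω, Z 0 ω = 0
  ss : ∀ (n : ℕ) (t : Fin n → ℝ) (c : ℝ), 0 < c → ∀ a : Fin n → ℝ,
    P.map (fun ω => ∑ i, a i * Z (c * t i) ω) = P.map (fun ω => ∑ i, a i * (c ^ κ * Z (t i) ω))

variable {κ : ℝ} {Z : ℝ → Ω → ℝ}

lemma GP.gaussian (h : GP P κ Z) {ι : Type*} [Fintype ι] (t : ι → ℝ) : CG P (fun i => Z (t i)) := by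
  have e := Fintype.equivFin ι
  have := (h.cg _ (fun k => t (e.symm k))).reindex e
  simpa using this

lemma GP.scaling (h : GP P κ Z) {ι : Type*} [Fintype ι] (t : ι → ℝ) {c : ℝ} (hc : 0 < c)
    (a : ι → ℝ) :
    P.map (fun ω => ∑ i, a i * Z (c * t i) ω) = P.map (fun ω => ∑ i, a i * (c ^ κ * Z (t i) ω)) := by
  have e := Fintype.equivFin ι
  have := h.ss _ (fun k => t (e.symm k)) c hc (fun k => a (e.symm k))
  have e1 : ∀ f : ι → ℝ, ∑ k, f (e.symm k) = ∑ i, f i := fun f => e.symm.sum_comp f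
  have e2 : (fun ω => ∑ k, a (e.symm k) * Z (c * t (e.symm k)) ω) =
      fun ω => ∑ i, a i * Z (c * t i) ω := by
    ext ω; exact e1 fun i => a i * Z (c * t i) ω
  have e3 : (fun ω => ∑ k, a (e.symm k) * (c ^ κ * Z (t (e.symm k)) ω)) =
      fun ω => ∑ i, a i * (c ^ κ * Z (t i) ω) := by
    ext ω; exact e1 fun i => a i * (c ^ κ * Z (t i) ω)
  rwa [e2, e3] at this

lemma GP.scaling_law (h : GP P κ Z) {ι : Type*} [Fintype ι] (t : ι → ℝ) {c : ℝ} (hc : 0 < c) :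
    P.map (fun ω i => Z (c * t i) ω) = P.map (fun ω i => c ^ κ * Z (t i) ω) := by
  refine law_ext (Z := fun i ω => Z (c * t i) ω) (Z' := fun i ω => c ^ κ * Z (t i) ω)
    (h.gaussian fun i => c * t i).aemeasurable_pi ?_ (h.scaling t hc)
  exact aemeasurable_pi_lambda _ fun i => ((h.gaussian t).aemeasurable i).const_mul _

lemma GP.aemeasurable (h : GP P κ Z) (t : ℝ) : AEMeasurable (Z t) P :=
  (h.gaussian fun _ : Unit => t).aemeasurable ()

lemma rl_max (a : ℝ) (x : ℝ → ℝ) (t : ℝ) : rl a x (max t 0) = rl a x t := by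
  simp [rl]

lemma GP.rl_approx {θ : ℝ} (hθ : 0 < θ) (h : GP P κ Z) (d : ℝ) {m : ℕ} (t : Fin m → ℝ)
    (a : Fin m → ℝ) (ω : Ω) :
    Tendsto (fun n : ℕ => ∑ p : Fin m × Fin (n+1),
      (a p.1 * d * ((max (t p.1) 0) ^ θ * rlWeight θ (n+1) p.2)) *
        Z (max (t p.1) 0 * ((p.2:ℕ) / (n+1 : ℕ))) ω) atTop
      (𝓝 (∑ i, a i * (d * rl θ (fun u => Z u ω) (t i)))) := by
  have : ∀ n : ℕ, ∑ p : Fin m × Fin (n+1),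
      (a p.1 * d * ((max (t p.1) 0) ^ θ * rlWeight θ (n+1) p.2)) *
        Z (max (t p.1) 0 * ((p.2:ℕ) / (n+1 : ℕ))) ω =
      ∑ i, a i * (d * ∑ j : Fin (n+1), ((max (t i) 0) ^ θ * rlWeight θ (n+1) j) *
        Z (max (t i) 0 * ((j:ℕ) / (n+1 : ℕ))) ω) := by
    intro n
    rw [Fintype.sum_prod_type]
    refine Finset.sum_congr rfl fun i _ => ?_
    rw [Finset.mul_sum, Finset.mul_sum]
    exact Finset.sum_congr rfl fun j _ => by ring
  simp_rw [this]
  refine tendsto_finsetSum _ fun i _ => ?_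
  refine (Tendsto.const_mul d ?_).const_mul (a i)
  rw [← rl_max]
  exact rl_sum_tendsto hθ (h.cont ω) (le_max_right _ _)

lemma GP.rl {θ : ℝ} (hθ : 0 < θ) (h : GP P κ Z) (d : ℝ) :
    GP P (κ + θ) (fun t ω => d * rl θ (fun u => Z u ω) t) where
  cg n t a := by
    have hv : ∀ k : ℕ, _ := fun k => (h.gaussian
      (fun p : Fin n × Fin (k+1) => max (t p.1) 0 * ((p.2:ℕ) / (k+1 : ℕ))))
        fun p => a p.1 * d * ((max (t p.1) 0) ^ θ * rlWeight θ (k+1) p.2)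
    choose v hv using hv
    obtain ⟨w, -, hw⟩ := gaussian_limit hv (h.rl_approx hθ d t a)
    exact ⟨w, hw⟩
  cont ω := (rl_continuous hθ (h.cont ω)).const_mul d
  zero ω := by simp [LowerClass.rl, Real.zero_rpow hθ.ne']
  ss n t c hc a := by
    have hm : ∀ i, max (c * t i) 0 = c * max (t i) 0 := fun i => by
      rw [mul_max_of_nonneg _ _ hc.le, mul_zero]
    have hv : ∀ k : ℕ, _ := fun k => (h.gaussian
      (fun p : Fin n × Fin (k+1) => max (c * t p.1) 0 * ((p.2:ℕ) / (k+1 : ℕ))))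
        fun p => a p.1 * d * ((max (c * t p.1) 0) ^ θ * rlWeight θ (k+1) p.2)
    choose v hv using hv
    obtain ⟨w, hw1, hw⟩ := gaussian_limit hv (h.rl_approx hθ d (fun i => c * t i) a)
    have hv' : ∀ k, P.map (fun ω => ∑ p : Fin n × Fin (k+1),
        (a p.1 * c ^ (κ + θ) * d * ((max (t p.1) 0) ^ θ * rlWeight θ (k+1) p.2)) *
        Z (max (t p.1) 0 * ((p.2:ℕ) / (k+1 : ℕ))) ω) = gaussianReal 0 (v k) := by
      intro k
      rw [← hv k]
      simp only [hm, mul_assoc c]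
      rw [h.scaling _ hc]
      congr 1; ext ω
      refine Finset.sum_congr rfl fun p _ => ?_
      rw [Real.mul_rpow hc.le (le_max_right _ _), Real.rpow_add hc]
      ring
    obtain ⟨w', hw1', hw'⟩ := gaussian_limit hv'
      (h.rl_approx hθ d t fun i => a i * c ^ (κ + θ))
    rw [hw, tendsto_nhds_unique hw1 hw1', ← hw']
    congr 1; ext ω
    exact Finset.sum_congr rfl fun i _ => by ring

lemma gfbmCov_scale {α γ : ℝ} (s t : ℝ) {c : ℝ} (hc : 0 < c) :
    gfbmCov α γ (c * s) (c * t) = c ^ (2 * α - γ + 1) * gfbmCov α γ s t := by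
  unfold gfbmCov
  have h := Measure.integral_comp_mul_left (fun u : ℝ =>
    ((max (c * s - u) 0) ^ α - (max (-u) 0) ^ α) *
    ((max (c * t - u) 0) ^ α - (max (-u) 0) ^ α) * |u| ^ (-γ)) c
  rw [abs_of_pos (inv_pos.2 hc), smul_eq_mul, eq_comm, inv_mul_eq_iff_eq_mul₀ hc.ne'] at h
  rw [h, ← integral_const_mul, ← integral_const_mul]
  congr 1; ext u
  have hm : ∀ x : ℝ, (max (c * x) 0) ^ α = c ^ α * (max x 0) ^ α := fun x => by
    rw [← Real.mul_rpow hc.le (le_max_right _ _), mul_max_of_nonneg _ _ hc.le, mul_zero]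
  rw [← mul_sub, ← mul_sub, ← mul_neg, hm, hm, hm, abs_mul, abs_of_pos hc,
    Real.mul_rpow hc.le (abs_nonneg _), Real.rpow_add hc, Real.rpow_sub hc, two_mul,
    Real.rpow_add hc, Real.rpow_neg hc.le, Real.rpow_one]
  field_simp

lemma CG.integral_sq {ι : Type*} [Fintype ι] {W : ι → Ω → ℝ} (h : CG P W) (c : ι → ℝ) :
    ∫ ω, (∑ i, c i * W i ω) ^ 2 ∂P = ∑ i, ∑ j, c i * c j * ∫ ω, W i ω * W j ω ∂P := by
  have hi : ∀ i j, Integrable (fun ω => W i ω * W j ω) P := fun i j =>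
    (h.memLp i).integrable_mul (h.memLp j)
  have : ∀ ω, (∑ i, c i * W i ω) ^ 2 = ∑ i, ∑ j, c i * c j * (W i ω * W j ω) := by
    intro ω
    rw [sq, Finset.sum_mul_sum]
    exact Finset.sum_congr rfl fun i _ => Finset.sum_congr rfl fun j _ => by ring
  simp_rw [this]
  rw [integral_finsetSum _ fun i _ => integrable_finsetSum _ fun j _ => (hi i j).const_mul _]
  refine Finset.sum_congr rfl fun i _ => ?_
  rw [integral_finsetSum _ fun j _ => (hi i j).const_mul _]
  exact Finset.sum_congr rfl fun j _ => integral_const_mul _ _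

lemma integral_sq_of_gaussian {L : Ω → ℝ} {v : ℝ≥0} (h : P.map L = gaussianReal 0 v) :
    ∫ ω, L ω ^ 2 ∂P = v := by
  have hm := aemeasurable_of_map_eq_gaussian h
  have h1 := integral_map hm (f := fun x : ℝ => x ^ 2) (by fun_prop)
  rw [← h1, h]
  have h2 := variance_id_gaussianReal (μ := 0) (v := v)
  rw [variance_eq_integral (by fun_prop)] at h2
  simpa using h2

lemma CG.map_sum_eq {ι κ : Type*} [Fintype ι] [Fintype κ] {W : ι → Ω → ℝ} {W' : κ → Ω → ℝ}
    (h : CG P W) (h' : CG P W') (c : ι → ℝ) (c' : κ → ℝ)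
    (hc : ∫ ω, (∑ i, c i * W i ω) ^ 2 ∂P = ∫ ω, (∑ i, c' i * W' i ω) ^ 2 ∂P) :
    P.map (fun ω => ∑ i, c i * W i ω) = P.map (fun ω => ∑ i, c' i * W' i ω) := by
  obtain ⟨v, hv⟩ := h c
  obtain ⟨v', hv'⟩ := h' c'
  rw [integral_sq_of_gaussian hv, integral_sq_of_gaussian hv'] at hc
  rw [hv, hv', NNReal.coe_injective hc]

lemma GP.of_isGFBM {α γ H : ℝ} (hH : H = α - γ/2 + 1/2) {X : ℝ → Ω → ℝ} (hX : IsGFBM P α γ X) :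
    GP P H (fun t ω => X (max t 0) ω) where
  cg n t := fun c => hX.1 n (fun i => max (t i) 0) c
  cont ω := (hX.2.1 ω).comp_continuous (by fun_prop) fun t => mem_Ici.2 (le_max_right _ _)
  zero ω := by simpa using hX.2.2.1 ω
  ss n t c hc a := by
    have h1 : CG P (fun i : Fin n => X (max (c * t i) 0)) := hX.1 n (fun i => max (c * t i) 0)
    have h2 : CG P (fun i : Fin n => X (max (t i) 0)) := hX.1 n (fun i => max (t i) 0)
    have e : (fun ω => ∑ i, a i * (c ^ H * X (max (t i) 0) ω)) =
        fun ω => ∑ i, (a i * c ^ H) * X (max (t i) 0) ω := by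
      ext ω; simp only [mul_assoc]
    rw [e]
    refine h1.map_sum_eq h2 a (fun i => a i * c ^ H) ?_
    rw [h1.integral_sq, h2.integral_sq]
    refine Finset.sum_congr rfl fun i _ => Finset.sum_congr rfl fun j _ => ?_
    rw [hX.2.2.2 _ _ (le_max_right _ _) (le_max_right _ _),
      hX.2.2.2 _ _ (le_max_right _ _) (le_max_right _ _)]
    have hm : ∀ x : ℝ, max (c * x) 0 = c * max x 0 := fun x => by
      rw [mul_max_of_nonneg _ _ hc.le, mul_zero]
    rw [hm, hm, gfbmCov_scale _ _ hc]
    have : c ^ (2 * α - γ + 1) = c ^ H * c ^ H := by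
      rw [← Real.rpow_add hc]; congr 1; rw [hH]; ring
    rw [this]; ring

lemma fracInt_eq {θ : ℝ} (hθ : 0 < θ) (X : ℝ → Ω → ℝ) {t : ℝ} (ht : 0 ≤ t) (ω : Ω) :
    fracInt θ X t ω = (Real.Gamma θ)⁻¹ * rl θ (fun u => X (max u 0) ω) t := by
  rw [fracInt, rl_eq hθ _ ht]
  congr 1
  refine intervalIntegral.integral_congr fun u hu => ?_
  rw [uIcc_of_le ht] at hu
  simp only [max_eq_left hu.1]

end process

section smallBallSection
variable {Ω : Type*} [MeasurableSpace Ω] {P : Measure Ω} [IsProbabilityMeasure P]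
  {κ : ℝ} {Z : ℝ → Ω → ℝ}

/-- The probability that `|Z| ≤ x` on `[0, 1]`. -/
noncomputable def sb (P : Measure Ω) (Z : ℝ → Ω → ℝ) (x : ℝ) : ℝ≥0∞ :=
  P {ω | ∀ s ∈ Icc (0:ℝ) 1, |Z s ω| ≤ x}

/-- The probability that `|Z| ≤ x` on the dyadic grid of mesh `2 ^ (-K)`. -/
noncomputable def gridBall (P : Measure Ω) (Z : ℝ → Ω → ℝ) (K : ℕ) (x : ℝ) : ℝ≥0∞ :=
  P {ω | ∀ j : Fin (2 ^ K + 1), |Z ((j:ℕ) / 2 ^ K) ω| ≤ x}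

lemma grid_mem (K : ℕ) (j : Fin (2 ^ K + 1)) : ((j:ℕ) / 2 ^ K : ℝ) ∈ Icc (0:ℝ) 1 := by
  refine ⟨by positivity, ?_⟩
  rw [div_le_one (by positivity)]
  exact_mod_cast Nat.lt_succ_iff.1 j.2

lemma sb_le_gridBall (K : ℕ) (x : ℝ) : sb P Z x ≤ gridBall P Z K x :=
  measure_mono fun _ hω j => hω _ (grid_mem K j)

lemma grid_floor_tendsto {s : ℝ} (hs : s ∈ Icc (0:ℝ) 1) :
    Tendsto (fun K : ℕ => (⌊s * 2 ^ K⌋₊ : ℝ) / 2 ^ K) atTop (𝓝 s) := by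
  have h := (tendsto_nat_floor_mul_div_atTop hs.1).comp
    (tendsto_pow_atTop_atTop_of_one_lt (one_lt_two (α := ℝ)))
  exact h

lemma grid_iff {z : ℝ → ℝ} (hz : Continuous z) (x : ℝ) :
    (∀ s ∈ Icc (0:ℝ) 1, |z s| ≤ x) ↔ ∀ K : ℕ, ∀ j : Fin (2 ^ K + 1), |z ((j:ℕ) / 2 ^ K)| ≤ x := by
  refine ⟨fun h K j => h _ (grid_mem K j), fun h s hs => ?_⟩
  refine le_of_tendsto ((hz.abs.tendsto s).comp (grid_floor_tendsto hs)) (Eventually.of_forall fun K => ?_)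
  refine h K ⟨⌊s * 2 ^ K⌋₊, Nat.lt_succ_of_le ?_⟩
  refine Nat.floor_le_of_le ?_
  push_cast
  have : (0:ℝ) < 2 ^ K := by positivity
  nlinarith [hs.2]

lemma GP.gridBall_tendsto (h : GP P κ Z) (x : ℝ) :
    Tendsto (fun K => gridBall P Z K x) atTop (𝓝 (sb P Z x)) := by
  have e : {ω | ∀ s ∈ Icc (0:ℝ) 1, |Z s ω| ≤ x} =
      ⋂ K : ℕ, {ω | ∀ j : Fin (2 ^ K + 1), |Z ((j:ℕ) / 2 ^ K) ω| ≤ x} := by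
    ext ω
    simp only [mem_iInter]
    exact grid_iff (h.cont ω) x
  unfold sb gridBall
  rw [e]
  refine tendsto_measure_iInter_atTop (fun K => ?_) ?_ ⟨0, measure_ne_top _ _⟩
  · simp only [ofPred_forall]
    refine NullMeasurableSet.iInter fun j => ?_
    exact nullMeasurableSet_le (h.aemeasurable _).abs aemeasurable_const
  · refine antitone_nat_of_succ_le fun K ω hω j => ?_
    have := hω ⟨2 * j, by have := j.2; rw [pow_succ]; omega⟩
    have e1 : ((2 * (j:ℕ) : ℕ) : ℝ) / 2 ^ (K + 1) = (j:ℕ) / 2 ^ K := by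
      push_cast
      rw [pow_succ]
      field_simp
    simp only [e1] at this
    exact this

lemma GP.le_sb (h : GP P κ Z) {x : ℝ} {p : ℝ≥0∞} (hp : ∀ K, p ≤ gridBall P Z K x) :
    p ≤ sb P Z x :=
  ge_of_tendsto' (h.gridBall_tendsto x) hp

lemma GP.sb_concave (h : GP P κ Z) {l : ℝ} (hl0 : 0 < l) (hl1 : l < 1) (x y : ℝ) :
    sb P Z x ^ (1 - l) * sb P Z y ^ l ≤ sb P Z ((1 - l) * x + l * y) := by
  refine h.le_sb fun K => ?_
  have := (h.gaussian fun j : Fin (2 ^ K + 1) => ((j:ℕ) / 2 ^ K : ℝ)).box_concave hl0 hl1 0 0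
    (fun _ => x) (fun _ => y)
  simp only [Pi.zero_apply, sub_zero, mul_zero, add_zero] at this
  refine le_trans ?_ this
  gcongr
  · exact sb_le_gridBall K x
  · exact sb_le_gridBall K y

lemma GP.sb_anderson (h : GP P κ Z) (y : ℝ → ℝ) (x : ℝ) :
    P {ω | ∀ s ∈ Icc (0:ℝ) 1, |Z s ω - y s| ≤ x} ≤ sb P Z x := by
  refine h.le_sb fun K => ?_
  refine le_trans ?_ ((h.gaussian fun j : Fin (2 ^ K + 1) => ((j:ℕ) / 2 ^ K : ℝ)).anderson
    (fun j => y ((j:ℕ) / 2 ^ K)) fun _ => x)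
  exact measure_mono fun _ hω j => hω _ (grid_mem K j)

lemma GP.sb_scaling (h : GP P κ Z) {t : ℝ} (ht : 0 < t) (x : ℝ) :
    P {ω | ∀ s ∈ Icc (0:ℝ) t, |Z s ω| ≤ x} ≤ sb P Z (x / t ^ κ) := by
  refine h.le_sb fun K => ?_
  have htk : 0 < t ^ κ := Real.rpow_pos_of_pos ht _
  let g : Fin (2 ^ K + 1) → ℝ := fun j => (j:ℕ) / 2 ^ K
  have hB : MeasurableSet {z : Fin (2 ^ K + 1) → ℝ | ∀ j, |z j| ≤ x} := by
    simp only [ofPred_forall]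
    exact MeasurableSet.iInter fun j => measurableSet_le (by fun_prop) measurable_const
  have e1 := Measure.map_apply_of_aemeasurable (h.gaussian fun j => t * g j).aemeasurable_pi hB
  have e2 := Measure.map_apply_of_aemeasurable
    (aemeasurable_pi_lambda (fun ω j => t ^ κ * Z (g j) ω)
      fun j => ((h.gaussian g).aemeasurable j).const_mul (t ^ κ)) hB
  rw [h.scaling_law g ht] at e1
  calc P {ω | ∀ s ∈ Icc (0:ℝ) t, |Z s ω| ≤ x}
      ≤ P ((fun ω j => Z (t * g j) ω) ⁻¹' {z : Fin (2 ^ K + 1) → ℝ | ∀ j, |z j| ≤ x}) := by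
        refine measure_mono fun ω hω j => hω _ ?_
        have := grid_mem K j
        exact ⟨mul_nonneg ht.le this.1, mul_le_of_le_one_right ht.le this.2⟩
    _ = P ((fun ω j => t ^ κ * Z (g j) ω) ⁻¹' {z : Fin (2 ^ K + 1) → ℝ | ∀ j, |z j| ≤ x}) :=
        e1.symm.trans e2
    _ ≤ gridBall P Z K (x / t ^ κ) := by
        refine measure_mono fun ω hω j => ?_
        have := hω j
        rw [abs_mul, abs_of_pos htk] at this
        rw [le_div_iff₀ htk, mul_comm]
        exact this

lemma sb_mono : Monotone (sb P Z) := fun _ _ h => measure_mono fun _ hω s hs => (hω s hs).trans h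

lemma runSup_le_iff {Y : ℝ → Ω → ℝ} {ω : Ω} {z : ℝ → ℝ} (hz : Continuous z)
    (hY : ∀ s, 0 ≤ s → Y s ω = z s) {t : ℝ} (ht : 0 ≤ t) (x : ℝ) :
    runSup Y t ω ≤ x ↔ ∀ s ∈ Icc (0:ℝ) t, |z s| ≤ x := by
  unfold runSup
  have hne : Nonempty (Icc (0:ℝ) t) := ⟨⟨0, le_rfl, ht⟩⟩
  have hbdd : BddAbove (range fun s : Icc (0:ℝ) t => |Y s.1 ω|) := by
    obtain ⟨C, hC⟩ := (isCompact_Icc (a := (0:ℝ)) (b := t)).exists_bound_of_continuousOn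
      hz.continuousOn
    refine ⟨C, ?_⟩
    rintro _ ⟨s, rfl⟩
    simp only [hY s.1 s.2.1]
    exact hC s.1 s.2
  rw [ciSup_le_iff hbdd]
  constructor
  · intro h s hs
    rw [← hY s hs.1]; exact h ⟨s, hs⟩
  · intro h s
    rw [hY s.1 s.2.1]; exact h s.1 s.2

end smallBallSection

section variances

/-- The increment kernel of the moving average. -/
noncomputable def incrKer (α w : ℝ) : ℝ := (max (1 + w) 0) ^ α - (max w 0) ^ α

variable {α γ : ℝ}

lemma incrKer_measurable : Measurable (incrKer α) := by
  unfold incrKer; fun_prop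

lemma incrKer_zero (w : ℝ) : incrKer 0 w = 0 := by simp [incrKer]

lemma incrKer_sq_le_tail (hα : |α| ≤ 1) {w : ℝ} (hw : 0 < w) :
    incrKer α w ^ 2 ≤ w ^ (2 * α - 2) := by
  have h1 : α ≤ 1 := (abs_le.1 hα).2
  rw [incrKer, max_eq_left (by linarith), max_eq_left hw.le]
  obtain ⟨x, hx, he⟩ := exists_hasDerivAt_eq_slope (fun x : ℝ => x ^ α) (fun x => α * x ^ (α - 1))
    (show w < 1 + w by linarith)
    (fun x hx => (Real.continuousAt_rpow_const x α (Or.inl (by linarith [hx.1]))).continuousWithinAt)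
    (fun x hx => Real.hasDerivAt_rpow_const (Or.inl (by linarith [hx.1])))
  have e2 : (1 + w) ^ α - w ^ α = α * x ^ (α - 1) := by rw [he]; simp
  have hle : x ^ (α - 1) ≤ w ^ (α - 1) := Real.rpow_le_rpow_of_nonpos hw hx.1.le (by linarith)
  have hx0 : 0 ≤ x ^ (α - 1) := Real.rpow_nonneg (by linarith [hx.1]) _
  rw [e2, mul_pow]
  have e3 : w ^ (2 * α - 2) = (w ^ (α - 1)) ^ 2 := by
    rw [← Real.rpow_mul_natCast hw.le]; congr 1; push_cast; ring
  rw [e3]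
  have : α ^ 2 ≤ 1 := by rw [← sq_abs]; exact pow_le_one₀ (abs_nonneg _) hα
  calc α ^ 2 * (x ^ (α - 1)) ^ 2 ≤ 1 * (w ^ (α - 1)) ^ 2 := by gcongr
    _ = _ := one_mul _

lemma incrKer_sq_le_near (hα : α ∈ Ioo (-1/2 : ℝ) (1/2)) {w : ℝ} (hw : 0 < w) (hw1 : w ≤ 1) :
    incrKer α w ^ 2 ≤ 2 * w ^ (2 * α) + 8 := by
  rw [incrKer, max_eq_left (by linarith), max_eq_left hw.le]
  have h1 : (1 + w) ^ α ≤ 2 := by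
    rcases le_total 0 α with h | h
    · calc (1 + w) ^ α ≤ (1 + w) ^ (1:ℝ) :=
          Real.rpow_le_rpow_of_exponent_le (by linarith) (by linarith [hα.2])
        _ ≤ 2 := by rw [Real.rpow_one]; linarith
    · linarith [Real.rpow_le_one_of_one_le_of_nonpos (show 1 ≤ 1 + w by linarith) h]
  have h2 : 0 ≤ (1 + w) ^ α := Real.rpow_nonneg (by linarith) _
  have h3 : w ^ (2 * α) = (w ^ α) ^ 2 := by
    rw [← Real.rpow_mul_natCast hw.le]; congr 1; push_cast; ring
  rw [h3]
  nlinarith [sq_nonneg ((1 + w) ^ α + w ^ α)]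

lemma incrKer_neg (hα : α ≠ 0) {w : ℝ} (hw : w ≤ 0) : incrKer α w = (max (1 + w) 0) ^ α := by
  rw [incrKer, max_eq_right hw, Real.zero_rpow hα, sub_zero]

lemma abs_rpow_neg_integrable {s : ℝ} (hs : -1 < s) {r : ℝ} (hr : 0 ≤ r) :
    IntegrableOn (fun w : ℝ => |w| ^ s) (Ioo (-r) r) ∧
      ∫ w in Ioo (-r) r, |w| ^ s = 2 * (r ^ (s + 1) / (s + 1)) := by
  have hp : IntegrableOn (fun w : ℝ => |w| ^ s) (Ioc 0 r) := by
    have := (intervalIntegral.intervalIntegrable_rpow' (r := s) hs (a := 0) (b := r)).1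
    refine this.congr_fun (fun w hw => ?_) measurableSet_Ioc
    simp only [abs_of_pos hw.1]
  have hi : IntervalIntegrable (fun w : ℝ => |w| ^ s) volume 0 r :=
    (intervalIntegrable_iff_integrableOn_Ioc_of_le hr).2 hp
  have hi2 : IntervalIntegrable (fun w : ℝ => |w| ^ s) volume (-r) 0 := by
    have := hi.comp_sub_left 0
    simp only [zero_sub, abs_neg, neg_zero] at this
    simpa using this.symm
  have h3 := hi2.trans hi
  have e1 : ∫ w in (0:ℝ)..r, |w| ^ s = r ^ (s + 1) / (s + 1) := by
    have : ∫ w in (0:ℝ)..r, |w| ^ s = ∫ w in (0:ℝ)..r, w ^ s := by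
      refine intervalIntegral.integral_congr fun w hw => ?_
      rw [uIcc_of_le hr] at hw
      simp only [abs_of_nonneg hw.1]
    rw [this, integral_rpow (Or.inl hs), Real.zero_rpow (by linarith), sub_zero]
  have e2 : ∫ w in (-r)..(0:ℝ), |w| ^ s = r ^ (s + 1) / (s + 1) := by
    have := intervalIntegral.integral_comp_neg (fun w : ℝ => |w| ^ s) (a := 0) (b := r)
    simp only [abs_neg, neg_zero] at this
    rw [← this, e1]
  constructor
  · exact ((intervalIntegrable_iff_integrableOn_Ioc_of_le (by linarith)).1 h3).mono_set
      Ioo_subset_Ioc_self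
  · rw [← integral_Ioc_eq_integral_Ioo, ← intervalIntegral.integral_of_le (by linarith),
      ← intervalIntegral.integral_add_adjacent_intervals hi2 hi, e1, e2]
    ring

lemma incrKer_sq_integrable (hα : α ∈ Ioo (-1/2 : ℝ) (1/2)) (hγ : γ ∈ Ico (0:ℝ) 1)
    (h1 : -1 < 2 * α - γ) (h2 : 2 * α - γ < 1) :
    Integrable fun w => incrKer α w ^ 2 * |w| ^ (-γ) := by
  rcases eq_or_ne α 0 with rfl | hα0
  · simp [incrKer_zero]
  have hm : Measurable fun w => incrKer α w ^ 2 * |w| ^ (-γ) :=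
    (incrKer_measurable.pow_const 2).mul (by fun_prop)
  have habs : |α| ≤ 1 := abs_le.2 ⟨by linarith [hα.1], by linarith [hα.2]⟩
  have I0 : IntegrableOn (fun w => incrKer α w ^ 2 * |w| ^ (-γ)) (Iic (-1)) := by
    refine (integrableOn_zero (s := Iic (-1:ℝ))).congr_fun (fun w hw => ?_) measurableSet_Iic
    rw [mem_Iic] at hw
    simp only
    rw [incrKer_neg hα0 (by linarith), max_eq_right (by linarith), Real.zero_rpow hα0]
    ring
  have I1 : IntegrableOn (fun w => incrKer α w ^ 2 * |w| ^ (-γ)) (Ioc (-1) 0) := by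
    have hb : IntegrableOn (fun w : ℝ => 2 * (1 + w) ^ (2 * α) + 2 * |w| ^ (-γ)) (Ioo (-1) 0) := by
      refine Integrable.add ?_ ?_
      · have := (intervalIntegral.intervalIntegrable_rpow' (r := 2 * α) (by linarith [hα.1])
          (a := 0) (b := 1)).comp_add_left 1
        simp only [zero_sub, sub_self] at this
        exact (((intervalIntegrable_iff_integrableOn_Ioc_of_le (by norm_num)).1 this).mono_set
          Ioo_subset_Ioc_self).const_mul 2
      · exact ((abs_rpow_neg_integrable (by linarith [hγ.2]) zero_le_one).1.mono_set
          (Ioo_subset_Ioo_right zero_le_one)).const_mul 2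
    rw [integrableOn_Ioc_iff_integrableOn_Ioo]
    refine Integrable.mono' hb hm.aestronglyMeasurable ?_
    filter_upwards [ae_restrict_mem measurableSet_Ioo] with w hw
    rw [Real.norm_of_nonneg (by positivity), incrKer_neg hα0 hw.2.le,
      max_eq_left (by linarith [hw.1]), ← Real.rpow_mul_natCast (by linarith [hw.1]),
      abs_of_neg hw.2]
    have p1 : 0 < 1 + w := by linarith [hw.1]
    have p2 : 0 < -w := by linarith [hw.2]
    have e : α * (2:ℕ) = 2 * α := by push_cast; ring
    rw [e]
    have q1 : 0 ≤ (1 + w) ^ (2 * α) := by positivity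
    have q2 : 0 ≤ (-w) ^ (-γ) := by positivity
    have aux : ∀ x s : ℝ, 1/2 ≤ x → x ≤ 1 → -1 ≤ s → x ^ s ≤ 2 := by
      intro x s hx hx1 hs
      calc x ^ s ≤ x ^ (-1:ℝ) := Real.rpow_le_rpow_of_exponent_ge (by linarith) hx1 hs
        _ ≤ (1/2:ℝ) ^ (-1:ℝ) := Real.rpow_le_rpow_of_nonpos (by norm_num) hx (by norm_num)
        _ = 2 := by rw [Real.rpow_neg_one]; norm_num
    rcases le_total w (-1/2) with h | h
    · have := aux (-w) (-γ) (by linarith) (by linarith [hw.1]) (by linarith [hγ.2])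
      nlinarith
    · have := aux (1 + w) (2 * α) (by linarith) (by linarith [hw.2]) (by linarith [hα.1])
      nlinarith
  have I2 : IntegrableOn (fun w => incrKer α w ^ 2 * |w| ^ (-γ)) (Ioc 0 1) := by
    have hb : IntegrableOn (fun w : ℝ => 2 * w ^ (2 * α - γ) + 8 * w ^ (-γ)) (Ioc 0 1) :=
      ((intervalIntegral.intervalIntegrable_rpow' h1).1.const_mul 2).add
        ((intervalIntegral.intervalIntegrable_rpow' (by linarith [hγ.2])).1.const_mul 8)
    refine Integrable.mono' hb hm.aestronglyMeasurable ?_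
    filter_upwards [ae_restrict_mem measurableSet_Ioc] with w hw
    rw [Real.norm_of_nonneg (by positivity), abs_of_pos hw.1, sub_eq_add_neg,
      Real.rpow_add hw.1]
    have := incrKer_sq_le_near hα hw.1 hw.2
    have q2 : 0 ≤ w ^ (-γ) := Real.rpow_nonneg hw.1.le _
    nlinarith
  have I3 : IntegrableOn (fun w => incrKer α w ^ 2 * |w| ^ (-γ)) (Ioi 1) := by
    have hb : IntegrableOn (fun w : ℝ => w ^ (2 * α - 2 - γ)) (Ioi 1) :=
      integrableOn_Ioi_rpow_of_lt (by linarith) one_pos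
    refine Integrable.mono' hb hm.aestronglyMeasurable ?_
    filter_upwards [ae_restrict_mem measurableSet_Ioi] with w hw
    have hw0 : 0 < w := one_pos.trans hw
    rw [Real.norm_of_nonneg (by positivity), abs_of_pos hw0, sub_eq_add_neg _ γ,
      Real.rpow_add hw0]
    gcongr
    exact incrKer_sq_le_tail habs hw0
  have : (univ : Set ℝ) = Iic (-1) ∪ Ioc (-1) 0 ∪ (Ioc 0 1 ∪ Ioi 1) := by
    rw [Iic_union_Ioc_eq_Iic (by norm_num), Ioc_union_Ioi_eq_Ioi zero_le_one, Iic_union_Ioi]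
  rw [← integrableOn_univ, this]
  exact (I0.union I1).union (I2.union I3)

lemma incrKer_shift_integral_le (hα : α ∈ Ioo (-1/2 : ℝ) (1/2)) (hγ : γ ∈ Ico (0:ℝ) 1)
    {x : ℝ} (hx : 1 ≤ x) :
    ∫ w, incrKer α w ^ 2 * |x - w| ^ (-γ) ≤
      (2 * (∫ w, incrKer α w ^ 2) + 16 / (1 - γ)) * x ^ (-γ) := by
  have habs : |α| ≤ 1 := abs_le.2 ⟨by linarith [hα.1], by linarith [hα.2]⟩
  have hx0 : 0 < x := by linarith
  have hx2 : 0 < x / 2 := by linarith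
  have hI : Integrable fun w => incrKer α w ^ 2 := by
    have := incrKer_sq_integrable (γ := 0) hα (by norm_num) (by linarith [hα.1]) (by linarith [hα.2])
    simpa using this
  obtain ⟨J1, J2⟩ := abs_rpow_neg_integrable (s := -γ) (by linarith [hγ.2]) hx2.le
  have J1' : Integrable ((Ioo (-(x/2)) (x/2)).indicator fun w : ℝ => |w| ^ (-γ)) :=
    J1.integrable_indicator measurableSet_Ioo
  have K1 : Integrable fun w => (Ioo (-(x/2)) (x/2)).indicator (fun w : ℝ => |w| ^ (-γ)) (x - w) :=
    J1'.comp_sub_left x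
  have K2 : ∫ w, (Ioo (-(x/2)) (x/2)).indicator (fun w : ℝ => |w| ^ (-γ)) (x - w) =
      2 * ((x/2) ^ (-γ + 1) / (-γ + 1)) := by
    rw [integral_sub_left_eq_self (fun w => (Ioo (-(x/2)) (x/2)).indicator (fun w : ℝ => |w| ^ (-γ)) w),
      integral_indicator measurableSet_Ioo, J2]
  have hhalf : ∀ s : ℝ, -3 ≤ s → s ≤ 0 → (x / 2) ^ s ≤ (2:ℝ) ^ (-s) * x ^ s := by
    intro s _ _
    rw [Real.div_rpow hx0.le zero_le_two, Real.rpow_neg zero_le_two, div_eq_inv_mul]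
  have b1 : (x / 2) ^ (-γ) ≤ 2 * x ^ (-γ) := by
    refine (hhalf _ (by linarith [hγ.2]) (by linarith [hγ.1])).trans ?_
    gcongr
    calc (2:ℝ) ^ (- -γ) ≤ 2 ^ (1:ℝ) :=
        Real.rpow_le_rpow_of_exponent_le one_le_two (by linarith [hγ.2])
      _ = 2 := Real.rpow_one _
  have b2 : (x / 2) ^ (2 * α - 2) ≤ 8 * x ^ (2 * α - 2) := by
    refine (hhalf _ (by linarith [hα.1]) (by linarith [hα.2])).trans ?_
    gcongr
    calc (2:ℝ) ^ (-(2 * α - 2)) ≤ 2 ^ (3:ℝ) :=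
        Real.rpow_le_rpow_of_exponent_le one_le_two (by linarith [hα.1])
      _ = 8 := by norm_num
  have hdom : ∀ w, incrKer α w ^ 2 * |x - w| ^ (-γ) ≤ 2 * x ^ (-γ) * incrKer α w ^ 2 +
      8 * x ^ (2 * α - 2) * (Ioo (-(x/2)) (x/2)).indicator (fun w : ℝ => |w| ^ (-γ)) (x - w) := by
    intro w
    by_cases hw : x - w ∈ Ioo (-(x/2)) (x/2)
    · rw [indicator_of_mem hw]
      have hw1 : x / 2 < w := by linarith [hw.2]
      have hk : incrKer α w ^ 2 ≤ 8 * x ^ (2 * α - 2) :=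
        (incrKer_sq_le_tail habs (hx2.trans hw1)).trans
          ((Real.rpow_le_rpow_of_nonpos hx2 hw1.le (by linarith [hα.2])).trans b2)
      have : incrKer α w ^ 2 * |x - w| ^ (-γ) ≤ 8 * x ^ (2 * α - 2) * |x - w| ^ (-γ) := by gcongr
      have h0 : 0 ≤ 2 * x ^ (-γ) * incrKer α w ^ 2 := by positivity
      linarith
    · rw [indicator_of_notMem hw, mul_zero, add_zero]
      have hw1 : x / 2 ≤ |x - w| := by
        by_contra h
        exact hw (abs_lt.1 (not_le.1 h))
      have : |x - w| ^ (-γ) ≤ 2 * x ^ (-γ) :=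
        (Real.rpow_le_rpow_of_nonpos hx2 hw1 (by linarith [hγ.1])).trans b1
      calc incrKer α w ^ 2 * |x - w| ^ (-γ) ≤ incrKer α w ^ 2 * (2 * x ^ (-γ)) := by gcongr
        _ = _ := by ring
  have h1γ : 0 < 1 - γ := by linarith [hγ.2]
  calc ∫ w, incrKer α w ^ 2 * |x - w| ^ (-γ)
      ≤ ∫ w, (2 * x ^ (-γ) * incrKer α w ^ 2 +
      8 * x ^ (2 * α - 2) * (Ioo (-(x/2)) (x/2)).indicator (fun w : ℝ => |w| ^ (-γ)) (x - w)) := by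
        refine integral_mono_of_nonneg (ae_of_all _ fun w => by positivity) ?_ (ae_of_all _ hdom)
        exact (hI.const_mul _).add (K1.const_mul _)
    _ = 2 * x ^ (-γ) * (∫ w, incrKer α w ^ 2) +
        8 * x ^ (2 * α - 2) * (2 * ((x/2) ^ (-γ + 1) / (-γ + 1))) := by
        rw [integral_add (hI.const_mul _) (K1.const_mul _), integral_const_mul, integral_const_mul, K2]
    _ ≤ 2 * x ^ (-γ) * (∫ w, incrKer α w ^ 2) + 16 / (1 - γ) * x ^ (-γ) := by
        refine add_le_add le_rfl ?_
        have e1 : (x/2) ^ (-γ + 1) ≤ x ^ (-γ + 1) := by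
          apply Real.rpow_le_rpow hx2.le (by linarith) (by linarith)
        have e2 : x ^ (2 * α - 2) * x ^ (-γ + 1) = x ^ (-γ) * x ^ (2 * α - 1) := by
          rw [← Real.rpow_add hx0, ← Real.rpow_add hx0]; congr 1; ring
        have e3 : x ^ (2 * α - 1) ≤ 1 := Real.rpow_le_one_of_one_le_of_nonpos hx (by linarith [hα.2])
        have e4 : 0 ≤ x ^ (-γ) := by positivity
        have e5 : 0 ≤ x ^ (2 * α - 2) := by positivity
        rw [show -γ + 1 = 1 - γ by ring] at *
        calc 8 * x ^ (2 * α - 2) * (2 * ((x/2) ^ (1 - γ) / (1 - γ)))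
            ≤ 8 * x ^ (2 * α - 2) * (2 * (x ^ (1 - γ) / (1 - γ))) := by gcongr
          _ = 16 / (1 - γ) * (x ^ (2 * α - 2) * x ^ (1 - γ)) := by ring
          _ = 16 / (1 - γ) * (x ^ (-γ) * x ^ (2 * α - 1)) := by rw [e2]
          _ ≤ 16 / (1 - γ) * (x ^ (-γ) * 1) := by gcongr
          _ = 16 / (1 - γ) * x ^ (-γ) := by rw [mul_one]
    _ = _ := by ring

end variances

section increments
variable {Ω : Type*} [MeasurableSpace Ω] {P : Measure Ω} [IsProbabilityMeasure P] {α γ : ℝ}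

/-- The moving-average kernel at time `t`. -/
noncomputable def maKer (α t u : ℝ) : ℝ := (max (t - u) 0) ^ α - (max (-u) 0) ^ α

lemma maKer_measurable (t : ℝ) : Measurable (maKer α t) := by
  unfold maKer; fun_prop

lemma maKer_sq_integrable (hα : α ∈ Ioo (-1/2 : ℝ) (1/2)) (hγ : γ ∈ Ico (0:ℝ) 1)
    (h1 : -1 < 2 * α - γ) (h2 : 2 * α - γ < 1) {t : ℝ} (ht : 0 ≤ t) :
    Integrable fun u => maKer α t u ^ 2 * |u| ^ (-γ) := by
  rcases ht.eq_or_lt with rfl | ht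
  · simp [maKer]
  have h := ((incrKer_sq_integrable hα hγ h1 h2).comp_mul_left'
    (R := (-t⁻¹)) (by simpa using ht.ne')).const_mul ((t ^ α) ^ 2 * t ^ (-γ))
  refine h.congr (ae_of_all _ fun u => ?_)
  have hm : ∀ x : ℝ, t ^ α * (max x 0) ^ α = (max (t * x) 0) ^ α := fun x => by
    rw [← Real.mul_rpow ht.le (le_max_right _ _), mul_max_of_nonneg _ _ ht.le, mul_zero]
  have e1 : t ^ α * incrKer α (-t⁻¹ * u) = maKer α t u := by
    rw [incrKer, mul_sub, hm, hm, maKer]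
    congr 3
    · field_simp; ring
    · field_simp
  have e2 : t ^ (-γ) * |-t⁻¹ * u| ^ (-γ) = |u| ^ (-γ) := by
    rw [← Real.mul_rpow ht.le (abs_nonneg _), abs_mul, abs_neg, abs_of_pos (inv_pos.2 ht)]
    congr 1; field_simp
  simp only
  rw [← e1, ← e2]; ring

lemma gfbmCov_increment (hα : α ∈ Ioo (-1/2 : ℝ) (1/2)) (hγ : γ ∈ Ico (0:ℝ) 1)
    (h1 : -1 < 2 * α - γ) (h2 : 2 * α - γ < 1) {x : ℝ} (hx : 0 ≤ x) :
    gfbmCov α γ (x + 1) (x + 1) - 2 * gfbmCov α γ x (x + 1) + gfbmCov α γ x x =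
      ∫ w, incrKer α w ^ 2 * |x - w| ^ (-γ) := by
  have i1 := maKer_sq_integrable hα hγ h1 h2 (add_nonneg hx zero_le_one)
  have i2 := maKer_sq_integrable hα hγ h1 h2 hx
  have i3 : Integrable fun u => maKer α x u * maKer α (x + 1) u * |u| ^ (-γ) := by
    refine (i1.add i2).mono' ?_ (ae_of_all _ fun u => ?_)
    · exact (((maKer_measurable x).mul (maKer_measurable (x + 1))).mul (by fun_prop)).aestronglyMeasurable
    · have hp : 0 ≤ |u| ^ (-γ) := by positivity
      simp only [Pi.add_apply]
      rw [norm_mul, Real.norm_of_nonneg hp, ← add_mul]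
      refine mul_le_mul_of_nonneg_right ?_ hp
      rw [Real.norm_eq_abs, abs_le]
      constructor <;> nlinarith [sq_nonneg (maKer α x u + maKer α (x + 1) u),
        sq_nonneg (maKer α x u - maKer α (x + 1) u)]
  have e : ∀ s t : ℝ, gfbmCov α γ s t = ∫ u, maKer α s u * maKer α t u * |u| ^ (-γ) := fun _ _ => rfl
  rw [← integral_sub_left_eq_self _ _ x, e, e, e, ← integral_const_mul]
  simp only [← sq]
  have i4 : Integrable fun u => maKer α (x + 1) u ^ 2 * |u| ^ (-γ) -
      2 * (maKer α x u * maKer α (x + 1) u * |u| ^ (-γ)) := i1.sub (i3.const_mul 2)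
  rw [← integral_sub i1 (i3.const_mul 2), ← integral_add i4 i2]
  refine integral_congr_ae (ae_of_all _ fun u => ?_)
  have e1 : incrKer α (x - u) = maKer α (x + 1) u - maKer α x u := by
    simp only [incrKer, maKer]
    rw [show 1 + (x - u) = x + 1 - u by ring]; ring
  simp only
  rw [e1, sub_sub_cancel]
  ring

lemma increment_variance {H : ℝ} (hα : α ∈ Ioo (-1/2 : ℝ) (1/2)) (hγ : γ ∈ Ico (0:ℝ) 1)
    (h1 : -1 < 2 * α - γ) (h2 : 2 * α - γ < 1) (hH : H = α - γ/2 + 1/2) :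
    ∃ V : ℝ, 0 < V ∧ ∀ X : ℝ → Ω → ℝ, IsGFBM P α γ X → ∀ (j : ℕ) (h : ℝ), 0 < h →
      ∫ ω, (X (h * (j + 1)) ω - X (h * j) ω) ^ 2 ∂P ≤ V * h ^ (2 * H) * (j + 1 : ℝ) ^ (-γ) := by
  set A := ∫ w, incrKer α w ^ 2 * |0 - w| ^ (-γ) with hA
  set B := 2 * (∫ w, incrKer α w ^ 2) + 16 / (1 - γ) with hB
  have hA0 : 0 ≤ A := integral_nonneg fun w => by positivity
  have hB0 : 0 < B := by
    have : 0 < 1 - γ := by linarith [hγ.2]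
    have : 0 ≤ ∫ w, incrKer α w ^ 2 := integral_nonneg fun w => by positivity
    positivity
  refine ⟨A + 2 * B, by positivity, fun X hX j h hh => ?_⟩
  have hj : (0:ℝ) ≤ j := Nat.cast_nonneg j
  have hcg : CG P (fun i : Fin 2 => X (![h * (j + 1), h * j] i)) := hX.1 2 _
  have := hcg.integral_sq ![1, -1]
  simp only [Fin.sum_univ_two, Matrix.cons_val_zero, Matrix.cons_val_one, one_mul,
    mul_neg, mul_one, neg_mul, neg_neg] at this
  rw [hX.2.2.2 _ _ (by positivity) (by positivity), hX.2.2.2 _ _ (by positivity) (by positivity),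
    hX.2.2.2 _ _ (by positivity) (by positivity), hX.2.2.2 _ _ (by positivity) (by positivity)] at this
  have hsymm : ∀ s t, gfbmCov α γ s t = gfbmCov α γ t s := fun s t => by
    unfold gfbmCov; congr 1; ext u; ring
  have hd := gfbmCov_increment hα hγ h1 h2 hj
  have hle : ∫ w, incrKer α w ^ 2 * |(j:ℝ) - w| ^ (-γ) ≤ (A + 2 * B) * (j + 1 : ℝ) ^ (-γ) := by
    rcases Nat.eq_zero_or_pos j with rfl | hj1
    · simp only [Nat.cast_zero, zero_add, Real.one_rpow, mul_one]
      linarith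
    · have hj1' : (1:ℝ) ≤ j := by exact_mod_cast hj1
      refine (incrKer_shift_integral_le hα hγ hj1').trans ?_
      have : (j:ℝ) ^ (-γ) ≤ 2 * (j + 1 : ℝ) ^ (-γ) := by
        have e : (j:ℝ) ^ (-γ) ≤ ((j + 1 : ℝ) / 2) ^ (-γ) :=
          Real.rpow_le_rpow_of_nonpos (by linarith) (by linarith) (by linarith [hγ.1])
        refine e.trans ?_
        rw [Real.div_rpow (by positivity) zero_le_two, div_eq_inv_mul, ← Real.rpow_neg zero_le_two]
        gcongr
        calc (2:ℝ) ^ (- -γ) ≤ 2 ^ (1:ℝ) :=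
            Real.rpow_le_rpow_of_exponent_le one_le_two (by linarith [hγ.2])
          _ = 2 := Real.rpow_one _
      have hp : 0 ≤ (j + 1 : ℝ) ^ (-γ) := by positivity
      calc B * (j:ℝ) ^ (-γ) ≤ B * (2 * (j + 1 : ℝ) ^ (-γ)) := by gcongr
        _ ≤ _ := by nlinarith
  have e3 : ∫ ω, (X (h * (j + 1)) ω - X (h * j) ω) ^ 2 ∂P =
      h ^ (2 * H) * ∫ w, incrKer α w ^ 2 * |(j:ℝ) - w| ^ (-γ) := by
    rw [← hd]
    simp only [sub_eq_add_neg]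
    rw [this, gfbmCov_scale _ _ hh, gfbmCov_scale _ _ hh, gfbmCov_scale _ _ hh, gfbmCov_scale _ _ hh,
      hsymm (j + 1 : ℝ) j, show 2 * H = 2 * α - γ + 1 by rw [hH]; ring]
    ring
  rw [e3]
  calc _ ≤ h ^ (2 * H) * ((A + 2 * B) * (j + 1 : ℝ) ^ (-γ)) := by gcongr
    _ = _ := by ring

end increments

section gaussianEstimates

lemma gaussianReal_ball_ge {r : ℝ} (hr1 : r ≤ 1) :
    ENNReal.ofReal (2 * gaussianPDFReal 0 1 1 * r) ≤ gaussianReal 0 1 (Icc (-r) r) := by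
  rw [gaussianReal_apply 0 one_ne_zero]
  calc ENNReal.ofReal (2 * gaussianPDFReal 0 1 1 * r)
      = ∫⁻ _ in Icc (-r) r, ENNReal.ofReal (gaussianPDFReal 0 1 1) := by
        rw [setLIntegral_const, Real.volume_Icc, ← ENNReal.ofReal_mul (gaussianPDFReal_nonneg _ _ _)]
        congr 1; ring
    _ ≤ _ := by
        refine setLIntegral_mono' measurableSet_Icc fun x hx => ?_
        refine ENNReal.ofReal_le_ofReal ?_
        simp only [gaussianPDFReal, sub_zero]
        refine mul_le_mul_of_nonneg_left (Real.exp_le_exp.2 ?_) (by positivity)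
        have : x ^ 2 ≤ 1 :=
          (sq_le_one_iff_abs_le_one x).2 (abs_le.2 ⟨by linarith [hx.1], by linarith [hx.2]⟩)
        simp only [NNReal.coe_one, mul_one]
        linarith

lemma gaussianReal_tail {p : ℝ} (hp : 0 < p) :
    ∃ C : ℝ, 0 < C ∧ ∀ x : ℝ, 0 < x → gaussianReal 0 1 {y | 1 < x * |y|} ≤ ENNReal.ofReal (C * x ^ p) := by
  have hm := memLp_id_gaussianReal (μ := 0) (v := 1) p.toNNReal
  have hfin : ∫⁻ y, ENNReal.ofReal (|y| ^ p) ∂(gaussianReal 0 1) ≠ ⊤ := by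
    have := hm.eLpNorm_lt_top
    rw [eLpNorm_lt_top_iff_lintegral_rpow_enorm_lt_top (by simpa using hp) (by simp)] at this
    simp only [ENNReal.coe_toReal, Real.coe_toNNReal _ hp.le, id] at this
    refine ne_of_lt (lt_of_le_of_lt (le_of_eq ?_) this)
    refine lintegral_congr fun y => ?_
    rw [Real.enorm_eq_ofReal_abs, ENNReal.ofReal_rpow_of_nonneg (abs_nonneg _) hp.le]
  refine ⟨(∫⁻ y, ENNReal.ofReal (|y| ^ p) ∂(gaussianReal 0 1)).toReal + 1, by positivity, fun x hx => ?_⟩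
  have hxp : 0 < x ^ p := Real.rpow_pos_of_pos hx _
  have hmk := mul_meas_ge_le_lintegral (μ := gaussianReal 0 1) (f := fun y => ENNReal.ofReal (|y| ^ p))
    (by fun_prop) (ENNReal.ofReal ((x ^ p)⁻¹))
  have hsub : {y : ℝ | 1 < x * |y|} ⊆ {y | ENNReal.ofReal ((x ^ p)⁻¹) ≤ ENNReal.ofReal (|y| ^ p)} := by
    intro y hy
    refine ENNReal.ofReal_le_ofReal ?_
    rw [inv_le_iff_one_le_mul₀' hxp, ← Real.mul_rpow hx.le (abs_nonneg _)]
    exact Real.one_le_rpow (le_of_lt hy) hp.le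
  calc gaussianReal 0 1 {y | 1 < x * |y|}
      = ENNReal.ofReal (x ^ p) * (ENNReal.ofReal ((x ^ p)⁻¹) * gaussianReal 0 1 {y | 1 < x * |y|}) := by
        rw [← mul_assoc, ← ENNReal.ofReal_mul hxp.le, mul_inv_cancel₀ hxp.ne', ENNReal.ofReal_one, one_mul]
    _ ≤ ENNReal.ofReal (x ^ p) * ∫⁻ y, ENNReal.ofReal (|y| ^ p) ∂(gaussianReal 0 1) := by
        gcongr
        exact (mul_le_mul_right (measure_mono hsub) _).trans hmk
    _ ≤ ENNReal.ofReal (x ^ p) * ENNReal.ofReal ((∫⁻ y, ENNReal.ofReal (|y| ^ p) ∂(gaussianReal 0 1)).toReal + 1) := by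
        gcongr
        refine (ENNReal.le_ofReal_iff_toReal_le hfin (by positivity)).2 (by linarith)
    _ = _ := by rw [← ENNReal.ofReal_mul hxp.le, mul_comm]

lemma exp_neg_two_mul_le {u : ℝ} (h0 : 0 ≤ u) (h1 : u ≤ 1/2) : Real.exp (-(2 * u)) ≤ 1 - u := by
  rw [Real.exp_neg, inv_le_comm₀ (Real.exp_pos _) (by linarith)]
  have : (1 - u)⁻¹ ≤ 1 + 2 * u := by
    rw [inv_le_iff_one_le_mul₀ (by linarith)]; nlinarith
  linarith [Real.add_one_le_exp (2 * u)]

lemma gaussianReal_ball_lower {p : ℝ} (hp : 0 < p) :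
    ∃ C : ℝ, 0 < C ∧ ∀ x : ℝ, 0 ≤ x →
      ENNReal.ofReal (Real.exp (-(C * x ^ p))) ≤ gaussianReal 0 1 {y | x * |y| ≤ 1} := by
  obtain ⟨A, hA, hT⟩ := gaussianReal_tail hp
  set c := 2 * gaussianPDFReal 0 1 1 with hc
  have hc0 : 0 < c := by have := gaussianPDFReal_pos 0 1 1 one_ne_zero; positivity
  refine ⟨2 * A + 1 / p + 2 * A * |Real.log c|, by positivity, fun x hx => ?_⟩
  rcases hx.eq_or_lt with rfl | hx
  · simp [Real.zero_rpow hp.ne']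
  have hxp : 0 < x ^ p := Real.rpow_pos_of_pos hx _
  rcases le_or_gt (A * x ^ p) (1/2) with h | h
  · have hcompl : {y : ℝ | x * |y| ≤ 1} = {y | 1 < x * |y|}ᶜ := by ext y; simp
    rw [hcompl, prob_compl_eq_one_sub (measurableSet_lt (by fun_prop) (by fun_prop))]
    refine le_trans ?_ (tsub_le_tsub_left (hT x hx) 1)
    rw [← ENNReal.ofReal_one, ← ENNReal.ofReal_sub _ (by positivity)]
    refine ENNReal.ofReal_le_ofReal ?_
    refine le_trans (Real.exp_le_exp.2 ?_) (exp_neg_two_mul_le (by positivity) h)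
    have : 0 ≤ 1 / p + 2 * A * |Real.log c| := by positivity
    nlinarith
  · set r := min x⁻¹ 1 with hr
    have hr0 : 0 < r := lt_min (inv_pos.2 hx) one_pos
    have hsub : Icc (-r) r ⊆ {y : ℝ | x * |y| ≤ 1} := by
      intro y hy
      have : |y| ≤ x⁻¹ := (abs_le.2 hy).trans (min_le_left _ _)
      rw [mem_ofPred_eq]
      calc x * |y| ≤ x * x⁻¹ := by gcongr
        _ = 1 := mul_inv_cancel₀ hx.ne'
    refine le_trans ?_ ((gaussianReal_ball_ge (min_le_right _ _)).trans (measure_mono hsub))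
    refine ENNReal.ofReal_le_ofReal ?_
    rw [← hc, ← Real.log_le_log_iff (Real.exp_pos _) (by positivity), Real.log_exp,
      Real.log_mul hc0.ne' hr0.ne']
    have h1 : -(x ^ p / p) ≤ Real.log r := by
      rcases min_choice x⁻¹ 1 with h' | h'
      · rw [hr, h', Real.log_inv]
        exact neg_le_neg (Real.log_le_rpow_div hx.le hp)
      · rw [hr, h', Real.log_one]
        have : 0 ≤ x ^ p / p := by positivity
        linarith
    have h2 : -|Real.log c| ≤ Real.log c := neg_abs_le _
    have h3 : |Real.log c| ≤ 2 * A * |Real.log c| * x ^ p := by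
      have := abs_nonneg (Real.log c)
      nlinarith
    have h4 : x ^ p / p = 1 / p * x ^ p := by ring
    nlinarith [mul_pos hA hxp]

/-- Lower bound of the probability of an interval for a centered Gaussian variable. -/
lemma gaussian_interval_lower {q : ℝ} (hq : 0 < q) :
    ∃ C : ℝ, 0 < C ∧ ∀ {Ω : Type*} [MeasurableSpace Ω] (P : Measure Ω) [IsProbabilityMeasure P]
      (L : Ω → ℝ) (v : ℝ≥0), P.map L = gaussianReal 0 v → ∀ s : ℝ, 0 < s → ∀ w : ℝ, v / s ^ 2 ≤ w →
      ENNReal.ofReal (Real.exp (-(C * w ^ q))) ≤ P {ω | |L ω| ≤ s} := by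
  obtain ⟨C, hC, h⟩ := gaussianReal_ball_lower (p := 2 * q) (by positivity)
  refine ⟨C, hC, fun {Ω} _ P _ L v hv s hs w hw => ?_⟩
  have hm := aemeasurable_of_map_eq_gaussian hv
  have hB : MeasurableSet {y : ℝ | |y| ≤ s} := measurableSet_le (by fun_prop) measurable_const
  have e1 : P {ω | |L ω| ≤ s} = gaussianReal 0 v {y | |y| ≤ s} := by
    rw [← hv, Measure.map_apply_of_aemeasurable hm hB]; rfl
  have e2 : gaussianReal 0 v = (gaussianReal 0 1).map (√v * ·) := by
    rw [gaussianReal_map_const_mul, mul_zero, mul_one]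
    congr 1
    ext; simp
  have e3 : (√(v:ℝ) * ·) ⁻¹' {y : ℝ | |y| ≤ s} = {y | (√v / s) * |y| ≤ 1} := by
    ext y
    simp only [mem_preimage, mem_ofPred_eq, abs_mul, abs_of_nonneg (Real.sqrt_nonneg (v:ℝ))]
    rw [div_mul_eq_mul_div, div_le_one hs]
  rw [e1, e2, Measure.map_apply (by fun_prop) hB, e3]
  refine le_trans (ENNReal.ofReal_le_ofReal (Real.exp_le_exp.2 (neg_le_neg ?_))) (h _ (by positivity))
  refine mul_le_mul_of_nonneg_left ?_ hC.le
  have : (√(v:ℝ) / s) ^ (2 * q) = (v / s ^ 2) ^ q := by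
    rw [Real.rpow_mul (by positivity), Real.rpow_two, div_pow, Real.sq_sqrt v.coe_nonneg]
  rw [this]
  exact Real.rpow_le_rpow (by positivity) hw hq.le

end gaussianEstimates

section chaining

lemma sum_rpow_neg_le {a : ℝ} (ha0 : 0 ≤ a) (ha1 : a < 1) (J : ℕ) :
    ∑ j ∈ Finset.range J, (j + 1 : ℝ) ^ (-a) ≤ (1 - a)⁻¹ * (J:ℝ) ^ (1 - a) := by
  have h1a : 0 < 1 - a := by linarith
  induction J with
  | zero => simp [Real.zero_rpow h1a.ne']
  | succ J ih =>
    rw [Finset.sum_range_succ]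
    have hJ : (0:ℝ) ≤ J := Nat.cast_nonneg J
    obtain ⟨x, hx, he⟩ := exists_hasDerivAt_eq_slope (fun x : ℝ => x ^ (1 - a))
      (fun x => (1 - a) * x ^ (1 - a - 1)) (show (J:ℝ) < J + 1 by linarith)
      (Real.continuous_rpow_const h1a.le).continuousOn
      (fun x hx => Real.hasDerivAt_rpow_const (Or.inl (by linarith [hx.1])))
    have hx0 : 0 < x := lt_of_le_of_lt hJ hx.1
    have hle : (J + 1 : ℝ) ^ (-a) ≤ x ^ (-a) :=
      Real.rpow_le_rpow_of_nonpos hx0 hx.2.le (by linarith)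
    rw [add_sub_cancel_left, div_one, show 1 - a - 1 = -a by ring] at he
    push_cast
    have : (1 - a)⁻¹ * (J + 1 : ℝ) ^ (1 - a) = (1 - a)⁻¹ * (J:ℝ) ^ (1 - a) + x ^ (-a) := by
      field_simp
      linarith
    rw [this]
    exact add_le_add ih hle

lemma sum_geom_dist {r : ℝ} (hr0 : 0 ≤ r) (hr1 : r < 1) (k0 n : ℕ) :
    ∑ k ∈ Finset.range n, r ^ ((k - k0) + (k0 - k)) ≤ 2 / (1 - r) := by
  have key : (∑ k ∈ Finset.range n, r ^ ((k - k0) + (k0 - k))) * (1 - r) ≤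
      if n ≤ k0 then r ^ (k0 - n + 1) else r + 1 - r ^ (n - k0) := by
    induction n with
    | zero => simp; positivity
    | succ n ih =>
      rw [Finset.sum_range_succ, add_mul]
      rcases lt_trichotomy n k0 with h | h | h
      · rw [if_pos h.le] at ih
        rw [if_pos (by omega), show n - k0 = 0 by omega, show k0 - (n + 1) + 1 = k0 - n by omega]
        rw [pow_succ] at ih
        simp only [zero_add]
        linarith
      · subst h
        rw [if_pos le_rfl] at ih
        rw [if_neg (by omega)]
        simp at ih ⊢
        linarith
      · rw [if_neg (by omega)] at ih
        rw [if_neg (by omega), show k0 - n = 0 by omega, show n + 1 - k0 = n - k0 + 1 by omega, pow_succ]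
        simp only [add_zero]
        linarith
  rw [le_div_iff₀ (by linarith)]
  refine key.trans ?_
  split_ifs
  · have := pow_le_one₀ (n := k0 - n + 1) hr0 hr1.le
    linarith
  · have := pow_nonneg hr0 (n - k0)
    linarith

lemma chain_bound {z : ℝ → ℝ} (hz : z 0 = 0) {s : ℕ → ℝ} (hs : ∀ k, 0 ≤ s k) (K : ℕ)
    (h : ∀ k : ℕ, k ≤ K → ∀ j : ℕ, j < 2 ^ k → |z ((j + 1 : ℝ) / 2 ^ k) - z ((j:ℝ) / 2 ^ k)| ≤ s k) :
    ∀ m : ℕ, m ≤ 2 ^ K → |z ((m:ℝ) / 2 ^ K)| ≤ ∑ k ∈ Finset.range (K + 1), s k := by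
  induction K with
  | zero =>
    intro m hm
    have := h 0 le_rfl 0 (by norm_num)
    simp only [Nat.cast_zero, zero_add, pow_zero, div_one, hz, sub_zero] at this
    simp only [pow_zero, div_one, zero_add, Finset.sum_range_one]
    interval_cases m
    · simpa [hz] using hs 0
    · simpa using this
  | succ K ih =>
    intro m hm
    have ih' := ih fun k hk => h k (hk.trans (Nat.le_succ K))
    rw [Finset.sum_range_succ]
    have e : ∀ i : ℕ, ((2 * i : ℕ):ℝ) / 2 ^ (K + 1) = (i:ℝ) / 2 ^ K := fun i => by
      push_cast; rw [pow_succ]; field_simp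
    obtain ⟨i, rfl | rfl⟩ := Nat.even_or_odd' m
    · rw [e]
      have := ih' i (by rw [pow_succ] at hm; omega)
      linarith [hs (K + 1)]
    · have h1 := ih' i (by rw [pow_succ] at hm; omega)
      have h2 := h (K + 1) le_rfl (2 * i) (by omega)
      rw [e] at h2
      push_cast at h2 ⊢
      have := abs_sub_abs_le_abs_sub (z ((2 * (i:ℝ) + 1) / 2 ^ (K + 1))) (z (i / 2 ^ K))
      linarith

lemma level_sum {C A γ q : ℝ} (hC : 0 ≤ C) (hA : 0 ≤ A) (hγ : 0 ≤ γ) (hq : 0 < q) (hγq : γ * q < 1)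
    (E : ℝ) (k : ℕ) :
    ∑ j ∈ Finset.range (2 ^ k), C * (A * 2 ^ E * (j + 1 : ℝ) ^ (-γ)) ^ q ≤
      (C * A ^ q * (1 - γ * q)⁻¹) * 2 ^ (E * q + k * (1 - γ * q)) := by
  have h := sum_rpow_neg_le (mul_nonneg hγ hq.le) hγq (2 ^ k)
  have e : ∀ j : ℕ, C * (A * 2 ^ E * (j + 1 : ℝ) ^ (-γ)) ^ q =
      C * A ^ q * 2 ^ (E * q) * (j + 1 : ℝ) ^ (-(γ * q)) := by
    intro j
    rw [Real.mul_rpow (by positivity) (by positivity), Real.mul_rpow hA (by positivity),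
      ← Real.rpow_mul zero_le_two, ← Real.rpow_mul (by positivity), neg_mul]
    ring
  simp_rw [e]
  rw [← Finset.mul_sum]
  have e2 : ((2 ^ k : ℕ) : ℝ) ^ (1 - γ * q) = 2 ^ (k * (1 - γ * q)) := by
    push_cast
    rw [← Real.rpow_natCast, ← Real.rpow_mul zero_le_two]
  rw [e2] at h
  calc _ ≤ C * A ^ q * 2 ^ (E * q) * ((1 - γ * q)⁻¹ * 2 ^ (k * (1 - γ * q))) := by gcongr
    _ = _ := by rw [Real.rpow_add two_pos]; ring

variable {Ω : Type*} [MeasurableSpace Ω] {P : Measure Ω} [IsProbabilityMeasure P]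
  {H b γ V : ℝ} {Z : ℝ → Ω → ℝ}

lemma GP.gaussian_sub (h : GP P H Z) {ι : Type*} [Fintype ι] (u w : ι → ℝ) :
    CG P (fun i ω => Z (u i) ω - Z (w i) ω) := by
  intro c
  obtain ⟨v, hv⟩ := h.gaussian (Sum.elim u w) (Sum.elim c (fun i => -c i))
  refine ⟨v, ?_⟩
  rw [← hv]
  congr 1; ext ω
  simp only [Fintype.sum_sum_type, Sum.elim_inl, Sum.elim_inr, ← Finset.sum_add_distrib]
  exact Finset.sum_congr rfl fun i _ => by ring

/-- Lower bounds for the probabilities of small dyadic increments. -/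
lemma GP.level_bound (h : GP P H Z) (hγ : 0 ≤ γ) (hb : γ / 2 < b) (hH : H = b - γ / 2) (hV : 0 < V)
    (hvar : ∀ k j : ℕ, ∫ ω, (Z ((j + 1 : ℝ) / 2 ^ k) ω - Z ((j:ℝ) / 2 ^ k) ω) ^ 2 ∂P ≤
      V * ((2:ℝ) ^ k)⁻¹ ^ (2 * H) * (j + 1 : ℝ) ^ (-γ)) {c : ℝ} (hc : 0 < c) :
    ∃ B r : ℝ, 0 < B ∧ 0 ≤ r ∧ r < 1 ∧ ∀ k0 k : ℕ, ∃ e : ℕ → ℝ,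
      (∀ j : ℕ, ENNReal.ofReal (Real.exp (-e j)) ≤
        P {ω | |Z ((j + 1 : ℝ) / 2 ^ k) ω - Z ((j:ℝ) / 2 ^ k) ω| ≤
          c * 2 ^ (-(k0 * b)) * ((2:ℝ) ^ (-(H / 4))) ^ ((k - k0) + (k0 - k))}) ∧
      ∑ j ∈ Finset.range (2 ^ k), e j ≤ B * 2 ^ k0 * r ^ ((k - k0) + (k0 - k)) := by
  have hH0 : 0 < H := by linarith
  have hb0 : 0 < b := by linarith
  set q1 := 1 / (b + γ / 2) with hq1
  set q2 := 1 / (4 * b) with hq2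
  have hq10 : 0 < q1 := by positivity
  have hq20 : 0 < q2 := by positivity
  have hγ1 : γ * q1 < 1 := by rw [hq1, mul_one_div, div_lt_one (by positivity)]; linarith
  have hγ2 : γ * q2 < 1 := by rw [hq2, mul_one_div, div_lt_one (by positivity)]; linarith
  obtain ⟨C1, hC1, G1⟩ := gaussian_interval_lower hq10
  obtain ⟨C2, hC2, G2⟩ := gaussian_interval_lower hq20
  set A := V / c ^ 2 with hA
  have hA0 : 0 < A := by positivity
  set B1 := C1 * A ^ q1 * (1 - γ * q1)⁻¹ with hB1
  set B2 := C2 * A ^ q2 * (1 - γ * q2)⁻¹ with hB2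
  have hB10 : 0 < B1 := by have : 0 < 1 - γ * q1 := by linarith
                           positivity
  have hB20 : 0 < B2 := by have : 0 < 1 - γ * q2 := by linarith
                           positivity
  set δ1 := q1 * (2 * b - H / 2) - 1 with hδ1
  set δ2 := 1 - q2 * (2 * b + H / 2) with hδ2
  have hδ10 : 0 < δ1 := by
    rw [hδ1, hq1, one_div_mul_eq_div, sub_pos, lt_div_iff₀ (by positivity)]; linarith
  have hδ20 : 0 < δ2 := by
    rw [hδ2, hq2, one_div_mul_eq_div, sub_pos, div_lt_one (by positivity)]; linarith
  set δ := min δ1 δ2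
  have hδ0 : 0 < δ := lt_min hδ10 hδ20
  refine ⟨B1 + B2, 2 ^ (-δ), by positivity, by positivity,
    Real.rpow_lt_one_of_one_lt_of_neg one_lt_two (by linarith), fun k0 k => ?_⟩
  set d := (k - k0) + (k0 - k) with hd
  set s := c * 2 ^ (-(k0 * b)) * ((2:ℝ) ^ (-(H / 4))) ^ d with hs
  have hs0 : 0 < s := by positivity
  set E : ℝ := 2 * k0 * b - 2 * k * H + 2 * (H / 4) * d with hE
  have hw : ∀ j : ℕ, ∀ v : ℝ≥0, P.map (fun ω => Z ((j + 1 : ℝ) / 2 ^ k) ω - Z ((j:ℝ) / 2 ^ k) ω) =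
      gaussianReal 0 v → v / s ^ 2 ≤ A * 2 ^ E * (j + 1 : ℝ) ^ (-γ) := by
    intro j v hv
    have h1 := hvar k j
    rw [integral_sq_of_gaussian hv] at h1
    rw [div_le_iff₀ (by positivity)]
    refine h1.trans (le_of_eq ?_)
    have e1 : ((2:ℝ) ^ k)⁻¹ ^ (2 * H) = 2 ^ (-(2 * k * H)) := by
      rw [← Real.rpow_natCast, ← Real.rpow_neg zero_le_two, ← Real.rpow_mul zero_le_two]
      congr 1; ring
    have e2 : s ^ 2 = c ^ 2 * 2 ^ (-(2 * k0 * b) - 2 * (H / 4) * d) := by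
      rw [hs, mul_pow, mul_pow, mul_assoc, ← Real.rpow_natCast (2 ^ (-(H/4))) d,
        ← Real.rpow_mul zero_le_two, ← Real.rpow_mul_natCast zero_le_two,
        ← Real.rpow_mul_natCast zero_le_two, ← Real.rpow_add two_pos]
      congr 2; push_cast; ring
    have e3 : (2:ℝ) ^ E * 2 ^ (-(2 * k0 * b) - 2 * (H / 4) * d) = 2 ^ (-(2 * k * H)) := by
      rw [← Real.rpow_add two_pos]; congr 1; rw [hE]; ring
    rw [e1, e2, ← e3, hA]
    field_simp
  have hlaw : ∀ j : ℕ, ∃ v : ℝ≥0,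
      P.map (fun ω => Z ((j + 1 : ℝ) / 2 ^ k) ω - Z ((j:ℝ) / 2 ^ k) ω) = gaussianReal 0 v := by
    intro j
    obtain ⟨v, hv⟩ := h.gaussian_sub (fun _ : Unit => ((j + 1 : ℝ) / 2 ^ k))
      (fun _ => (j:ℝ) / 2 ^ k) (fun _ => 1)
    exact ⟨v, by simpa using hv⟩
  have hpow : ∀ x : ℝ, x ≤ k0 - δ * d → (2:ℝ) ^ x ≤ 2 ^ k0 * (2 ^ (-δ)) ^ d := by
    intro x hx
    calc (2:ℝ) ^ x ≤ 2 ^ ((k0:ℝ) - δ * d) := Real.rpow_le_rpow_of_exponent_le one_le_two hx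
      _ = _ := by
        rw [← Real.rpow_mul_natCast zero_le_two, ← Real.rpow_natCast, ← Real.rpow_add two_pos]
        congr 1; ring
  rcases le_or_gt k0 k with hk | hk
  · refine ⟨fun j => C1 * (A * 2 ^ E * (j + 1 : ℝ) ^ (-γ)) ^ q1, fun j => ?_, ?_⟩
    · obtain ⟨v, hv⟩ := hlaw j
      exact G1 P _ v hv s hs0 _ (hw j v hv)
    · refine (level_sum hC1.le hA0.le hγ hq10 hγ1 E k).trans ?_
      rw [← hB1, mul_assoc (B1 + B2)]
      have hdk : (d:ℝ) = k - k0 := by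
        rw [hd, show k0 - k = 0 by omega, add_zero, Nat.cast_sub hk]
      have hd0 : (0:ℝ) ≤ d := Nat.cast_nonneg d
      have hle : E * q1 + k * (1 - γ * q1) ≤ k0 - δ * d := by
        have e : E * q1 + k * (1 - γ * q1) = k0 - δ1 * d := by
          rw [hE, hδ1, hH, hdk]; ring
        rw [e]
        have := mul_le_mul_of_nonneg_right (min_le_left δ1 δ2) hd0
        linarith
      exact mul_le_mul (by linarith) (hpow _ hle) (by positivity) (by positivity)
  · refine ⟨fun j => C2 * (A * 2 ^ E * (j + 1 : ℝ) ^ (-γ)) ^ q2, fun j => ?_, ?_⟩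
    · obtain ⟨v, hv⟩ := hlaw j
      exact G2 P _ v hv s hs0 _ (hw j v hv)
    · refine (level_sum hC2.le hA0.le hγ hq20 hγ2 E k).trans ?_
      rw [← hB2, mul_assoc (B1 + B2)]
      have hdk : (d:ℝ) = k0 - k := by
        rw [hd, show k - k0 = 0 by omega, zero_add, Nat.cast_sub hk.le]
      have hd0 : (0:ℝ) ≤ d := Nat.cast_nonneg d
      have hle : E * q2 + k * (1 - γ * q2) ≤ k0 - δ * d := by
        have e : E * q2 + k * (1 - γ * q2) = k0 - δ2 * d := by
          rw [hE, hδ2, hH, hdk]; ring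
        rw [e]
        have := mul_le_mul_of_nonneg_right (min_le_right δ1 δ2) hd0
        linarith
      exact mul_le_mul (by linarith) (hpow _ hle) (by positivity) (by positivity)

end chaining

section smallBallX
variable {Ω : Type*} [MeasurableSpace Ω] {P : Measure Ω} [IsProbabilityMeasure P]
  {H b γ V : ℝ} {Z : ℝ → Ω → ℝ}

lemma exists_dyadic_level {b ρ : ℝ} (hb : 0 < b) (hρ : 0 < ρ) (hρ1 : ρ ≤ 1) :
    ∃ k : ℕ, (2:ℝ) ^ (-(k * b)) ≤ ρ ∧ (2:ℝ) ^ k ≤ 2 * ρ ^ (-(1 / b)) := by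
  have h2 : ρ = 2 ^ (Real.logb 2 ρ) := (Real.rpow_logb two_pos (by norm_num) hρ).symm
  set l := Real.logb 2 ρ with hl
  have hl0 : l ≤ 0 := Real.logb_nonpos (by norm_num) hρ.le hρ1
  have hx : 0 ≤ -l / b := by have : 0 ≤ -l := by linarith
                             positivity
  refine ⟨⌈-l / b⌉₊, ?_, ?_⟩
  · rw [h2]
    refine Real.rpow_le_rpow_of_exponent_le one_le_two ?_
    have := Nat.le_ceil (-l / b)
    rw [div_le_iff₀ hb] at this
    linarith
  · have := (Nat.ceil_lt_add_one hx).le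
    calc (2:ℝ) ^ ⌈-l / b⌉₊ = 2 ^ ((⌈-l / b⌉₊ : ℕ) : ℝ) := (Real.rpow_natCast _ _).symm
      _ ≤ 2 ^ (-l / b + 1) := Real.rpow_le_rpow_of_exponent_le one_le_two this
      _ = 2 * ρ ^ (-(1 / b)) := by
        rw [h2, Real.rpow_add two_pos, Real.rpow_one, ← Real.rpow_mul zero_le_two, mul_comm]
        congr 2; ring

/-- Small ball lower bound obtained by chaining and Sidak's inequality. -/
lemma GP.sb_lower (h : GP P H Z) (hγ : 0 ≤ γ) (hb : γ / 2 < b) (hH : H = b - γ / 2) (hV : 0 < V)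
    (hvar : ∀ k j : ℕ, ∫ ω, (Z ((j + 1 : ℝ) / 2 ^ k) ω - Z ((j:ℝ) / 2 ^ k) ω) ^ 2 ∂P ≤
      V * ((2:ℝ) ^ k)⁻¹ ^ (2 * H) * (j + 1 : ℝ) ^ (-γ)) :
    ∃ C : ℝ, 0 < C ∧ ∀ ρ : ℝ, 0 < ρ → ρ ≤ 1 →
      ENNReal.ofReal (Real.exp (-(C * ρ ^ (-(1 / b))))) ≤ sb P Z ρ := by
  have hH0 : 0 < H := by linarith
  have hb0 : 0 < b := by linarith
  set r1 := (2:ℝ) ^ (-(H / 4)) with hr1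
  have hr10 : 0 ≤ r1 := by positivity
  have hr11 : r1 < 1 := Real.rpow_lt_one_of_one_lt_of_neg one_lt_two (by linarith)
  obtain ⟨B, r, hB, hr0, hr, hL⟩ := h.level_bound hγ hb hH hV hvar
    (c := (1 - r1) / 2) (by linarith)
  have h1r : 0 < 1 - r := by linarith
  refine ⟨4 * B / (1 - r), by positivity, fun ρ hρ hρ1 => ?_⟩
  obtain ⟨k0, hk1, hk2⟩ := exists_dyadic_level hb0 hρ hρ1
  choose e he1 he2 using hL k0
  set s : ℕ → ℝ := fun k => (1 - r1) / 2 * 2 ^ (-(k0 * b)) * r1 ^ ((k - k0) + (k0 - k)) with hs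
  have hs0 : ∀ k, 0 ≤ s k := fun k => by
    have : 0 < 1 - r1 := by linarith
    positivity
  have hsum : ∀ K, ∑ k ∈ Finset.range K, s k ≤ ρ := by
    intro K
    rw [← Finset.mul_sum]
    have h1 := sum_geom_dist hr10 hr11 k0 K
    have h2 : 0 < 1 - r1 := by linarith
    refine le_trans ?_ hk1
    calc _ ≤ (1 - r1) / 2 * 2 ^ (-(k0 * b)) * (2 / (1 - r1)) := by gcongr
      _ = _ := by field_simp
  refine h.le_sb fun K => ?_
  have hsid := (h.gaussian_sub (ι := (k : Fin (K + 1)) × Fin (2 ^ (k:ℕ)))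
    (fun i => ((i.2:ℕ) + 1 : ℝ) / 2 ^ (i.1:ℕ)) (fun i => ((i.2:ℕ) : ℝ) / 2 ^ (i.1:ℕ))).sidak
    (fun i => s i.1) (fun i => hs0 _)
  have hlow : ENNReal.ofReal (Real.exp (-∑ i : (k : Fin (K + 1)) × Fin (2 ^ (k:ℕ)), e i.1 i.2)) ≤
      ∏ i : (k : Fin (K + 1)) × Fin (2 ^ (k:ℕ)),
        P {ω | |Z (((i.2:ℕ) + 1 : ℝ) / 2 ^ (i.1:ℕ)) ω - Z (((i.2:ℕ) : ℝ) / 2 ^ (i.1:ℕ)) ω| ≤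
          s i.1} := by
    rw [← Finset.sum_neg_distrib, Real.exp_sum,
      ENNReal.ofReal_prod_of_nonneg fun i _ => (Real.exp_pos _).le]
    exact Finset.prod_le_prod' fun i _ => he1 _ _
  have hE : ∑ i : (k : Fin (K + 1)) × Fin (2 ^ (k:ℕ)), e i.1 i.2 ≤
      4 * B / (1 - r) * ρ ^ (-(1 / b)) := by
    rw [Fintype.sum_sigma]
    have e1 : ∀ k : Fin (K + 1), ∑ j : Fin (2 ^ (k:ℕ)), e k j ≤
        B * 2 ^ k0 * r ^ (((k:ℕ) - k0) + (k0 - k)) := fun k => by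
      rw [Fin.sum_univ_eq_sum_range (fun j => e k j)]
      exact he2 k
    refine (Finset.sum_le_sum fun k _ => e1 k).trans ?_
    rw [Fin.sum_univ_eq_sum_range (fun k => B * 2 ^ k0 * r ^ ((k - k0) + (k0 - k))),
      ← Finset.mul_sum]
    calc _ ≤ B * (2 * ρ ^ (-(1 / b))) * (2 / (1 - r)) := by
          gcongr
          exact sum_geom_dist hr0 hr k0 _
      _ = _ := by ring
  refine (ENNReal.ofReal_le_ofReal (Real.exp_le_exp.2 (neg_le_neg hE))).trans
    (hlow.trans (hsid.trans (measure_mono fun ω hω j => ?_)))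
  refine (chain_bound (z := fun t => Z t ω) (h.zero ω) hs0 K (fun k hk j hj => ?_) j
    (Nat.lt_succ_iff.1 j.2)).trans (hsum _)
  exact hω ⟨⟨k, Nat.lt_succ_of_le hk⟩, ⟨j, hj⟩⟩

end smallBallX

section smallBallY
variable {Ω : Type*} [MeasurableSpace Ω] {P : Measure Ω} [IsProbabilityMeasure P]
  {H b θ d : ℝ} {Z : ℝ → Ω → ℝ}

/-- Comparison of the small balls of `Z` and of its fractional integral through entropy. -/
lemma GP.sb_le_entropy (h : GP P H Z) (hθ : 0 < θ) (hd : 0 < d) :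
    ∃ C : ℝ, 1 ≤ C ∧ ∀ n : ℕ, 1 ≤ n → ∀ ρ : ℝ, 0 < ρ → sb P Z ρ ≤
      ENNReal.ofReal (C ^ n) *
        sb P (fun t ω => d * LowerClass.rl θ (fun u => Z u ω) t) (d * C * ρ * (n:ℝ) ^ (-θ)) := by
  obtain ⟨C, hC, hE⟩ := Ent.all hθ
  refine ⟨C, hC, fun n hn ρ hρ => ?_⟩
  obtain ⟨N, code, hN, hcode⟩ := hE n hn
  set W : ℝ → Ω → ℝ := fun t ω => d * LowerClass.rl θ (fun u => Z u ω) t with hW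
  have hGW : GP P (H + θ) W := h.rl hθ d
  set r := d * C * ρ * (n:ℝ) ^ (-θ) with hr
  set A : Fin N → Set Ω := fun c => {ω | (∀ s ∈ Icc (0:ℝ) 1, |Z s ω| ≤ ρ) ∧
    code (fun u => ρ⁻¹ * Z u ω) = c} with hA
  have hAc : ∀ c, P (A c) ≤ sb P W r := by
    intro c
    rcases (A c).eq_empty_or_nonempty with h0 | ⟨ω0, h1, h2⟩
    · simp [h0]
    refine le_trans (measure_mono fun ω hω => ?_) (hGW.sb_anderson (fun s => W s ω0) r)
    intro s hs
    have hnorm : ∀ ω, (∀ s ∈ Icc (0:ℝ) 1, |Z s ω| ≤ ρ) → ∀ u ∈ Icc (0:ℝ) 1, |ρ⁻¹ * Z u ω| ≤ 1 := by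
      intro ω hω u hu
      rw [abs_mul, abs_of_pos (inv_pos.2 hρ), inv_mul_le_iff₀ hρ, mul_one]
      exact hω u hu
    have key := hcode _ _ ((h.cont ω).const_mul ρ⁻¹) ((h.cont ω0).const_mul ρ⁻¹) (hnorm ω hω.1)
      (hnorm ω0 h1) (hω.2.trans h2.symm) s hs
    rw [rl_smul, rl_smul, ← mul_sub, abs_mul, abs_of_pos (inv_pos.2 hρ), inv_mul_le_iff₀ hρ] at key
    rw [hW]
    simp only
    rw [← mul_sub, abs_mul, abs_of_pos hd, hr]
    calc _ ≤ d * (ρ * (C * (n:ℝ) ^ (-θ))) := by gcongr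
      _ = _ := by ring
  calc sb P Z ρ ≤ P (⋃ c, A c) := measure_mono fun ω hω => mem_iUnion.2 ⟨_, hω, rfl⟩
    _ ≤ ∑ c, P (A c) := measure_iUnion_fintype_le _ _
    _ ≤ ∑ c : Fin N, sb P W r := Finset.sum_le_sum fun c _ => hAc c
    _ = ENNReal.ofReal N * sb P W r := by simp
    _ ≤ _ := by gcongr

lemma GP.sb_rl_lower (h : GP P H Z) (hθ : 0 < θ) (hd : 0 < d) (hb : 0 < b)
    (hZ : ∃ C : ℝ, 0 < C ∧ ∀ ρ : ℝ, 0 < ρ → ρ ≤ 1 →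
      ENNReal.ofReal (Real.exp (-(C * ρ ^ (-(1 / b))))) ≤ sb P Z ρ) {C0 : ℝ} (hC0 : 0 < C0) :
    ∃ C : ℝ, 0 < C ∧ ∀ ε : ℝ, 0 < ε → ε ≤ C0 →
      ENNReal.ofReal (Real.exp (-(C * ε ^ (-(1 / (b + θ)))))) ≤
        sb P (fun t ω => d * LowerClass.rl θ (fun u => Z u ω) t) ε := by
  obtain ⟨C1, hC1, hX⟩ := hZ
  obtain ⟨C2, hC2, hE⟩ := h.sb_le_entropy hθ hd
  have hβ : 0 < b + θ := by linarith
  set η := min 1 (d * C2 / C0) with hη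
  have hη0 : 0 < η := lt_min one_pos (by positivity)
  set A := C1 + 2 * Real.log C2 with hA
  have hlog : 0 ≤ Real.log C2 := Real.log_nonneg hC2
  refine ⟨A * (η / (d * C2)) ^ (-(1 / (b + θ))), by positivity, fun ε hε hε0 => ?_⟩
  set x := η * ε / (d * C2) with hx
  have hx0 : 0 < x := by positivity
  have hx1 : x ≤ 1 := by
    rw [hx, div_le_one (by positivity)]
    calc η * ε ≤ d * C2 / C0 * C0 := by gcongr; exact min_le_right _ _
      _ = _ := by field_simp
  set ρ := x ^ (b / (b + θ)) with hρ
  have hρ0 : 0 < ρ := by positivity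
  have hρ1 : ρ ≤ 1 := Real.rpow_le_one hx0.le hx1 (by positivity)
  have hρx : ρ ^ (-(1 / b)) = x ^ (-(1 / (b + θ))) := by
    rw [hρ, ← Real.rpow_mul hx0.le]; congr 1; field_simp
  set y := ρ ^ (-(1 / b)) with hy
  have hy1 : 1 ≤ y := Real.one_le_rpow_of_pos_of_le_one_of_nonpos hρ0 hρ1 (by
    have : 0 < 1 / b := by positivity
    linarith)
  set n := ⌈y⌉₊ with hn
  have hyn : y ≤ n := Nat.le_ceil y
  have hn1 : 1 ≤ n := by exact_mod_cast hy1.trans hyn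
  have hn2 : (n:ℝ) ≤ 2 * y := by have := (Nat.ceil_lt_add_one (by linarith : 0 ≤ y)).le; linarith
  have hrad : d * C2 * ρ * (n:ℝ) ^ (-θ) ≤ ε := by
    have e1 : (n:ℝ) ^ (-θ) ≤ y ^ (-θ) := Real.rpow_le_rpow_of_nonpos (by linarith) hyn (by linarith)
    have e2 : ρ * y ^ (-θ) = x := by
      rw [hρx, hρ, ← Real.rpow_mul hx0.le, ← Real.rpow_add hx0]
      conv_rhs => rw [← Real.rpow_one x]
      congr 1; field_simp
    calc _ ≤ d * C2 * (ρ * y ^ (-θ)) := by rw [mul_assoc]; gcongr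
      _ = η * ε := by rw [e2, hx]; field_simp
      _ ≤ 1 * ε := by gcongr; exact min_le_left _ _
      _ = ε := one_mul ε
  have h1 := (hX ρ hρ0 hρ1).trans ((hE n hn1 ρ hρ0).trans (mul_le_mul_right (sb_mono hrad) _))
  have hCn : (0:ℝ) < C2 ^ n := by positivity
  have h2 : ENNReal.ofReal (C2 ^ n)⁻¹ * ENNReal.ofReal (Real.exp (-(C1 * y))) ≤
      sb P (fun t ω => d * LowerClass.rl θ (fun u => Z u ω) t) ε := by
    refine (mul_le_mul_right h1 _).trans ?_
    rw [← mul_assoc, ← ENNReal.ofReal_mul (by positivity), inv_mul_cancel₀ hCn.ne']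
    simp
  refine le_trans ?_ h2
  rw [← ENNReal.ofReal_mul (by positivity)]
  refine ENNReal.ofReal_le_ofReal ?_
  have e3 : (C2 ^ n)⁻¹ = Real.exp (-(n * Real.log C2)) := by
    rw [Real.exp_neg, mul_comm, Real.exp_mul, Real.exp_log (by linarith), Real.rpow_natCast]
  rw [e3, ← Real.exp_add]
  refine Real.exp_le_exp.2 ?_
  have e4 : A * (η / (d * C2)) ^ (-(1 / (b + θ))) * ε ^ (-(1 / (b + θ))) = A * y := by
    rw [mul_assoc, ← Real.mul_rpow (by positivity) hε.le, hρx,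
      show η / (d * C2) * ε = x by rw [hx]; ring]
  rw [e4, hA]
  nlinarith

end smallBallY

section regularity
variable {Ω : Type*} [MeasurableSpace Ω] {P : Measure Ω} [IsProbabilityMeasure P]
  {κ p : ℝ} {Z : ℝ → Ω → ℝ}

/-- Log-concavity and the lower bound of small balls control their relative decay. -/
lemma GP.sb_regular (h : GP P κ Z) {C C0 : ℝ} (hC : 0 < C)
    (hlow : ∀ ε : ℝ, 0 < ε → ε ≤ C0 → ENNReal.ofReal (Real.exp (-(C * ε ^ (-p)))) ≤ sb P Z ε)
    {c : ℝ} (hc : 0 < c) :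
    ∃ K : ℝ, 1 ≤ K ∧ ∀ ε l : ℝ, 0 < ε → ε ≤ C0 → 0 < l → l ≤ 1 / 4 → l ≤ c * ε ^ p →
      sb P Z ε ≤ ENNReal.ofReal K * sb P Z ((1 - l) * ε) := by
  set B := 2 * c * C * 2⁻¹ ^ (-p) with hB
  have hB0 : 0 < B := by positivity
  refine ⟨Real.exp B, Real.one_le_exp hB0.le, fun ε l hε hεC hl hl4 hlc => ?_⟩
  have h1 := h.sb_concave (l := 2 * l) (by linarith) (by linarith) ε (ε / 2)
  rw [show (1 - 2 * l) * ε + 2 * l * (ε / 2) = (1 - l) * ε by ring] at h1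
  have h2 : sb P Z ε ≤ sb P Z ε ^ (1 - 2 * l) := by
    conv_lhs => rw [← ENNReal.rpow_one (sb P Z ε)]
    exact ENNReal.rpow_le_rpow_of_exponent_ge prob_le_one (by linarith)
  have h3 : ENNReal.ofReal (Real.exp (-B)) ≤ sb P Z (ε / 2) ^ (2 * l) := by
    refine le_trans ?_ (ENNReal.rpow_le_rpow (hlow (ε / 2) (by linarith) (by linarith))
      (by linarith : 0 ≤ 2 * l))
    rw [ENNReal.ofReal_rpow_of_pos (Real.exp_pos _), ← Real.exp_mul]
    refine ENNReal.ofReal_le_ofReal (Real.exp_le_exp.2 ?_)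
    have e : (ε / 2) ^ (-p) = 2⁻¹ ^ (-p) * (ε ^ p)⁻¹ := by
      rw [div_eq_mul_inv, Real.mul_rpow hε.le (by norm_num), Real.rpow_neg hε.le, mul_comm]
    have h4 : 2 * l * (C * (ε / 2) ^ (-p)) ≤ B := by
      have hεp : 0 < ε ^ p := by positivity
      rw [e, hB]
      calc _ ≤ 2 * (c * ε ^ p) * (C * (2⁻¹ ^ (-p) * (ε ^ p)⁻¹)) := by gcongr
        _ = _ := by field_simp
    linarith
  calc sb P Z ε = ENNReal.ofReal (Real.exp B) * (sb P Z ε * ENNReal.ofReal (Real.exp (-B))) := by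
        rw [mul_comm (sb P Z ε), ← mul_assoc, ← ENNReal.ofReal_mul (Real.exp_pos _).le,
          ← Real.exp_add]
        simp
    _ ≤ ENNReal.ofReal (Real.exp B) * sb P Z ((1 - l) * ε) := by
        gcongr
        exact (mul_le_mul' h2 h3).trans h1

lemma gaussianReal_Icc_le {v : ℝ≥0} (hv : v ≠ 0) (x : ℝ) :
    gaussianReal 0 v (Icc (-x) x) ≤ ENNReal.ofReal ((√(2 * π * v))⁻¹ * (2 * x)) := by
  rw [gaussianReal_apply 0 hv]
  have hle : ∀ y, gaussianPDF 0 v y ≤ ENNReal.ofReal (√(2 * π * v))⁻¹ := by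
    intro y
    refine ENNReal.ofReal_le_ofReal ?_
    rw [gaussianPDFReal]
    refine mul_le_of_le_one_right (by positivity) (Real.exp_le_one_iff.2 ?_)
    rw [neg_div]
    exact neg_nonpos.2 (by positivity)
  refine (lintegral_mono hle).trans ?_
  rw [setLIntegral_const, Real.volume_Icc, ← ENNReal.ofReal_mul (by positivity)]
  exact ENNReal.ofReal_le_ofReal (by ring_nf; rfl)

/-- Small ball probabilities decay at least linearly unless the process vanishes. -/
lemma GP.sb_linear_or_one (h : GP P κ Z) :
    (∃ D : ℝ, ∀ x : ℝ, sb P Z x ≤ ENNReal.ofReal (D * x)) ∨ ∀ x : ℝ, 0 ≤ x → sb P Z x = 1 := by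
  obtain ⟨v, hv⟩ := h.gaussian (fun _ : Unit => (1:ℝ)) fun _ => 1
  simp only [Finset.univ_unique, one_mul, Finset.sum_const, Finset.card_singleton, one_smul] at hv
  have hae := h.aemeasurable 1
  rcases eq_or_ne v 0 with hv0 | hv0
  · right
    have h1 : P.map (Z 1) = Measure.dirac 0 := by
      rw [show Z 1 = fun ω => Z 1 ω from rfl, hv, hv0, gaussianReal_zero_var]
    have hz : ∀ t : ℝ, 0 < t → ∀ᵐ ω ∂P, Z t ω = 0 := by
      intro t ht
      have hs := h.ss 1 (fun _ => 1) t ht (fun _ => 1)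
      simp only [Finset.univ_unique, one_mul, Finset.sum_const, Finset.card_singleton, one_smul,
        mul_one] at hs
      have h2 : P.map (fun ω => t ^ κ * Z 1 ω) = Measure.dirac 0 := by
        rw [← Function.comp_def (fun y => t ^ κ * y) (Z 1),
          ← AEMeasurable.map_map_of_aemeasurable (by fun_prop) hae, h1,
          Measure.map_dirac' (measurable_const_mul (t ^ κ)), mul_zero]
      rw [h2] at hs
      have : ∀ᵐ y ∂(P.map fun ω => Z t ω), y = 0 := by
        rw [hs]
        exact (ae_dirac_iff (measurableSet_singleton (0:ℝ))).2 rfl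
      exact ae_of_ae_map (h.aemeasurable t) this
    intro x hx
    refine le_antisymm prob_le_one (h.le_sb fun K => ?_)
    have : ∀ᵐ ω ∂P, ∀ j : Fin (2 ^ K + 1), Z ((j:ℕ) / 2 ^ K) ω = 0 := by
      refine ae_all_iff.2 fun j => ?_
      rcases (grid_mem K j).1.eq_or_lt with h0 | h0
      · exact ae_of_all _ fun ω => by rw [← h0]; exact h.zero ω
      · exact hz _ h0
    rw [← measure_univ (μ := P)]
    refine measure_mono_ae ?_
    filter_upwards [this] with ω hω _ j
    rw [hω j, abs_zero]
    exact hx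
  · left
    refine ⟨(√(2 * π * v))⁻¹ * 2, fun x => ?_⟩
    rw [mul_assoc]
    refine le_trans ?_ (gaussianReal_Icc_le hv0 x)
    rw [← hv, Measure.map_apply_of_aemeasurable hae measurableSet_Icc]
    exact measure_mono fun ω hω => abs_le.1 (hω 1 (by simp))

end regularity

section integralTest

lemma tsum_ne_top_of_doubling {ψ : ℝ → ℝ≥0∞} (hψ : Monotone ψ) {D : ℝ}
    (hD : ∀ x, ψ x ≤ ENNReal.ofReal (D * x)) {f : ℕ → ℝ} (hf0 : ∀ n, 0 ≤ f n)
    (hf : ∀ n, f (n + 1) ≤ 2 * f n) {g : ℕ → ℝ≥0∞} (hg : ∑' n, g n ≠ ⊤)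
    (hgood : ∀ n, f n ≤ 2 * f (n + 1) → ψ (f (n + 1)) ≤ g n) : ∑' n, ψ (f n) ≠ ⊤ := by
  set G : ℝ → ℝ≥0∞ := fun x => ∑' k : ℕ, ψ (x / 2 ^ k) with hG
  have hGm : Monotone G := fun x y hxy => ENNReal.tsum_le_tsum fun k => hψ (by gcongr)
  have hGs : ∀ x, G x = ψ x + G (x / 2) := fun x => by
    simp only [hG]
    rw [tsum_eq_zero_add' (f := fun k : ℕ => ψ (x / 2 ^ k)) ENNReal.summable]
    simp only [pow_zero, div_one]
    congr 2; ext k; rw [pow_succ']; congr 1; field_simp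
  have hGt : ∀ x, G x ≠ ⊤ := fun x => by
    have hs : Summable fun k : ℕ => D * x * (1 / 2 : ℝ) ^ k :=
      (summable_geometric_of_lt_one (by norm_num) (by norm_num)).mul_left _
    refine ne_top_of_le_ne_top hs.tsum_ofReal_ne_top (ENNReal.tsum_le_tsum fun k => ?_)
    refine (hD _).trans (le_of_eq ?_)
    congr 1; rw [one_div, inv_pow]; ring
  have key : ∀ N : ℕ, ∑ n ∈ Finset.range N, ψ (f (n + 1)) + G (f N) ≤
      G (f 0) + 2 * ∑ n ∈ Finset.range N, g n := by
    intro N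
    induction N with
    | zero => simp
    | succ N ih =>
      rw [Finset.sum_range_succ, Finset.sum_range_succ]
      have hstep : ψ (f (N + 1)) + G (f (N + 1)) ≤ G (f N) + 2 * g N := by
        rcases le_or_gt (f N) (2 * f (N + 1)) with h | h
        · have h1 := hgood N h
          rw [hGs]
          have h2 : G (f (N + 1) / 2) ≤ G (f N) := hGm (by linarith [hf N])
          calc _ ≤ g N + (g N + G (f N)) := by gcongr
            _ = _ := by ring
        · have h1 : ψ (f (N + 1)) + G (f (N + 1)) ≤ G (f N) := by
            refine le_trans ?_ (hGm h.le)
            rw [hGs (2 * f (N + 1)), mul_div_cancel_left₀ _ (two_ne_zero' ℝ)]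
            gcongr
            exact hψ (by linarith [hf0 (N + 1)])
          exact h1.trans le_self_add
      calc _ = ∑ n ∈ Finset.range N, ψ (f (n + 1)) + (ψ (f (N + 1)) + G (f (N + 1))) := by ring
        _ ≤ ∑ n ∈ Finset.range N, ψ (f (n + 1)) + (G (f N) + 2 * g N) := by gcongr
        _ = (∑ n ∈ Finset.range N, ψ (f (n + 1)) + G (f N)) + 2 * g N := by ring
        _ ≤ (G (f 0) + 2 * ∑ n ∈ Finset.range N, g n) + 2 * g N := by gcongr
        _ = _ := by ring
  have h1 : ∑' n, ψ (f (n + 1)) ≤ G (f 0) + 2 * ∑' n, g n := by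
    rw [ENNReal.tsum_eq_iSup_nat]
    refine iSup_le fun N => le_self_add.trans ((key N).trans ?_)
    gcongr
    exact ENNReal.sum_le_tsum _
  rw [tsum_eq_zero_add' (f := fun n : ℕ => ψ (f n)) ENNReal.summable]
  refine ENNReal.add_ne_top.2 ⟨ne_top_of_le_ne_top ENNReal.ofReal_ne_top (hD _), ?_⟩
  exact ne_top_of_le_ne_top (ENNReal.add_ne_top.2 ⟨hGt _, ENNReal.mul_ne_top (by simp) hg⟩) h1

lemma one_sub_mul_le_one_sub_rpow {κ δ : ℝ} (hδ0 : 0 ≤ δ) (hδ1 : δ ≤ 1) :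
    1 - max κ 1 * δ ≤ (1 - δ) ^ κ := by
  rcases le_total κ 1 with h | h
  · rw [max_eq_right h]
    rcases hδ1.eq_or_lt with rfl | h1
    · simp only [mul_one, sub_self]; positivity
    calc 1 - 1 * δ = (1 - δ) ^ (1:ℝ) := by rw [Real.rpow_one, one_mul]
      _ ≤ _ := Real.rpow_le_rpow_of_exponent_ge (by linarith) (by linarith) h
  · rw [max_eq_left h]
    have := one_add_mul_self_le_rpow_one_add (s := -δ) (by linarith) h
    linarith [show (1 - δ) ^ κ = (1 + -δ) ^ κ by rw [sub_eq_add_neg]]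

/-- Comparison of the integral over one cell with the value of the small ball function. -/
lemma cell_bound {ψ : ℝ → ℝ≥0∞} (hψ : Monotone ψ) {p a b m A K δ : ℝ} (hp : 0 < p)
    {f : ℝ → ℝ} (ha : 0 < a) (hb : 0 < b) (hab : a = b * (1 - δ)) (hm : 0 < m) (hA : 0 < A)
    (hK : 0 ≤ K) {x y : ℝ}
    (hfm : ∀ s ∈ Ioc a b, x ≤ f s) (hfA : ∀ s ∈ Ioc a b, f s ≤ A) (hx : 0 < x)
    (hxy : ψ y ≤ ENNReal.ofReal K * ψ x) (hmA : m ≤ A ^ (-p) * δ) :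
    ψ y ≤ ENNReal.ofReal (K / m) *
      ∫⁻ s in Ioc a b, ENNReal.ofReal (f s ^ (-p)) * ψ (f s) * ENNReal.ofReal s⁻¹ := by
  have hle : ENNReal.ofReal m * ψ x ≤
      ∫⁻ s in Ioc a b, ENNReal.ofReal (f s ^ (-p)) * ψ (f s) * ENNReal.ofReal s⁻¹ := by
    calc ENNReal.ofReal m * ψ x
        ≤ ENNReal.ofReal (A ^ (-p) * δ) * ψ x := by gcongr
      _ = (ENNReal.ofReal (A ^ (-p)) * ψ x * ENNReal.ofReal b⁻¹) * volume (Ioc a b) := by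
        rw [Real.volume_Ioc, mul_assoc _ (ENNReal.ofReal b⁻¹), ← ENNReal.ofReal_mul (by positivity),
          ENNReal.ofReal_mul (by positivity), show b⁻¹ * (b - a) = δ by rw [hab]; field_simp; ring]
        ring
      _ = ∫⁻ s in Ioc a b, ENNReal.ofReal (A ^ (-p)) * ψ x * ENNReal.ofReal b⁻¹ :=
        (setLIntegral_const _ _).symm
      _ ≤ _ := by
        refine setLIntegral_mono' measurableSet_Ioc fun s hs => ?_
        have hs0 : 0 < s := ha.trans hs.1
        refine mul_le_mul' (mul_le_mul' (ENNReal.ofReal_le_ofReal ?_) (hψ (hfm s hs)))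
          (ENNReal.ofReal_le_ofReal (inv_anti₀ hs0 hs.2))
        exact Real.rpow_le_rpow_of_nonpos (hx.trans_le (hfm s hs)) (hfA s hs) (by linarith)
  calc ψ y ≤ ENNReal.ofReal K * ψ x := hxy
    _ = ENNReal.ofReal (K / m) * (ENNReal.ofReal m * ψ x) := by
      rw [← mul_assoc, ← ENNReal.ofReal_mul (by positivity), div_mul_cancel₀ _ hm.ne']
    _ ≤ _ := by gcongr

end integralTest

section cells

lemma exists_cells {T q κ p c C0 : ℝ} (hT : 0 < T) (hκ : 0 < κ) (hp : 0 < p) (hq : 1 ≤ q) {ξ : ℝ → ℝ}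
    (hpos : ∀ t ∈ Ioc 0 T, 0 < ξ t) (hmono : MonotoneOn ξ (Ioc 0 T))
    (hbdd : ∀ t ∈ Ioc 0 T, ξ t / t ^ κ ≤ C0) (hC0 : 0 < C0) (hc : c = (4 * q * C0 ^ p)⁻¹) :
    ∃ τ : ℕ → ℝ, (∀ n, τ n ∈ Ioc 0 T) ∧
      (∀ n, τ (n + 1) = τ n * (1 - c * (ξ (τ n) / τ n ^ κ) ^ p)) ∧
      (∀ n, 0 < c * (ξ (τ n) / τ n ^ κ) ^ p) ∧ (∀ n, q * (c * (ξ (τ n) / τ n ^ κ) ^ p) ≤ 1 / 4) ∧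
      Antitone τ ∧ ∀ t > 0, ∃ n, τ n < t := by
  have hq0 : 0 < q := by linarith
  have hc0 : 0 < c := by rw [hc]; positivity
  set δ : ℝ → ℝ := fun t => c * (ξ t / t ^ κ) ^ p with hδ
  have hf0 : ∀ t ∈ Ioc 0 T, 0 < ξ t / t ^ κ := fun t ht =>
    div_pos (hpos t ht) (Real.rpow_pos_of_pos ht.1 _)
  have hδ0 : ∀ t ∈ Ioc 0 T, 0 < δ t := fun t ht =>
    mul_pos hc0 (Real.rpow_pos_of_pos (hf0 t ht) _)
  have hδ1 : ∀ t ∈ Ioc 0 T, q * δ t ≤ 1 / 4 := fun t ht => by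
    have h1 := Real.rpow_le_rpow (hf0 t ht).le (hbdd t ht) hp.le
    calc q * δ t ≤ q * (c * C0 ^ p) := by simp only [hδ]; gcongr
      _ = 1 / 4 := by rw [hc]; field_simp
  have hδ2 : ∀ t ∈ Ioc 0 T, δ t ≤ 1 / 4 := fun t ht => by nlinarith [hδ1 t ht, hδ0 t ht]
  set τ : ℕ → ℝ := fun n => (fun t => t * (1 - δ t))^[n] T with hτ
  have hsucc : ∀ n, τ (n + 1) = τ n * (1 - δ (τ n)) := fun n =>
    Function.iterate_succ_apply' _ _ _
  have hmem : ∀ n, τ n ∈ Ioc 0 T := by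
    intro n
    induction n with
    | zero => exact ⟨hT, le_rfl⟩
    | succ n ih =>
      rw [hsucc]
      have h1 := hδ0 _ ih
      have h2 := hδ2 _ ih
      exact ⟨mul_pos ih.1 (by linarith), by nlinarith [ih.1, ih.2]⟩
  have hanti : Antitone τ := antitone_nat_of_succ_le fun n => by
    rw [hsucc]
    nlinarith [hδ0 _ (hmem n), (hmem n).1]
  refine ⟨τ, hmem, hsucc, fun n => hδ0 _ (hmem n), fun n => hδ1 _ (hmem n), hanti, fun t ht => ?_⟩
  by_contra! hcon
  have htT : t ∈ Ioc 0 T := ⟨ht, (hcon 0).trans (hmem 0).2⟩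
  set d := c * (ξ t / T ^ κ) ^ p with hd
  have hx0 : 0 < ξ t / T ^ κ := div_pos (hpos t htT) (Real.rpow_pos_of_pos hT _)
  have hd0 : 0 < d := mul_pos hc0 (Real.rpow_pos_of_pos hx0 _)
  have hdδ : ∀ n, d ≤ δ (τ n) := fun n => by
    have h1 : ξ t ≤ ξ (τ n) := hmono htT (hmem n) (hcon n)
    have h2 : 0 < τ n := (hmem n).1
    have h3 : τ n ≤ T := (hmem n).2
    have h4 : 0 < ξ t := hpos t htT
    have h5 := (hpos _ (hmem n)).le
    simp only [hδ, hd]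
    gcongr
  have hd1 : d ≤ 1 / 4 := (hdδ 0).trans (hδ2 _ (hmem 0))
  have hgeo : ∀ n, τ n ≤ T * (1 - d) ^ n := by
    intro n
    induction n with
    | zero => simpa using (hmem 0).2
    | succ n ih =>
      rw [hsucc, pow_succ, ← mul_assoc]
      have h1 := hδ2 _ (hmem n)
      exact mul_le_mul ih (by linarith [hdδ n]) (by linarith)
        (mul_nonneg hT.le (pow_nonneg (by linarith) _))
  have hlim : Tendsto (fun n : ℕ => T * (1 - d) ^ n) atTop (𝓝 (T * 0)) :=
    (tendsto_pow_atTop_nhds_zero_of_lt_one (by linarith) (by linarith)).const_mul T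
  rw [mul_zero] at hlim
  exact absurd (ge_of_tendsto' hlim fun n => (hcon n).trans (hgeo n)) (not_le.2 ht)

/-- Deterministic part of the integral test. -/
lemma integral_test {T κ p C0 : ℝ} (hT : 0 < T) (hκ : 0 < κ) (hp : 0 < p) {ξ : ℝ → ℝ}
    (hpos : ∀ t ∈ Ioc 0 T, 0 < ξ t) (hmono : MonotoneOn ξ (Ioc 0 T))
    (hbdd : ∀ t ∈ Ioc 0 T, ξ t / t ^ κ ≤ C0) (hC0 : 0 < C0)
    {ψ : ℝ → ℝ≥0∞} (hψ : Monotone ψ)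
    (hR : ∀ c > 0, ∃ K : ℝ, 1 ≤ K ∧ ∀ ε l : ℝ, 0 < ε → ε ≤ 2 * C0 → 0 < l → l ≤ 1 / 4 →
      l ≤ c * ε ^ p → ψ ε ≤ ENNReal.ofReal K * ψ ((1 - l) * ε))
    {D : ℝ} (hD : ∀ x, ψ x ≤ ENNReal.ofReal (D * x))
    (hI : ∫⁻ t in Ioc 0 T, ENNReal.ofReal ((ξ t / t ^ κ) ^ (-p)) * ψ (ξ t / t ^ κ) *
      ENNReal.ofReal t⁻¹ ≠ ⊤) :
    ∃ τ : ℕ → ℝ, (∀ n, τ n ∈ Ioc 0 T) ∧ Antitone τ ∧ (∀ t > 0, ∃ n, τ n < t) ∧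
      ∑' n, ψ (ξ (τ n) / τ (n + 1) ^ κ) ≠ ⊤ := by
  set q := max κ 1 with hq
  have hq1 : 1 ≤ q := le_max_right _ _
  have hq0 : 0 < q := by linarith
  set c := (4 * q * C0 ^ p)⁻¹ with hc
  have hc0 : 0 < c := by positivity
  obtain ⟨τ, hmem, hsucc, hδ0, hδq, hanti, hlim⟩ :=
    exists_cells hT hκ hp hq1 hpos hmono hbdd hC0 hc
  refine ⟨τ, hmem, hanti, hlim, ?_⟩
  obtain ⟨K, hK1, hK⟩ := hR (q * c * 2 ^ p) (by positivity)
  set F : ℝ → ℝ := fun t => ξ t / t ^ κ with hF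
  set f : ℕ → ℝ := fun n => F (τ n) with hf
  set δ : ℕ → ℝ := fun n => c * f n ^ p with hδ
  change ∀ n, τ (n + 1) = τ n * (1 - δ n) at hsucc
  change ∀ n, 0 < δ n at hδ0
  change ∀ n, q * δ n ≤ 1 / 4 at hδq
  have hδ1 : ∀ n, δ n ≤ 1 / 4 := fun n => by nlinarith [hδ0 n, hδq n]
  have hf0 : ∀ n, 0 < f n := fun n =>
    div_pos (hpos _ (hmem n)) (Real.rpow_pos_of_pos (hmem n).1 _)
  have hfC : ∀ n, f n ≤ C0 := fun n => hbdd _ (hmem n)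
  set u : ℕ → ℝ := fun n => (1 - δ n) ^ κ with hu
  have hu1 : ∀ n, 1 - q * δ n ≤ u n := fun n =>
    one_sub_mul_le_one_sub_rpow (hδ0 n).le (by linarith [hδ1 n])
  have hu34 : ∀ n, 3 / 4 ≤ u n := fun n => by linarith [hu1 n, hδq n]
  have hult : ∀ n, u n < 1 := fun n =>
    Real.rpow_lt_one (by linarith [hδ1 n]) (by linarith [hδ0 n]) hκ
  have hτu : ∀ n, τ (n + 1) ^ κ = τ n ^ κ * u n := fun n => by
    rw [hsucc, Real.mul_rpow (hmem n).1.le (by linarith [hδ1 n])]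
  have hquot : ∀ n, ξ (τ n) / τ (n + 1) ^ κ = f n / u n := fun n => by
    rw [hτu, ← div_div]
  have hquot' : ∀ n, ξ (τ (n + 1)) / τ n ^ κ = f (n + 1) * u n := fun n => by
    have h1 : (τ n) ^ κ ≠ 0 := (Real.rpow_pos_of_pos (hmem n).1 _).ne'
    have h2 : u n ≠ 0 := by linarith [hu34 n]
    simp only [hf, hF]
    rw [hτu]; field_simp
  have hdouble : ∀ n, f n / u n ≤ 2 * f n := fun n => by
    rw [div_le_iff₀ (by linarith [hu34 n])]
    nlinarith [hf0 n, hu34 n]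
  have hcellup : ∀ n, ∀ s ∈ Icc (τ (n + 1)) (τ n), F s ≤ 2 * f n := fun n s hs => by
    refine le_trans ?_ (hdouble n)
    rw [← hquot]
    have hs0 : 0 < τ (n + 1) := (hmem _).1
    have hsm : s ∈ Ioc 0 T := ⟨hs0.trans_le hs.1, hs.2.trans (hmem n).2⟩
    have h1 : ξ s ≤ ξ (τ n) := hmono hsm (hmem n) hs.2
    have h2 := (hpos _ hsm).le
    have h3 := (hpos _ (hmem n)).le
    have h4 := hs.1
    simp only [hF]
    gcongr
  have hcelllow : ∀ n, ∀ s ∈ Icc (τ (n + 1)) (τ n), u n * f (n + 1) ≤ F s := fun n s hs => by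
    rw [mul_comm, ← hquot']
    have hs0 : 0 < s := (hmem (n + 1)).1.trans_le hs.1
    have hsm : s ∈ Ioc 0 T := ⟨hs0, hs.2.trans (hmem n).2⟩
    have h1 : ξ (τ (n + 1)) ≤ ξ s := hmono (hmem _) hsm hs.1
    have h2 := (hpos _ hsm).le
    have h4 := hs.2
    simp only [hF]
    gcongr
  have hfs : ∀ n, f (n + 1) ≤ 2 * f n := fun n => hcellup n _ ⟨le_rfl, hanti n.le_succ⟩
  have hreg : ∀ n, ψ (f n / u n) ≤ ENNReal.ofReal K * ψ (f n) := fun n => by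
    have hun : 0 < u n := by linarith [hu34 n]
    have hle : f n ≤ f n / u n := by
      rw [le_div_iff₀ hun]; nlinarith [hf0 n, hult n]
    have h1 := hK (f n / u n) (1 - u n) (div_pos (hf0 n) hun)
      ((hdouble n).trans (by linarith [hfC n])) (by linarith [hult n]) (by linarith [hu34 n]) (by
        calc 1 - u n ≤ q * c * 1 * f n ^ p := by
              rw [mul_one, mul_assoc]; linarith [hu1 n]
          _ ≤ q * c * 2 ^ p * (f n / u n) ^ p := by
              have := Real.one_le_rpow one_le_two hp.le
              have := (hf0 n).le
              gcongr)
    rwa [sub_sub_cancel, mul_div_cancel₀ _ hun.ne'] at h1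
  set m := c * 8 ^ (-p) with hm
  have hm0 : 0 < m := by positivity
  set I : ℕ → ℝ≥0∞ := fun n => ∫⁻ s in Ioc (τ (n + 1)) (τ n),
    ENNReal.ofReal (F s ^ (-p)) * ψ (F s) * ENNReal.ofReal s⁻¹ with hIdef
  have hgood : ∀ n, f n ≤ 2 * f (n + 1) → ψ (f (n + 1)) ≤ ENNReal.ofReal (K / m) * I n := by
    intro n hn
    have hun : 0 < u n := by linarith [hu34 n]
    have hf1 := hf0 (n + 1)
    refine cell_bound hψ hp (A := 4 * f (n + 1)) (x := u n * f (n + 1)) (δ := δ n) (hmem _).1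
      (hmem n).1 (hsucc n) hm0 (by linarith) (by linarith)
      (fun s hs => hcelllow n s (Ioc_subset_Icc_self hs))
      (fun s hs => (hcellup n s (Ioc_subset_Icc_self hs)).trans (by linarith))
      (mul_pos hun hf1) ?_ ?_
    · have h1 := hK (f (n + 1)) (1 - u n) hf1 (by linarith [hfC (n + 1)]) (by linarith [hult n])
        (by linarith [hu34 n]) (by
          calc 1 - u n ≤ q * c * f n ^ p := by
                rw [mul_assoc]; linarith [hu1 n]
            _ ≤ q * c * (2 * f (n + 1)) ^ p := by
                have := (hf0 n).le
                gcongr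
            _ = _ := by rw [Real.mul_rpow zero_le_two hf1.le]; ring)
      rwa [sub_sub_cancel] at h1
    · have h2 : (f (n + 1) / 2) ^ p ≤ f n ^ p :=
        Real.rpow_le_rpow (by linarith) (by linarith [hfs n]) hp.le
      have h3 : (4 * f (n + 1)) ^ (-p) * (f (n + 1) / 2) ^ p = 8 ^ (-p) := by
        rw [show f (n + 1) / 2 = (4 * f (n + 1)) * 8⁻¹ by ring,
          Real.mul_rpow (x := 4 * f (n + 1)) (by linarith) (by norm_num), ← mul_assoc,
          ← Real.rpow_add (by linarith), neg_add_cancel, Real.rpow_zero, one_mul,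
          Real.inv_rpow (by norm_num), Real.rpow_neg (by norm_num)]
      calc m = (4 * f (n + 1)) ^ (-p) * (c * (f (n + 1) / 2) ^ p) := by rw [hm, ← h3]; ring
        _ ≤ _ := by simp only [hδ]; gcongr
  have hIsum : ∑' n, I n ≠ ⊤ := by
    refine ne_top_of_le_ne_top hI ?_
    rw [← lintegral_iUnion (fun n => measurableSet_Ioc) (by
      simpa using hanti.pairwise_disjoint_on_Ioc_succ)]
    refine lintegral_mono_set (iUnion_subset fun n => Ioc_subset_Ioc (hmem _).1.le (hmem n).2)
  have hsum : ∑' n, ψ (f n) ≠ ⊤ :=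
    tsum_ne_top_of_doubling hψ hD (fun n => (hf0 n).le) hfs
      (by rw [ENNReal.tsum_mul_left]; exact ENNReal.mul_ne_top ENNReal.ofReal_ne_top hIsum) hgood
  simp_rw [hquot]
  refine ne_top_of_le_ne_top ?_ (ENNReal.tsum_le_tsum hreg)
  rw [ENNReal.tsum_mul_left]
  exact ENNReal.mul_ne_top ENNReal.ofReal_ne_top hsum

end cells

section lowerClass
variable {Ω : Type*} [MeasurableSpace Ω] {P : Measure Ω} [IsProbabilityMeasure P]
  {α γ θ H : ℝ} {X : ℝ → Ω → ℝ}

lemma gfbm_sb_lower (hγ : γ ∈ Ico (0:ℝ) 1) (hα : α ∈ Ioo (-1/2 + γ/2) (1/2))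
    (hH : H = α - γ/2 + 1/2) (hX : IsGFBM P α γ X) :
    ∃ C : ℝ, 0 < C ∧ ∀ ρ : ℝ, 0 < ρ → ρ ≤ 1 →
      ENNReal.ofReal (Real.exp (-(C * ρ ^ (-(1 / (α + 1/2)))))) ≤
        sb P (fun t ω => X (max t 0) ω) ρ := by
  obtain ⟨V, hV, hvar⟩ := increment_variance (P := P) (H := H) (α := α) (γ := γ)
    ⟨by linarith [hα.1, hγ.1], hα.2⟩ hγ (by linarith [hα.1]) (by linarith [hα.2, hγ.1]) hH
  refine (GP.of_isGFBM hH hX).sb_lower hγ.1 (by linarith [hα.1]) (by linarith) hV fun k j => ?_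
  have h2 : (0:ℝ) < 2 ^ k := by positivity
  rw [max_eq_left (by positivity : (0:ℝ) ≤ (j + 1) / 2 ^ k),
    max_eq_left (by positivity : (0:ℝ) ≤ j / 2 ^ k)]
  have := hvar X hX j ((2:ℝ) ^ k)⁻¹ (by positivity)
  simpa only [div_eq_inv_mul] using this

lemma lintegral_const_mul_inv_eq_top {a T : ℝ} (ha : 0 < a) (hT : 0 < T) :
    ∫⁻ t in Ioc 0 T, ENNReal.ofReal a * ENNReal.ofReal t⁻¹ = ⊤ := by
  rw [lintegral_const_mul' _ _ ENNReal.ofReal_ne_top]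
  refine ENNReal.mul_eq_top.2 (Or.inl ⟨by simpa using ha, ?_⟩)
  by_contra hne
  have hInt : IntegrableOn (fun t : ℝ => t⁻¹) (Ioc 0 T) := by
    refine ⟨by fun_prop, ?_⟩
    rw [hasFiniteIntegral_iff_ofReal
      ((ae_restrict_iff' measurableSet_Ioc).2 (ae_of_all _ fun t ht => by
        simpa using ht.1.le))]
    exact lt_top_iff_ne_top.2 hne
  rw [← intervalIntegrable_iff_integrableOn_Ioc_of_le hT.le, intervalIntegrable_inv_iff] at hInt
  rcases hInt with h | h
  · exact hT.ne h
  · exact h left_mem_uIcc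

lemma GP.ae_le_of_tsum {κ T : ℝ} {Z : ℝ → Ω → ℝ} (h : GP P κ Z) {M : ℝ → Ω → ℝ}
    (hM : ∀ ω t x, 0 ≤ t → (M t ω ≤ x ↔ ∀ s ∈ Icc (0:ℝ) t, |Z s ω| ≤ x)) {ξ : ℝ → ℝ}
    (hmono : MonotoneOn ξ (Ioc 0 T)) {τ : ℕ → ℝ} (hmem : ∀ n, τ n ∈ Ioc 0 T) (hanti : Antitone τ)
    (hlim : ∀ t > 0, ∃ n, τ n < t) (hsum : ∑' n, sb P Z (ξ (τ n) / τ (n + 1) ^ κ) ≠ ⊤) :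
    ∀ᵐ ω ∂P, ∃ t₀ > (0:ℝ), ∀ t : ℝ, 0 < t → t < t₀ → ξ t ≤ M t ω := by
  set E : ℕ → Set Ω := fun n => {ω | ∀ s ∈ Icc (0:ℝ) (τ (n + 1)), |Z s ω| ≤ ξ (τ n)} with hE
  have hEsum : ∑' n, P (E n) ≠ ⊤ :=
    ne_top_of_le_ne_top hsum (ENNReal.tsum_le_tsum fun n => h.sb_scaling (hmem (n + 1)).1 _)
  filter_upwards [ae_eventually_notMem hEsum] with ω hω
  obtain ⟨N, hN⟩ := eventually_atTop.1 hω
  refine ⟨τ N, (hmem N).1, fun t ht htN => ?_⟩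
  by_contra! hcon
  classical
  have hex := hlim t ht
  set m := Nat.find hex with hm
  have hmt : τ m < t := Nat.find_spec hex
  have hNm : N < m := by
    by_contra! hle
    exact absurd (hanti hle) (not_le.2 (hmt.trans htN))
  obtain ⟨n, hn⟩ : ∃ n, m = n + 1 := ⟨m - 1, by omega⟩
  have hnt : t ≤ τ n := not_lt.1 (Nat.find_min hex (by omega))
  refine hN n (by omega) fun s hs => ?_
  rw [← hn] at hs
  have h1 := (hM ω t (ξ t) ht.le).1 hcon.le s ⟨hs.1, hs.2.trans hmt.le⟩
  exact h1.trans (hmono ⟨ht, hnt.trans (hmem n).2⟩ (hmem n) hnt)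

end lowerClass
end LowerClass

/-- Sufficiency of the integral test for the lower class of `M` at `0`. -/
theorem lowerClassZero_sufficiency
    {Ω : Type*} [MeasurableSpace Ω] (P : Measure Ω) [IsProbabilityMeasure P]
    (γ α θ H β : ℝ) (hγ : γ ∈ Set.Ico (0:ℝ) 1)
    (hα : α ∈ Set.Ioo (-1/2 + γ/2) (1/2)) (hθ : 0 < θ)
    (hH : H = α - γ/2 + 1/2) (hβ : β = α + θ + 1/2)
    (X : ℝ → Ω → ℝ) (hX : IsGFBM P α γ X)
    (Y : ℝ → Ω → ℝ) (hY : Y = fracInt θ X)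
    (M : ℝ → Ω → ℝ) (hM : M = runSup Y)
    (φ : ℝ → ℝ) (hφ : φ = smallBall P Y)
    (ξ : ℝ → ℝ)
    (hξpos : ∀ t ∈ Set.Ioc (0:ℝ) (Real.exp (Real.exp 1)), 0 < ξ t)
    (hξmono : MonotoneOn ξ (Set.Ioc (0:ℝ) (Real.exp (Real.exp 1))))
    (hξcont : ContinuousOn ξ (Set.Ioc (0:ℝ) (Real.exp (Real.exp 1))))
    (hbdd : ∃ C : ℝ, ∀ t ∈ Set.Ioc (0:ℝ) (Real.exp (Real.exp 1)), ξ t / t ^ (H + θ) ≤ C)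
    (hI : ∫⁻ t in Set.Ioc (0:ℝ) (Real.exp (Real.exp 1)),
        ENNReal.ofReal ((ξ t / t ^ (H + θ)) ^ (-(1/β)) * φ (ξ t / t ^ (H + θ)) / t) < ⊤) :
    ∀ᵐ ω ∂P, ∃ t₀ > (0:ℝ), ∀ t : ℝ, 0 < t → t < t₀ → ξ t ≤ M t ω := by
  set T := Real.exp (Real.exp 1) with hT
  have hT0 : 0 < T := Real.exp_pos _
  have hTm : T ∈ Set.Ioc 0 T := ⟨hT0, le_rfl⟩
  obtain ⟨C0, hC0⟩ := hbdd
  have hfpos : ∀ t ∈ Set.Ioc 0 T, 0 < ξ t / t ^ (H + θ) := fun t ht =>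
    div_pos (hξpos t ht) (Real.rpow_pos_of_pos ht.1 _)
  have hC00 : 0 < C0 := (hfpos T hTm).trans_le (hC0 T hTm)
  have hb : 0 < α + 1/2 := by linarith [hα.1, hγ.1]
  have hβ0 : 0 < β := by linarith
  have hκ0 : 0 < H + θ := by linarith [hα.1]
  have hΓ : 0 < (Real.Gamma θ)⁻¹ := inv_pos.2 (Real.Gamma_pos_of_pos hθ)
  have hGX := LowerClass.GP.of_isGFBM hH hX
  set W : ℝ → Ω → ℝ :=
    fun t ω => (Real.Gamma θ)⁻¹ * LowerClass.rl θ (fun u => X (max u 0) ω) t with hW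
  have hGW : LowerClass.GP P (H + θ) W := hGX.rl hθ _
  have hrun : ∀ ω t x, 0 ≤ t → (M t ω ≤ x ↔ ∀ s ∈ Set.Icc (0:ℝ) t, |W s ω| ≤ x) := by
    intro ω t x ht
    rw [hM]
    refine LowerClass.runSup_le_iff (hGW.cont ω) (fun s hs => ?_) ht x
    rw [hY]
    exact LowerClass.fracInt_eq hθ X hs ω
  have hφsb : ∀ x, φ x = (LowerClass.sb P W x).toReal := by
    intro x
    rw [hφ, smallBall, LowerClass.sb]
    congr 2
    ext ω
    rw [← hM]
    exact hrun ω 1 x zero_le_one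
  have hIeq : ∫⁻ t in Set.Ioc 0 T, ENNReal.ofReal ((ξ t / t ^ (H + θ)) ^ (-(1/β))) *
      LowerClass.sb P W (ξ t / t ^ (H + θ)) * ENNReal.ofReal t⁻¹ ≠ ⊤ := by
    refine ne_of_lt (lt_of_le_of_lt (le_of_eq ?_) hI)
    refine MeasureTheory.setLIntegral_congr_fun measurableSet_Ioc fun t ht => ?_
    have h1 := (Real.rpow_pos_of_pos (hfpos t ht) (-(1/β))).le
    rw [hφsb, div_eq_mul_inv _ t, ENNReal.ofReal_mul (by positivity), ENNReal.ofReal_mul h1,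
      ENNReal.ofReal_toReal (a := LowerClass.sb P W _) (MeasureTheory.measure_ne_top P _)]
  obtain ⟨C, hC, hlow⟩ := hGX.sb_rl_lower hθ hΓ hb (LowerClass.gfbm_sb_lower hγ hα hH hX)
    (C0 := 2 * C0) (by linarith)
  rw [show α + 1/2 + θ = β by linarith] at hlow
  obtain ⟨D, hD⟩ | hone := hGW.sb_linear_or_one
  · obtain ⟨τ, hmem, hanti, hlim, hsum⟩ := LowerClass.integral_test hT0 hκ0
      (one_div_pos.2 hβ0) hξpos hξmono hC0 hC00 LowerClass.sb_mono
      (fun c hc => hGW.sb_regular hC hlow hc) hD hIeq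
    exact hGW.ae_le_of_tsum hrun hξmono hmem hanti hlim hsum
  · refine absurd ?_ hIeq
    rw [eq_top_iff, ← LowerClass.lintegral_const_mul_inv_eq_top
      (Real.rpow_pos_of_pos hC00 (-(1/β))) hT0]
    refine MeasureTheory.setLIntegral_mono' measurableSet_Ioc fun t ht => ?_
    rw [hone _ (hfpos t ht).le, mul_one]
    gcongr ?_ * _
    refine ENNReal.ofReal_le_ofReal ?_
    exact Real.rpow_le_rpow_of_nonpos (hfpos t ht) (hC0 t ht)
      (neg_nonpos.2 (one_div_pos.2 hβ0).le)
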